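/- Every automorphism of the d-dimensional torus T^d = R^d/Z^d (induced by a matrix A ∈ GL_d(Z)) is universal: for every invertible ergodic measure-preserving transformation T of a non-atomic Lebesgue probability space (X, μ) whose measure-theoretic entropy h_μ(T) is strictly less than the topological entropy of the toral automorphism, there exists an embedding of (X, μ, T) into the toral automorphism system. -/

import Mathlib

open MeasureTheory Filter Set
open scoped ENNReal

/-- Shannon entropy of the finite-valued observable `P` with respect to `μ`. -/
noncomputable def infoEntropy {X : Type*} [MeasurableSpace X] (μ : Measure X)
    {α : Type*} [Fintype α] (P : X → α) : ℝ :=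
  ∑ a : α, Real.negMulLog (μ (P ⁻¹' {a})).toReal

/-- Entropy of the transformation `T` with respect to the observable (finite partition) `P`. -/
noncomputable def entropyWrt {X : Type*} [MeasurableSpace X] (μ : Measure X) (T : X → X)
    {α : Type*} [Fintype α] (P : X → α) : ℝ :=
  Filter.atTop.liminf fun n : ℕ =>
    infoEntropy μ (fun x => fun i : Fin n => P (T^[(i : ℕ)] x)) / n

/-- Kolmogorov–Sinai (measure-theoretic) entropy of `T` with respect to `μ`. -/
noncomputable def ksEntropy {X : Type*} [MeasurableSpace X] (μ : Measure X) (T : X → X) : ℝ≥0∞ :=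
  ⨆ (k : ℕ) (P : X → Fin k) (_ : Measurable P), ENNReal.ofReal (entropyWrt μ T P)

/-- Topological entropy (Bowen–Dinaburg, via dynamical covers). -/
noncomputable def topEntropy {Y : Type*} [UniformSpace Y] (S : Y → Y) : EReal :=
  Dynamics.coverEntropy S Set.univ

/-- `Ψ` is an embedding of the measure-preserving system `(X, μ, T)` into `(Y, S)`:
it is measurable, and on some set of full measure it is injective and equivariant. -/
def IsMeasEmbedding {X Y : Type*} [MeasurableSpace X] [MeasurableSpace Y]
    (μ : Measure X) (T : X → X) (S : Y → Y) (Ψ : X → Y) : Prop :=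
  Measurable Ψ ∧ ∃ X' : Set X, MeasurableSet X' ∧ μ X'ᶜ = 0 ∧ Set.InjOn Ψ X' ∧
    ∀ x ∈ X', Ψ (T x) = S (Ψ x)

/-- `(Y, S)` is universal: every invertible ergodic measure-preserving transformation of a
non-atomic Lebesgue (standard Borel) probability space with measure-theoretic entropy strictly
less than the topological entropy of `S` embeds into `(Y, S)`. -/
def Universal {Y : Type*} [UniformSpace Y] [MeasurableSpace Y] (S : Y → Y) : Prop :=
  ∀ (X : Type) [MeasurableSpace X] (μ : Measure X) (T : X ≃ᵐ X),
    StandardBorelSpace X → IsProbabilityMeasure μ → NoAtoms μ → Ergodic (⇑T) μ →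
    (ksEntropy μ (⇑T) : EReal) < topEntropy S →
    ∃ Ψ : X → Y, IsMeasEmbedding μ (⇑T) S Ψ

/-- The `d`-dimensional torus `ℝ^d/ℤ^d`. -/
abbrev Torus (d : ℕ) := Fin d → AddCircle (1 : ℝ)

/-- The automorphism of the torus induced by an integer matrix `A`. -/
noncomputable def toralAut {d : ℕ} (A : Matrix (Fin d) (Fin d) ℤ) : Torus d → Torus d :=
  fun x i => ∑ j : Fin d, A i j • x j

/-! ### Entropy of finite observables -/

/-- A map is countably measurable if it has countable range and measurable fibres. -/
def CM {X α : Type*} [MeasurableSpace X] (P : X → α) : Prop :=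
  (range P).Countable ∧ ∀ a, MeasurableSet (P ⁻¹' {a})

namespace CM

variable {X α β : Type*} [MeasurableSpace X]

theorem preimage {P : X → α} (hP : CM P) (s : Set α) : MeasurableSet (P ⁻¹' s) := by
  have : P ⁻¹' s = ⋃ a ∈ s ∩ range P, P ⁻¹' {a} := by
    ext x; simp
  rw [this]
  exact MeasurableSet.biUnion (hP.1.mono inter_subset_right) fun a _ => hP.2 a

theorem setOf {P : X → α} (hP : CM P) (p : α → Prop) : MeasurableSet {x | p (P x)} :=
  hP.preimage {a | p a}

theorem measurable [MeasurableSpace α] {P : X → α} (hP : CM P) : Measurable P :=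
  fun s _ => hP.preimage s

theorem comp {P : X → α} (hP : CM P) (φ : α → β) : CM fun x => φ (P x) := by
  refine ⟨?_, fun b => hP.preimage (φ ⁻¹' {b})⟩
  have : (range fun x => φ (P x)) = φ '' range P := by rw [← range_comp]; rfl
  rw [this]
  exact hP.1.image φ

theorem prodMk {P : X → α} {Q : X → β} (hP : CM P) (hQ : CM Q) : CM fun x => (P x, Q x) := by
  refine ⟨(hP.1.prod hQ.1).mono ?_, fun a => ?_⟩
  · rintro _ ⟨x, rfl⟩; exact ⟨⟨x, rfl⟩, ⟨x, rfl⟩⟩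
  · have : (fun x => (P x, Q x)) ⁻¹' {a} = P ⁻¹' {a.1} ∩ Q ⁻¹' {a.2} := by
      ext x; simp [Prod.ext_iff]
    rw [this]; exact (hP.2 _).inter (hQ.2 _)

theorem compMeas {Y : Type*} [MeasurableSpace Y] {P : X → α} (hP : CM P) {T : Y → X}
    (hT : Measurable T) : CM fun y => P (T y) :=
  ⟨hP.1.mono (range_comp_subset_range T P), fun a => hT (hP.2 a)⟩

theorem pi {ι : Type*} [Finite ι] {P : ι → X → α} (hP : ∀ i, CM (P i)) :
    CM fun x i => P i x := by
  refine ⟨(Set.countable_univ_pi fun i => (hP i).1).mono ?_, fun a => ?_⟩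
  · rintro _ ⟨x, rfl⟩ i _; exact ⟨x, rfl⟩
  · have : (fun x i => P i x) ⁻¹' {a} = ⋂ i, P i ⁻¹' {a i} := by
      ext x; simp [funext_iff]
    rw [this]; exact MeasurableSet.iInter fun i => (hP i).2 _

theorem of_countable [Countable α] {P : X → α} (h : ∀ a, MeasurableSet (P ⁻¹' {a})) : CM P :=
  ⟨Set.to_countable _, h⟩

theorem const (a : α) : CM fun _ : X => a :=
  ⟨(Set.countable_singleton a).mono (range_const_subset), fun b =>
    measurable_const (by trivial : @MeasurableSet α ⊤ {b})⟩

theorem prop {s : Set X} (hs : MeasurableSet s) : CM fun x => x ∈ s :=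
  of_countable fun a => by
    by_cases h : a
    · have : (fun x => x ∈ s) ⁻¹' {a} = s := by ext x; simp [h]
      rwa [this]
    · have : (fun x => x ∈ s) ⁻¹' {a} = sᶜ := by ext x; simp [h]
      rw [this]; exact hs.compl

end CM

/-- The `n`-name of a point with respect to an observable. -/
def nm {X α : Type*} (T : X → X) (P : X → α) (n : ℕ) (x : X) : Fin n → α :=
  fun i => P (T^[(i : ℕ)] x)

theorem CM.nm {X α : Type*} [MeasurableSpace X] {T : X → X} (hT : Measurable T) {P : X → α}
    (hP : CM P) (n : ℕ) : CM (nm T P n) :=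
  CM.pi fun _ => hP.compMeas (hT.iterate _)

section finite

variable {X α β : Type*} [MeasurableSpace X] {μ : Measure X} [Fintype α] [Fintype β]

open Classical in
theorem measureReal_preimage_eq_sum [IsProbabilityMeasure μ] {P : X → α} (hP : CM P) (s : Set α) :
    μ.real (P ⁻¹' s) = ∑ a : α, if a ∈ s then μ.real (P ⁻¹' {a}) else 0 := by
  rw [← Finset.sum_filter]
  have := sum_measureReal_preimage_singleton (μ := μ) (Finset.univ.filter (· ∈ s)) (f := P)
    (fun y _ => hP.2 y)
  rw [this]; congr 2; ext x; simp

theorem sum_measureReal_fibre [IsProbabilityMeasure μ] {P : X → α} (hP : CM P) :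
    ∑ a, μ.real (P ⁻¹' {a}) = 1 := by
  have := measureReal_preimage_eq_sum (μ := μ) hP univ
  simpa using this.symm

theorem sum_measureReal_prod_snd [IsProbabilityMeasure μ] {P : X → α} {Q : X → β} (hP : CM P)
    (hQ : CM Q) (a : α) :
    ∑ b, μ.real ((fun x => (P x, Q x)) ⁻¹' {(a, b)}) = μ.real (P ⁻¹' {a}) := by
  classical
  have := measureReal_preimage_eq_sum (μ := μ) (hP.prodMk hQ) {c | c.1 = a}
  rw [Fintype.sum_prod_type, Finset.sum_eq_single a] at this
  · simp only [mem_ofPred_eq, if_true] at this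
    rw [← this]; rfl
  · intro b _ hb; simp [hb]
  · simp

theorem sum_measureReal_prod_fst [IsProbabilityMeasure μ] {P : X → α} {Q : X → β} (hP : CM P)
    (hQ : CM Q) (b : β) :
    ∑ a, μ.real ((fun x => (P x, Q x)) ⁻¹' {(a, b)}) = μ.real (Q ⁻¹' {b}) := by
  rw [← sum_measureReal_prod_snd (μ := μ) hQ hP b]
  refine Finset.sum_congr rfl fun a _ => ?_
  congr 1; ext x; simp [and_comm]

/-- Integral of a function of a finite-valued observable. -/
theorem integral_comp_finite [IsProbabilityMeasure μ] {P : X → α} (hP : CM P) (φ : α → ℝ) :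
    ∫ x, φ (P x) ∂μ = ∑ a, μ.real (P ⁻¹' {a}) * φ a := by
  classical
  have h1 : ∀ x, φ (P x) = ∑ a, (P ⁻¹' {a}).indicator (fun _ => φ a) x := by
    intro x
    rw [Finset.sum_eq_single (P x)]
    · simp
    · intro b _ hb; simp [Ne.symm hb]
    · simp
  simp_rw [h1]
  rw [integral_finsetSum]
  · refine Finset.sum_congr rfl fun a _ => ?_
    rw [integral_indicator (hP.2 a), setIntegral_const, smul_eq_mul]
  · intro a _; exact (integrable_const _).indicator (hP.2 a)

theorem integrable_comp_finite [IsProbabilityMeasure μ] {P : X → α} (hP : CM P) (φ : α → ℝ) :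
    Integrable (fun x => φ (P x)) μ := by
  refine Integrable.of_bound (C := ∑ a, |φ a|) (hP.comp φ).measurable.aestronglyMeasurable ?_
  refine Eventually.of_forall fun x => ?_
  exact Finset.single_le_sum (f := fun a => |φ a|) (fun _ _ => abs_nonneg _) (Finset.mem_univ (P x))

theorem infoEntropy_eq (P : X → α) :
    infoEntropy μ P = ∑ a, Real.negMulLog (μ.real (P ⁻¹' {a})) := rfl

theorem infoEntropy_nonneg [IsProbabilityMeasure μ] (P : X → α) : 0 ≤ infoEntropy μ P :=
  Finset.sum_nonneg fun _ _ => Real.negMulLog_nonneg measureReal_nonneg measureReal_le_one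

theorem infoEntropy_eq_integral [IsProbabilityMeasure μ] {P : X → α} (hP : CM P) :
    infoEntropy μ P = ∫ x, -Real.log (μ.real (P ⁻¹' {P x})) ∂μ := by
  rw [integral_comp_finite hP (fun a => -Real.log (μ.real (P ⁻¹' {a}))), infoEntropy_eq]
  refine Finset.sum_congr rfl fun a _ => ?_
  rw [Real.negMulLog]; ring

theorem sum_negMulLog_le (p : α → β → ℝ) (hp : ∀ a b, 0 ≤ p a b) (h1 : ∑ a, ∑ b, p a b = 1) :
    ∑ a, ∑ b, Real.negMulLog (p a b) ≤
      ∑ a, Real.negMulLog (∑ b, p a b) + ∑ b, Real.negMulLog (∑ a, p a b) := by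
  set q : α → ℝ := fun a => ∑ b, p a b
  set r : β → ℝ := fun b => ∑ a, p a b
  have hq : ∀ a, 0 ≤ q a := fun a => Finset.sum_nonneg fun b _ => hp a b
  have hr : ∀ b, 0 ≤ r b := fun b => Finset.sum_nonneg fun a _ => hp a b
  have key : ∀ a b, Real.negMulLog (p a b) ≤
      -(p a b * Real.log (q a)) - p a b * Real.log (r b) + q a * r b - p a b := by
    intro a b
    rcases (hp a b).eq_or_lt with h | h
    · simp [← h]; positivity [hq a, hr b]
    · have hqa : p a b ≤ q a :=
        Finset.single_le_sum (f := fun b => p a b) (fun b _ => hp a b) (Finset.mem_univ b)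
      have hrb : p a b ≤ r b :=
        Finset.single_le_sum (f := fun a => p a b) (fun a _ => hp a b) (Finset.mem_univ a)
      have hq0 : 0 < q a := h.trans_le hqa
      have hr0 : 0 < r b := h.trans_le hrb
      have := Real.log_le_sub_one_of_pos (show 0 < q a * r b / p a b by positivity)
      rw [Real.log_div (by positivity) h.ne', Real.log_mul hq0.ne' hr0.ne'] at this
      have h2 := mul_le_mul_of_nonneg_left this h.le
      have h3 : p a b * (q a * r b / p a b - 1) = q a * r b - p a b := by field_simp
      rw [h3] at h2
      rw [Real.negMulLog]; linarith
  have hsum := Finset.sum_le_sum fun a (_ : a ∈ Finset.univ) =>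
    Finset.sum_le_sum fun b (_ : b ∈ Finset.univ) => key a b
  refine hsum.trans (le_of_eq ?_)
  simp only [Finset.sum_add_distrib, Finset.sum_sub_distrib, Finset.sum_neg_distrib]
  have h1' : ∑ a, ∑ b, p a b = 1 := h1
  have e1 : ∑ a, ∑ b, p a b * Real.log (q a) = ∑ a, q a * Real.log (q a) := by
    refine Finset.sum_congr rfl fun a _ => by rw [← Finset.sum_mul]
  have e2 : ∑ a, ∑ b, p a b * Real.log (r b) = ∑ b, r b * Real.log (r b) := by
    rw [Finset.sum_comm]
    refine Finset.sum_congr rfl fun a _ => by rw [← Finset.sum_mul]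
  have e3 : ∑ a, ∑ b, q a * r b = 1 := by
    simp_rw [← Finset.mul_sum, ← Finset.sum_mul]
    have : ∑ b, r b = 1 := by rw [← h1, Finset.sum_comm]
    rw [this]; simpa [q] using h1
  rw [e1, e2, e3, h1']
  simp only [Real.negMulLog, neg_mul, Finset.sum_neg_distrib]
  change _ = -∑ a, q a * Real.log (q a) + -∑ b, r b * Real.log (r b)
  ring

theorem infoEntropy_prod_le [IsProbabilityMeasure μ] {P : X → α} {Q : X → β} (hP : CM P)
    (hQ : CM Q) : infoEntropy μ (fun x => (P x, Q x)) ≤ infoEntropy μ P + infoEntropy μ Q := by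
  have := sum_negMulLog_le (fun a b => μ.real ((fun x => (P x, Q x)) ⁻¹' {(a, b)}))
    (fun _ _ => measureReal_nonneg) (by
      simp_rw [sum_measureReal_prod_snd hP hQ]; exact sum_measureReal_fibre hP)
  simp_rw [sum_measureReal_prod_snd hP hQ, sum_measureReal_prod_fst hP hQ] at this
  rw [infoEntropy_eq, Fintype.sum_prod_type]
  exact this

theorem ae_measureReal_fibre_pos [IsProbabilityMeasure μ] (P : X → α) :
    ∀ᵐ x ∂μ, 0 < μ.real (P ⁻¹' {P x}) := by
  have : ∀ a, ∀ᵐ x ∂μ, P x = a → 0 < μ.real (P ⁻¹' {a}) := by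
    intro a
    rcases (measureReal_nonneg (μ := μ) (s := P ⁻¹' {a})).eq_or_lt with h | h
    · have h0 : μ (P ⁻¹' {a}) = 0 := by
        rwa [eq_comm, measureReal_eq_zero_iff] at h
      have : ∀ᵐ x ∂μ, x ∉ P ⁻¹' {a} := measure_eq_zero_iff_ae_notMem.1 h0
      filter_upwards [this] with x hx hxa
      exact absurd hxa hx
    · exact Eventually.of_forall fun _ _ => h
  filter_upwards [ae_all_iff.2 this] with x hx using hx _ rfl

theorem infoEntropy_comp_le [IsProbabilityMeasure μ] {P : X → α} (hP : CM P) (φ : α → β) :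
    infoEntropy μ (fun x => φ (P x)) ≤ infoEntropy μ P := by
  rw [infoEntropy_eq_integral hP, infoEntropy_eq_integral (hP.comp φ)]
  refine integral_mono_ae (integrable_comp_finite hP fun a =>
    -Real.log (μ.real ((fun x => φ (P x)) ⁻¹' {φ a})))
    (integrable_comp_finite hP fun a => -Real.log (μ.real (P ⁻¹' {a}))) ?_
  have hpos := ae_measureReal_fibre_pos (μ := μ) P
  filter_upwards [hpos] with x hx
  refine neg_le_neg (Real.log_le_log hx (measureReal_mono ?_))
  intro y hy
  simp only [mem_preimage, mem_singleton_iff] at hy ⊢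
  rw [hy]

theorem infoEntropy_le_of_factor [IsProbabilityMeasure μ] {P : X → α} (hP : CM P) {Q : X → β}
    (φ : α → β) (h : ∀ x, Q x = φ (P x)) : infoEntropy μ Q ≤ infoEntropy μ P := by
  obtain rfl : Q = fun x => φ (P x) := funext h
  exact infoEntropy_comp_le hP φ

theorem infoEntropy_comp_measurePreserving {T : X → X} (hT : MeasurePreserving T μ μ)
    {P : X → α} (hP : CM P) : infoEntropy μ (fun x => P (T x)) = infoEntropy μ P := by
  rw [infoEntropy_eq, infoEntropy_eq]
  refine Finset.sum_congr rfl fun a _ => ?_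
  have : (fun x => P (T x)) ⁻¹' {a} = T ⁻¹' (P ⁻¹' {a}) := rfl
  rw [this, hT.measureReal_preimage (hP.2 a).nullMeasurableSet]

theorem infoEntropy_le_log [IsProbabilityMeasure μ] {P : X → α} (hP : CM P) :
    infoEntropy μ P ≤ Real.log (Fintype.card α) := by
  have h1 := sum_measureReal_fibre (μ := μ) hP
  have hne : Nonempty α := by
    by_contra h
    rw [not_nonempty_iff] at h
    simp at h1
  have hc : (0 : ℝ) < Fintype.card α := by exact_mod_cast Fintype.card_pos
  have key : ∀ a, Real.negMulLog (μ.real (P ⁻¹' {a})) ≤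
      μ.real (P ⁻¹' {a}) * Real.log (Fintype.card α) +
        (1 / (Fintype.card α : ℝ) - μ.real (P ⁻¹' {a})) := by
    intro a
    set p := μ.real (P ⁻¹' {a})
    rcases (measureReal_nonneg (μ := μ) (s := P ⁻¹' {a})).eq_or_lt with h | h
    · have : p = 0 := h.symm
      simp [this]
    · change 0 < p at h
      have := Real.log_le_sub_one_of_pos (show 0 < 1 / ((Fintype.card α : ℝ) * p) by positivity)
      rw [Real.log_div one_ne_zero (by positivity), Real.log_one, Real.log_mul hc.ne' h.ne'] at this
      have h2 := mul_le_mul_of_nonneg_left this h.le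
      have h3 : p * (1 / ((Fintype.card α : ℝ) * p) - 1) = 1 / (Fintype.card α : ℝ) - p := by
        field_simp
      rw [h3] at h2
      rw [Real.negMulLog]; linarith
  refine (Finset.sum_le_sum fun a _ => key a).trans (le_of_eq ?_)
  rw [Finset.sum_add_distrib, Finset.sum_sub_distrib, ← Finset.sum_mul, h1]
  simp [hc.ne']

end finite

/-! ### Entropy of a transformation with respect to an observable -/

section process

variable {X α β : Type*} [MeasurableSpace X] {μ : Measure X} [IsProbabilityMeasure μ] [Fintype α]
  [Fintype β] {T : X → X}

theorem nm_add {X α : Type*} {T : X → X} (P : X → α) (m n : ℕ) (x : X) :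
    nm T P (m + n) x = Fin.append (nm T P m x) (nm T P n (T^[m] x)) := by
  funext i
  refine Fin.addCases (fun j => ?_) (fun j => ?_) i
  · simp [nm]
  · simp only [nm, Fin.append_right, Fin.val_natAdd]
    rw [← Function.iterate_add_apply, Nat.add_comm]

theorem subadditive_infoEntropy (hT : MeasurePreserving T μ μ) {P : X → α} (hP : CM P) :
    Subadditive fun n => infoEntropy μ (nm T P n) := by
  intro m n
  have hm := hP.nm hT.measurable m
  have hn := (hP.nm hT.measurable n).compMeas (hT.measurable.iterate m)
  have h1 : infoEntropy μ (nm T P (m + n)) ≤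
      infoEntropy μ (fun x => (nm T P m x, nm T P n (T^[m] x))) := by
    exact infoEntropy_le_of_factor (hm.prodMk hn) (fun c => Fin.append c.1 c.2)
      fun x => nm_add P m n x
  have h2 := infoEntropy_prod_le (μ := μ) hm hn
  have h3 := infoEntropy_comp_measurePreserving (hT.iterate m) (hP.nm hT.measurable n)
  exact h1.trans (h2.trans_eq (by rw [h3]))

theorem infoEntropy_div_bddBelow (P : X → α) :
    BddBelow (range fun n : ℕ => infoEntropy μ (nm T P n) / n) := by
  refine ⟨0, ?_⟩
  rintro _ ⟨n, rfl⟩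
  exact div_nonneg (infoEntropy_nonneg _) (Nat.cast_nonneg _)

theorem tendsto_entropyWrt (hT : MeasurePreserving T μ μ) {P : X → α} (hP : CM P) :
    Tendsto (fun n : ℕ => infoEntropy μ (nm T P n) / n) atTop (nhds (entropyWrt μ T P)) := by
  have h := (subadditive_infoEntropy hT hP).tendsto_lim (infoEntropy_div_bddBelow P)
  have : entropyWrt μ T P = (subadditive_infoEntropy hT hP).lim := h.liminf_eq
  rwa [this]

theorem entropyWrt_nonneg (hT : MeasurePreserving T μ μ) {P : X → α} (hP : CM P) :
    0 ≤ entropyWrt μ T P :=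
  ge_of_tendsto' (tendsto_entropyWrt hT hP) fun _ =>
    div_nonneg (infoEntropy_nonneg _) (Nat.cast_nonneg _)

theorem entropyWrt_comp_le (hT : MeasurePreserving T μ μ) {P : X → α} (hP : CM P) (φ : α → β) :
    entropyWrt μ T (fun x => φ (P x)) ≤ entropyWrt μ T P := by
  refine le_of_tendsto_of_tendsto' (tendsto_entropyWrt hT (hP.comp φ)) (tendsto_entropyWrt hT hP)
    fun n => ?_
  refine div_le_div_of_nonneg_right ?_ (Nat.cast_nonneg _)
  exact infoEntropy_comp_le (hP.nm hT.measurable n) fun w i => φ (w i)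

theorem entropyWrt_le_ksEntropy (hT : MeasurePreserving T μ μ) (hfin : ksEntropy μ T ≠ ∞)
    {P : X → α} (hP : CM P) : entropyWrt μ T P ≤ (ksEntropy μ T).toReal := by
  have e := Fintype.equivFin α
  have h1 := entropyWrt_comp_le hT (hP.comp e) e.symm
  simp only [Equiv.symm_apply_apply] at h1
  have h2 : ENNReal.ofReal (entropyWrt μ T fun x => e (P x)) ≤ ksEntropy μ T :=
    le_iSup_of_le _ (le_iSup_of_le _ (le_iSup_of_le (hP.comp e).measurable le_rfl))
  exact h1.trans ((ENNReal.ofReal_le_iff_le_toReal hfin).1 h2)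

theorem exists_entropyWrt_gt (hT : MeasurePreserving T μ μ) (hfin : ksEntropy μ T ≠ ∞) {η : ℝ}
    (hη : 0 < η) :
    ∃ (k : ℕ) (P : X → Fin k), CM P ∧ (ksEntropy μ T).toReal - η < entropyWrt μ T P := by
  by_cases h : (ksEntropy μ T).toReal - η < 0
  · exact ⟨1, fun _ => 0, CM.const _, h.trans_le (entropyWrt_nonneg hT (CM.const _))⟩
  · have h1 : ENNReal.ofReal ((ksEntropy μ T).toReal - η) < ksEntropy μ T := by
      rw [ENNReal.ofReal_lt_iff_lt_toReal (not_lt.1 h) hfin]; linarith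
    unfold ksEntropy at h1
    simp only [lt_iSup_iff] at h1
    obtain ⟨k, P, hP, h2⟩ := h1
    refine ⟨k, P, CM.of_countable fun a => hP (measurableSet_singleton a), ?_⟩
    have := (ENNReal.ofReal_lt_ofReal_iff_of_nonneg (not_lt.1 h)).1 h2
    exact this

theorem infoEntropy_nm_le (hT : MeasurePreserving T μ μ) {P : X → α} (hP : CM P) (n : ℕ) :
    infoEntropy μ (nm T P n) ≤ n * infoEntropy μ P := by
  induction n with
  | zero =>
    refine (infoEntropy_le_log (hP.nm hT.measurable 0)).trans ?_
    simp
  | succ n ih =>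
    have h1 : infoEntropy μ (nm T P (n + 1)) ≤
        infoEntropy μ (nm T P n) + infoEntropy μ (nm T P 1) :=
      subadditive_infoEntropy hT hP n 1
    have h2 : infoEntropy μ (nm T P 1) ≤ infoEntropy μ P :=
      infoEntropy_le_of_factor hP (fun a _ => a) fun x => by
        funext i; simp [nm, Subsingleton.elim i 0]
    push_cast; linarith

open Classical in
/-- The observable recording the value of `P` where it differs from `Q`. -/
noncomputable def diffObs (P Q : X → α) (x : X) : Option α := if P x = Q x then none else some (P x)

theorem entropyWrt_le_add_diffObs (hT : MeasurePreserving T μ μ) {P Q : X → α} (hP : CM P)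
    (hQ : CM Q) : entropyWrt μ T P ≤ entropyWrt μ T Q + infoEntropy μ (diffObs P Q) := by
  have hD : CM (diffObs P Q) := by
    classical
    exact (hP.prodMk hQ).comp fun c => if c.1 = c.2 then none else some c.1
  refine le_of_tendsto_of_tendsto (tendsto_entropyWrt hT hP)
    ((tendsto_entropyWrt hT hQ).add_const _) ?_
  filter_upwards [eventually_gt_atTop 0] with n hn
  have hn' : (0 : ℝ) < n := by exact_mod_cast hn
  have h1 : infoEntropy μ (nm T P n) ≤
      infoEntropy μ (fun x => (nm T Q n x, nm T (diffObs P Q) n x)) := by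
    refine infoEntropy_le_of_factor ((hQ.nm hT.measurable n).prodMk (hD.nm hT.measurable n))
      (fun c i => (c.2 i).getD (c.1 i)) fun x => ?_
    funext i
    simp only [nm, diffObs]
    split_ifs with h <;> simp [h]
  have h2 := infoEntropy_prod_le (μ := μ) (hQ.nm hT.measurable n) (hD.nm hT.measurable n)
  have h3 := infoEntropy_nm_le hT hD n
  rw [div_add' _ _ _ hn'.ne']
  exact div_le_div_of_nonneg_right (by linarith) (Nat.cast_nonneg _)

/-- Entropy depends continuously on the observable. -/
theorem exists_entropyWrt_close (α : Type*) [Fintype α] (hT : MeasurePreserving T μ μ) {η : ℝ}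
    (hη : 0 < η) : ∃ ρ > 0, ∀ P Q : X → α, CM P → CM Q → μ.real {x | P x ≠ Q x} < ρ →
      entropyWrt μ T P ≤ entropyWrt μ T Q + η := by
  classical
  set c : ℝ := (Fintype.card (Option α) : ℝ) with hc
  have hc0 : 0 < c := by rw [hc]; exact_mod_cast Fintype.card_pos
  have h0 : ∀ᶠ t in nhds (0 : ℝ), Real.negMulLog t < η / c :=
    Real.continuous_negMulLog.continuousAt.eventually_lt continuousAt_const (by simp; positivity)
  have h1 : ∀ᶠ t in nhds (1 : ℝ), Real.negMulLog t < η / c :=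
    Real.continuous_negMulLog.continuousAt.eventually_lt continuousAt_const (by simp; positivity)
  obtain ⟨r0, hr0, h0⟩ := Metric.eventually_nhds_iff.1 h0
  obtain ⟨r1, hr1, h1⟩ := Metric.eventually_nhds_iff.1 h1
  refine ⟨min r0 r1, lt_min hr0 hr1, fun P Q hP hQ hlt => ?_⟩
  refine (entropyWrt_le_add_diffObs hT hP hQ).trans (add_le_add_right ?_ _)
  have hm : MeasurableSet {x | P x ≠ Q x} := (hP.prodMk hQ).setOf fun c => c.1 ≠ c.2
  have hterm : ∀ a, Real.negMulLog (μ.real (diffObs P Q ⁻¹' {a})) ≤ η / c := by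
    intro a
    cases a with
    | none =>
      refine (h1 ?_).le
      have : diffObs P Q ⁻¹' {none} = {x | P x ≠ Q x}ᶜ := by
        ext x; simp [diffObs]
      rw [this, measureReal_compl hm, probReal_univ, Real.dist_eq]
      simp only [sub_sub_cancel_left, abs_neg, abs_of_nonneg measureReal_nonneg]
      exact hlt.trans_le (min_le_right _ _)
    | some a =>
      refine (h0 ?_).le
      rw [Real.dist_eq, sub_zero, abs_of_nonneg measureReal_nonneg]
      refine (measureReal_mono ?_).trans_lt (hlt.trans_le (min_le_left _ _))
      intro x hx
      simp only [diffObs, mem_preimage, mem_singleton_iff] at hx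
      intro h; simp [h] at hx
  rw [infoEntropy_eq]
  refine (Finset.sum_le_card_nsmul _ _ _ fun a _ => hterm a).trans (le_of_eq ?_)
  rw [nsmul_eq_mul, Finset.card_univ, ← hc]; field_simp

end process

/-! ### The mean ergodic theorem -/

section meanErgodic

variable {X : Type*} [MeasurableSpace X] {μ : Measure X} [IsProbabilityMeasure μ] {T : X → X}

theorem integral_abs_le_norm_Lp (F : Lp ℝ 2 μ) : ∫ x, |F x| ∂μ ≤ ‖F‖ := by
  have h1 : eLpNorm F 1 μ ≤ eLpNorm F 2 μ :=
    eLpNorm_le_eLpNorm_of_exponent_le (by norm_num) (Lp.aestronglyMeasurable F)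
  have h2 : ∫ x, |F x| ∂μ = (eLpNorm F 1 μ).toReal := by
    rw [eLpNorm_one_eq_lintegral_enorm, ← integral_norm_eq_lintegral_enorm
      (Lp.aestronglyMeasurable F)]
    rfl
  rw [h2, Lp.norm_def]
  exact ENNReal.toReal_mono (Lp.eLpNorm_ne_top F) h1

/-- The mean ergodic theorem in `L¹` for bounded functions. -/
theorem tendsto_integral_abs_birkhoff (hT : Ergodic T μ) {g : X → ℝ} (hg : Measurable g) {C : ℝ}
    (hC : ∀ x, |g x| ≤ C) :
    Tendsto (fun n : ℕ => ∫ x, |(∑ i ∈ Finset.range n, g (T^[i] x)) / n - ∫ y, g y ∂μ| ∂μ)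
      atTop (nhds 0) := by
  have hmp := hT.toMeasurePreserving
  have hmem : MemLp g 2 μ := MemLp.of_bound hg.aestronglyMeasurable C (Eventually.of_forall hC)
  set G : Lp ℝ 2 μ := hmem.toLp g with hG
  set U : Lp ℝ 2 μ →L[ℝ] Lp ℝ 2 μ :=
    (Lp.compMeasurePreservingₗᵢ ℝ T hmp).toContinuousLinearMap with hU
  have hU1 : ‖U‖ ≤ 1 := LinearIsometry.norm_toContinuousLinearMap_le _
  have hUcoe : ∀ F : Lp ℝ 2 μ, U F =ᵐ[μ] F ∘ T := fun F => Lp.coeFn_compMeasurePreserving F hmp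
  have hlim := U.tendsto_birkhoffAverage_orthogonalProjection hU1 G
  set L : Lp ℝ 2 μ := ↑(((↑U : Lp ℝ 2 μ →ₗ[ℝ] Lp ℝ 2 μ).eqLocus
    ↑(1 : Lp ℝ 2 μ →L[ℝ] Lp ℝ 2 μ)).orthogonalProjectionOnto G) with hL
  have hfix : U L = L := by
    have := (((↑U : Lp ℝ 2 μ →ₗ[ℝ] Lp ℝ 2 μ).eqLocus
      ↑(1 : Lp ℝ 2 μ →L[ℝ] Lp ℝ 2 μ)).orthogonalProjectionOnto G).2
    exact this
  obtain ⟨c, hc⟩ : ∃ c, L =ᵐ[μ] Function.const X c := by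
    refine hT.ae_eq_const_of_ae_eq_comp_ae (Lp.aestronglyMeasurable L) ?_
    have := hUcoe L
    rw [hfix] at this
    exact this.symm
  have hiter : ∀ i, (U^[i] G : Lp ℝ 2 μ) =ᵐ[μ] fun x => g (T^[i] x) := by
    intro i
    induction i with
    | zero => exact hmem.coeFn_toLp
    | succ i ih =>
      rw [Function.iterate_succ', Function.comp_apply]
      refine (hUcoe _).trans ?_
      have := hmp.quasiMeasurePreserving.ae_eq_comp ih
      refine this.trans (Eventually.of_forall fun x => ?_)
      simp [Function.iterate_succ]
  have hsum : ∀ n, (birkhoffSum U id n G : Lp ℝ 2 μ) =ᵐ[μ]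
      fun x => ∑ i ∈ Finset.range n, g (T^[i] x) := by
    intro n
    induction n with
    | zero =>
      simp only [birkhoffSum_zero, Finset.range_zero, Finset.sum_empty]
      exact Lp.coeFn_zero ℝ 2 μ
    | succ n ih =>
      rw [birkhoffSum_succ]
      filter_upwards [Lp.coeFn_add (birkhoffSum U id n G) (id (U^[n] G)), ih,
        hiter n] with x h1 h2 h3
      rw [h1, Pi.add_apply, h2, Finset.sum_range_succ, id, h3]
  have havg : ∀ n : ℕ, (birkhoffAverage ℝ U id n G - L : Lp ℝ 2 μ) =ᵐ[μ]
      fun x => (∑ i ∈ Finset.range n, g (T^[i] x)) / n - c := by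
    intro n
    rw [birkhoffAverage]
    filter_upwards [Lp.coeFn_sub ((n : ℝ)⁻¹ • birkhoffSum U id n G) L,
      Lp.coeFn_smul (n : ℝ)⁻¹ (birkhoffSum U id n G), hsum n, hc] with x h1 h2 h3 h4
    rw [h1, Pi.sub_apply, h2, Pi.smul_apply, h3, h4, smul_eq_mul, Function.const_apply]
    ring
  have hint : ∀ i, Integrable (fun x => g (T^[i] x)) μ := fun i =>
    Integrable.of_bound (hg.comp (hmp.measurable.iterate i)).aestronglyMeasurable C
      (Eventually.of_forall fun x => hC _)
  have hT1 : Tendsto (fun n : ℕ => ∫ x, |(∑ i ∈ Finset.range n, g (T^[i] x)) / n - c| ∂μ)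
      atTop (nhds 0) := by
    have h0 := tendsto_iff_norm_sub_tendsto_zero.1 hlim
    refine squeeze_zero (fun n => integral_nonneg fun x => abs_nonneg _) (fun n => ?_) h0
    refine le_trans (le_of_eq (integral_congr_ae ?_)) (integral_abs_le_norm_Lp _)
    filter_upwards [havg n] with x hx
    rw [hx]
  have hmean : ∀ n : ℕ, 0 < n → |∫ y, g y ∂μ - c| ≤
      ∫ x, |(∑ i ∈ Finset.range n, g (T^[i] x)) / n - c| ∂μ := by
    intro n hn
    have hn' : (n : ℝ) ≠ 0 := by exact_mod_cast hn.ne'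
    have h1 : ∫ x, ((∑ i ∈ Finset.range n, g (T^[i] x)) / n - c) ∂μ = ∫ y, g y ∂μ - c := by
      rw [integral_sub ((integrable_finsetSum _ fun i _ => hint i).div_const _)
        (integrable_const _),
        integral_div, integral_finsetSum _ fun i _ => hint i]
      have : ∀ i, ∫ x, g (T^[i] x) ∂μ = ∫ x, g x ∂μ := fun i =>
        (integral_map (hmp.measurable.iterate i).aemeasurable
          (by rw [(hmp.iterate i).map_eq]; exact hg.aestronglyMeasurable)).symm.trans
          (by rw [(hmp.iterate i).map_eq])
      simp [this, hn']
    rw [← h1]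
    exact abs_integral_le_integral_abs
  have hceq : ∫ y, g y ∂μ = c := by
    have : |∫ y, g y ∂μ - c| ≤ 0 := ge_of_tendsto hT1
      ((eventually_gt_atTop 0).mono fun n hn => hmean n hn)
    linarith [abs_nonpos_iff.1 this]
  rw [hceq]
  exact hT1

end meanErgodic

/-! ### The Shannon–McMillan theorem -/

section smb

variable {X α : Type*} [MeasurableSpace X] {μ : Measure X} [IsProbabilityMeasure μ] [Fintype α]
  {T : X → X}

/-- The measure of a cylinder. -/
noncomputable def cyl (μ : Measure X) (T : X → X) (P : X → α) (n : ℕ) (w : Fin n → α) : ℝ :=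
  μ.real (preimage (nm T P n) {w})

/-- The Markov approximation of order `m` of the measures of cylinders. -/
noncomputable def markovW (μ : Measure X) (T : X → X) (P : X → α) (m : ℕ) :
    (k : ℕ) → (Fin (m + k) → α) → ℝ
  | 0, w => cyl μ T P m w
  | k + 1, w => markovW μ T P m k (fun i => w (Fin.succ i)) *
      (cyl μ T P (m + 1) (fun i => w ⟨i, by omega⟩) /
        cyl μ T P m (fun i => w ⟨i + 1, by omega⟩))

theorem cyl_nonneg {X α : Type*} [MeasurableSpace X] {μ : Measure X} {T : X → X}
    (P : X → α) (n : ℕ) (w : Fin n → α) : 0 ≤ cyl μ T P n w := measureReal_nonneg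

theorem markovW_nonneg {X α : Type*} [MeasurableSpace X] {μ : Measure X} {T : X → X}
    (P : X → α) (m k : ℕ) (w) : 0 ≤ markovW μ T P m k w := by
  induction k with
  | zero => exact cyl_nonneg P m w
  | succ k ih => exact mul_nonneg (ih _) (div_nonneg (cyl_nonneg _ _ _) (cyl_nonneg _ _ _))

theorem nm_succ {X α : Type*} {T : X → X} (P : X → α) (n : ℕ) (x : X) :
    nm T P (n + 1) x = Fin.cons (P x) (nm T P n (T x)) := by
  funext i
  refine Fin.cases ?_ (fun j => ?_) i
  · simp [nm]
  · simp [nm, Function.iterate_succ]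

theorem sum_cyl_cons (hT : MeasurePreserving T μ μ) {P : X → α} (hP : CM P) (m : ℕ)
    (u : Fin m → α) :
    ∑ b, cyl μ T P (m + 1) (Fin.cons b u) = cyl μ T P m u := by
  have h := sum_measureReal_prod_fst (μ := μ) hP ((hP.nm hT.measurable m).compMeas hT.measurable) u
  have h2 : μ.real ((fun y => nm T P m (T y)) ⁻¹' {u}) = cyl μ T P m u :=
    hT.measureReal_preimage ((hP.nm hT.measurable m).2 u).nullMeasurableSet
  rw [← h2, ← h]
  refine Finset.sum_congr rfl fun b _ => ?_
  unfold cyl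
  congr 1
  ext x
  simp only [mem_preimage, mem_singleton_iff, nm_succ, Prod.mk.injEq, Fin.cons_inj]

theorem sum_markovW_le (hT : MeasurePreserving T μ μ) {P : X → α} (hP : CM P) (m k : ℕ) :
    ∑ w, markovW μ T P m k w ≤ 1 := by
  induction k with
  | zero => exact (sum_measureReal_fibre (hP.nm hT.measurable m)).le
  | succ k ih =>
    refine le_trans ?_ ih
    have e0 : ∑ w, markovW μ T P m (k + 1) w = ∑ p : α × (Fin (m + k) → α),
        markovW μ T P m (k + 1) (Fin.cons (α := fun _ => α) p.1 p.2) :=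
      (Fintype.sum_equiv (Fin.consEquiv fun _ => α) _ _ fun _ => rfl).symm
    rw [e0, Fintype.sum_prod_type_right]
    refine Finset.sum_le_sum fun c _ => ?_
    have e : ∀ b, markovW μ T P m (k + 1) (Fin.cons (α := fun _ => α) b c) =
        markovW μ T P m k c * (cyl μ T P (m + 1) (Fin.cons b fun i => c ⟨i, by omega⟩) /
        cyl μ T P m (fun i => c ⟨i, by omega⟩)) := by
      intro b
      rw [markovW]
      congr 3
      funext i
      refine Fin.cases ?_ (fun j => ?_) i <;> rfl
    simp_rw [e]
    rw [← Finset.mul_sum, ← Finset.sum_div, sum_cyl_cons hT hP]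
    exact mul_le_of_le_one_right (markovW_nonneg _ _ _ _) (div_self_le_one _)

/-- The conditional information function of order `m`. -/
noncomputable def condInfo (μ : Measure X) (T : X → X) (P : X → α) (m : ℕ) (x : X) : ℝ :=
  Real.log (cyl μ T P m (nm T P m (T x))) - Real.log (cyl μ T P (m + 1) (nm T P (m + 1) x))

theorem ae_cyl_pos (hT : MeasurePreserving T μ μ) (P : X → α) :
    ∀ᵐ x ∂μ, ∀ n i : ℕ, 0 < cyl μ T P n (nm T P n (T^[i] x)) := by
  rw [ae_all_iff]; intro n
  rw [ae_all_iff]; intro i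
  exact (hT.iterate i).quasiMeasurePreserving.ae (ae_measureReal_fibre_pos (nm T P n))

theorem log_markovW {X α : Type*} [MeasurableSpace X] {μ : Measure X} {T : X → X}
    (P : X → α) (m k : ℕ) (x : X)
    (hx : ∀ n i : ℕ, 0 < cyl μ T P n (nm T P n (T^[i] x))) :
    0 < markovW μ T P m k (nm T P (m + k) x) ∧
    Real.log (markovW μ T P m k (nm T P (m + k) x)) =
      -(∑ i ∈ Finset.range k, condInfo μ T P m (T^[i] x)) +
        Real.log (cyl μ T P m (nm T P m (T^[k] x))) := by
  induction k generalizing x with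
  | zero => exact ⟨hx m 0, by simp [markovW]⟩
  | succ k ih =>
    obtain ⟨h1, h2⟩ := ih (T x) fun n i => by
      rw [← Function.iterate_succ_apply]; exact hx n (i + 1)
    have e : markovW μ T P m (k + 1) (nm T P (m + (k + 1)) x) =
        markovW μ T P m k (nm T P (m + k) (T x)) * (cyl μ T P (m + 1) (nm T P (m + 1) x) /
          cyl μ T P m (nm T P m (T x))) := by
      rw [markovW]; rfl
    have h3 : 0 < cyl μ T P (m + 1) (nm T P (m + 1) x) := hx (m + 1) 0
    have h4 : 0 < cyl μ T P m (nm T P m (T x)) := hx m 1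
    rw [e]
    refine ⟨by positivity, ?_⟩
    rw [Real.log_mul h1.ne' (by positivity), Real.log_div h3.ne' h4.ne', h2,
      Finset.sum_range_succ']
    simp only [Function.iterate_succ_apply, Function.iterate_zero, id, condInfo]
    ring

theorem exists_condEntropy_le (hT : MeasurePreserving T μ μ) {P : X → α} (hP : CM P) {δ : ℝ}
    (hδ : 0 < δ) : ∃ m, infoEntropy μ (nm T P (m + 1)) - infoEntropy μ (nm T P m) ≤
      entropyWrt μ T P + δ := by
  by_contra! hcon
  have h1 : ∀ m : ℕ, m * (entropyWrt μ T P + δ) ≤ infoEntropy μ (nm T P m) := by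
    intro m
    induction m with
    | zero => simpa using infoEntropy_nonneg (μ := μ) (nm T P 0)
    | succ m ih => have := hcon m; push_cast; linarith
  have h2 := ge_of_tendsto (tendsto_entropyWrt hT hP) (b := entropyWrt μ T P + δ)
    ((eventually_gt_atTop 0).mono fun n hn => by
      have hn' : (0 : ℝ) < n := by exact_mod_cast hn
      rw [le_div_iff₀ hn', mul_comm]; exact h1 n)
  linarith

theorem integral_condInfo (hT : MeasurePreserving T μ μ) {P : X → α} (hP : CM P) (m : ℕ) :
    ∫ x, condInfo μ T P m x ∂μ =
      infoEntropy μ (nm T P (m + 1)) - infoEntropy μ (nm T P m) := by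
  have h1 := infoEntropy_eq_integral (μ := μ) (hP.nm hT.measurable (m + 1))
  have hc := (hP.nm hT.measurable m).compMeas hT.measurable
  have h2 := infoEntropy_eq_integral (μ := μ) hc
  rw [infoEntropy_comp_measurePreserving hT (hP.nm hT.measurable m)] at h2
  have e : ∀ x, (fun y => nm T P m (T y)) ⁻¹' {nm T P m (T x)} =
    T ⁻¹' (nm T P m ⁻¹' {nm T P m (T x)}) := fun x => rfl
  simp_rw [e, hT.measureReal_preimage ((hP.nm hT.measurable m).2 _).nullMeasurableSet] at h2
  rw [h1, h2]
  change _ = ∫ x, -Real.log (cyl μ T P (m + 1) (nm T P (m + 1) x)) ∂μ -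
    ∫ x, -Real.log (cyl μ T P m (nm T P m (T x))) ∂μ
  rw [← integral_sub
    (integrable_comp_finite (hP.nm hT.measurable (m + 1)) fun w => -Real.log (cyl μ T P (m + 1) w))
    (integrable_comp_finite hc fun w => -Real.log (cyl μ T P m w))]
  refine integral_congr_ae (Eventually.of_forall fun x => ?_)
  simp only [condInfo, cyl]; ring

theorem exists_abs_comp_le {X α : Type*} [Fintype α] {P : X → α} (φ : α → ℝ) :
    ∃ C, 0 ≤ C ∧ ∀ x, |φ (P x)| ≤ C :=
  ⟨∑ a, |φ a|, Finset.sum_nonneg fun _ _ => abs_nonneg _, fun x =>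
    Finset.single_le_sum (f := fun a => |φ a|) (fun _ _ => abs_nonneg _) (Finset.mem_univ (P x))⟩

/-- Normalised information of the `n`-name. -/
noncomputable def normInfo (μ : Measure X) (T : X → X) (P : X → α) (n : ℕ) (x : X) : ℝ :=
  -Real.log (cyl μ T P n (nm T P n x)) / n

theorem integrable_normInfo (hT : MeasurePreserving T μ μ) {P : X → α} (hP : CM P) (n : ℕ) :
    Integrable (normInfo μ T P n) μ :=
  integrable_comp_finite (hP.nm hT.measurable n) fun w => -Real.log (cyl μ T P n w) / n

theorem tendsto_integral_posPart_normInfo (hT : Ergodic T μ) {P : X → α} (hP : CM P) :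
    Tendsto (fun n : ℕ => ∫ x, max (normInfo μ T P n x - entropyWrt μ T P) 0 ∂μ)
      atTop (nhds 0) := by
  have hmp := hT.toMeasurePreserving
  set h := entropyWrt μ T P with hh
  have hh0 : 0 ≤ h := entropyWrt_nonneg hmp hP
  rw [Metric.tendsto_atTop]
  intro ε hε
  obtain ⟨m, hm⟩ := exists_condEntropy_le hmp hP (half_pos (half_pos hε))
  rw [← integral_condInfo hmp hP m, ← hh] at hm
  set g := condInfo μ T P m with hg
  set gbar := ∫ x, g x ∂μ with hgbar
  have hgCM : CM g := by
    have := ((hP.nm hmp.measurable m).compMeas hmp.measurable).prodMk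
      (hP.nm hmp.measurable (m + 1))
    exact this.comp fun c => Real.log (cyl μ T P m c.1) - Real.log (cyl μ T P (m + 1) c.2)
  obtain ⟨C, hC⟩ : ∃ C, ∀ x, |g x| ≤ C := by
    obtain ⟨C1, -, h1⟩ := exists_abs_comp_le (P := nm T P m) fun w => Real.log (cyl μ T P m w)
    obtain ⟨C2, -, h2⟩ := exists_abs_comp_le (P := nm T P (m + 1))
      fun w => Real.log (cyl μ T P (m + 1) w)
    exact ⟨C1 + C2, fun x => (abs_sub _ _).trans (add_le_add (h1 (T x)) (h2 x))⟩
  obtain ⟨B, hB0, hB⟩ := exists_abs_comp_le (P := nm T P m) fun w => Real.log (cyl μ T P m w)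
  have herg := tendsto_integral_abs_birkhoff hT hgCM.measurable hC
  obtain ⟨k0, hk0⟩ := Metric.tendsto_atTop.1 herg (ε / 4) (by positivity)
  obtain ⟨n1, hn1⟩ := exists_nat_gt ((B + 1) / (ε / 4))
  refine ⟨m + k0 + n1 + 1, fun n hn => ?_⟩
  obtain ⟨k, rfl⟩ : ∃ k, n = m + k := ⟨n - m, by omega⟩
  have hk : k0 ≤ k := by omega
  have hkpos : (0 : ℝ) < k := by exact_mod_cast (by omega : 0 < k)
  have hnpos : (0 : ℝ) < ((m + k : ℕ) : ℝ) := by exact_mod_cast (by omega : 0 < m + k)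
  have hkn : (k : ℝ) ≤ ((m + k : ℕ) : ℝ) := by exact_mod_cast (by omega : k ≤ m + k)
  set N : ℝ := ((m + k : ℕ) : ℝ) with hN
  set S : X → ℝ := fun x => ∑ i ∈ Finset.range k, g (T^[i] x) with hS
  set r : X → ℝ :=
    fun x => markovW μ T P m k (nm T P (m + k) x) / cyl μ T P (m + k) (nm T P (m + k) x)
    with hr
  have hnmk := hP.nm hmp.measurable (m + k)
  have hrint : Integrable r μ :=
    integrable_comp_finite hnmk fun w => markovW μ T P m k w / cyl μ T P (m + k) w
  have hr1 : ∫ x, r x ∂μ ≤ 1 := by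
    rw [integral_comp_finite hnmk fun w => markovW μ T P m k w / cyl μ T P (m + k) w]
    refine le_trans (Finset.sum_le_sum fun w _ => ?_) (sum_markovW_le hmp hP m k)
    change cyl μ T P (m + k) w * _ ≤ _
    rcases eq_or_ne (cyl μ T P (m + k) w) 0 with h0 | h0
    · rw [h0, zero_mul]; exact markovW_nonneg _ _ _ _
    · rw [mul_div_cancel₀ _ h0]
  have hSint : Integrable (fun x => |S x / k - gbar|) μ := by
    refine (((integrable_finsetSum _ fun i _ => ?_).div_const _).sub (integrable_const _)).abs
    exact Integrable.of_bound (hgCM.measurable.comp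
      (hmp.measurable.iterate i)).aestronglyMeasurable C (Eventually.of_forall fun x => hC _)
  have hpt : ∀ᵐ x ∂μ, max (normInfo μ T P (m + k) x - h) 0 ≤
      |S x / k - gbar| + (ε / 4 + (B + r x) / N) := by
    filter_upwards [ae_cyl_pos hmp P] with x hx
    obtain ⟨h1, h2⟩ := log_markovW P m k x hx
    have hc : 0 < cyl μ T P (m + k) (nm T P (m + k) x) := hx (m + k) 0
    have hr0 : 0 < r x := div_pos h1 hc
    have h3 : Real.log (r x) ≤ r x := (Real.log_le_sub_one_of_pos hr0).trans (by linarith)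
    rw [hr, Real.log_div h1.ne' hc.ne', h2] at h3
    have h4 := neg_abs_le (Real.log (cyl μ T P m (nm T P m (T^[k] x))))
    have h5 := hB (T^[k] x)
    have h6 : -Real.log (cyl μ T P (m + k) (nm T P (m + k) x)) ≤ S x + (B + r x) := by
      simp only [hS, hr]; linarith
    have h7 : S x ≤ N * (h + ε / 4 + |S x / k - gbar|) := by
      have h8 : S x / k ≤ h + ε / 4 + |S x / k - gbar| := by
        have := le_abs_self (S x / k - gbar); linarith
      have h9 : S x = k * (S x / k) := by field_simp
      rw [h9]
      have h10 : 0 ≤ h + ε / 4 + |S x / k - gbar| := by positivity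
      calc (k : ℝ) * (S x / k) ≤ k * (h + ε / 4 + |S x / k - gbar|) :=
            mul_le_mul_of_nonneg_left h8 hkpos.le
        _ ≤ _ := by
            have : (k : ℝ) * (S x / k) / k = S x / k := by field_simp
            rw [this]
            exact mul_le_mul_of_nonneg_right hkn h10
    have h11 : normInfo μ T P (m + k) x ≤ h + ε / 4 + |S x / k - gbar| + (B + r x) / N := by
      rw [normInfo, div_le_iff₀ hnpos, add_mul, div_mul_cancel₀ _ hnpos.ne']
      linarith
    refine max_le (by linarith) ?_
    positivity
  rw [Real.dist_eq, sub_zero, abs_of_nonneg (integral_nonneg fun x => le_max_right _ _)]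
  have hBr : Integrable (fun x => B + r x) μ := (integrable_const _).add hrint
  have hBrN : Integrable (fun x => (B + r x) / N) μ := hBr.div_const _
  have hrhs : Integrable (fun x => ε / 4 + (B + r x) / N) μ := (integrable_const _).add hBrN
  have hI : ∫ x, max (normInfo μ T P (m + k) x - h) 0 ∂μ ≤
      ∫ x, (|S x / k - gbar| + (ε / 4 + (B + r x) / N)) ∂μ :=
    integral_mono_ae (((integrable_normInfo hmp hP (m + k)).sub (integrable_const _)).pos_part)
      (hSint.add hrhs) hpt
  rw [integral_add hSint hrhs, integral_add (integrable_const _) hBrN,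
    integral_div N (fun x => B + r x), integral_add (integrable_const _) hrint] at hI
  simp only [integral_const, probReal_univ, one_smul] at hI
  have hk1 := hk0 k hk
  rw [Real.dist_eq, sub_zero, abs_of_nonneg (integral_nonneg fun x => abs_nonneg _)] at hk1
  have hk1' : ∫ x, |S x / k - gbar| ∂μ < ε / 4 := hk1
  have hN1 : (B + ∫ x, r x ∂μ) / N < ε / 4 := by
    rw [div_lt_iff₀ hnpos]
    rw [div_lt_iff₀ (by positivity)] at hn1
    have : (n1 : ℝ) ≤ N := by rw [hN]; exact_mod_cast (by omega : n1 ≤ m + k)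
    nlinarith
  linarith

theorem tendsto_integral_abs_normInfo (hT : Ergodic T μ) {P : X → α} (hP : CM P) :
    Tendsto (fun n : ℕ => ∫ x, |normInfo μ T P n x - entropyWrt μ T P| ∂μ) atTop (nhds 0) := by
  have hmp := hT.toMeasurePreserving
  have h1 := tendsto_integral_posPart_normInfo hT hP
  have h2 : Tendsto (fun n : ℕ => ∫ x, normInfo μ T P n x ∂μ - entropyWrt μ T P) atTop
      (nhds 0) := by
    have := (tendsto_entropyWrt hmp hP).sub_const (entropyWrt μ T P)
    rw [sub_self] at this
    refine this.congr fun n => ?_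
    rw [infoEntropy_eq_integral (hP.nm hmp.measurable n), ← integral_div]
    rfl
  have h3 := (h1.const_mul 2).sub h2
  rw [mul_zero, sub_zero] at h3
  refine h3.congr fun n => ?_
  have i1 : Integrable (fun x => normInfo μ T P n x - entropyWrt μ T P) μ :=
    (integrable_normInfo hmp hP n).sub (integrable_const _)
  have e : ∫ x, normInfo μ T P n x ∂μ - entropyWrt μ T P =
      ∫ x, (normInfo μ T P n x - entropyWrt μ T P) ∂μ := by
    rw [integral_sub (integrable_normInfo hmp hP n) (integrable_const _)]; simp
  rw [e, ← integral_const_mul, ← integral_sub (i1.pos_part.const_mul 2) i1]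
  refine integral_congr_ae (Eventually.of_forall fun x => ?_)
  simp only
  rcases le_total 0 (normInfo μ T P n x - entropyWrt μ T P) with h | h
  · rw [max_eq_left h, abs_of_nonneg h]; ring
  · rw [max_eq_right h, abs_of_nonpos h]; ring

/-- The Shannon–McMillan theorem (convergence in probability). -/
theorem exists_shannonMcMillan (hT : Ergodic T μ) {P : X → α} (hP : CM P) {δ η : ℝ} (hδ : 0 < δ)
    (hη : 0 < η) : ∃ n0 : ℕ, ∀ n ≥ n0,
      μ.real {x | ¬ (Real.exp (-(n * (entropyWrt μ T P + δ))) ≤ cyl μ T P n (nm T P n x) ∧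
        cyl μ T P n (nm T P n x) ≤ Real.exp (-(n * (entropyWrt μ T P - δ))))} ≤ η := by
  have hmp := hT.toMeasurePreserving
  obtain ⟨n0, h0⟩ := Metric.tendsto_atTop.1 (tendsto_integral_abs_normInfo hT hP) (δ * η)
    (by positivity)
  refine ⟨n0 + 1, fun n hn => ?_⟩
  have hn' : (0 : ℝ) < n := by exact_mod_cast (by omega : 0 < n)
  have h1 := h0 n (by omega)
  rw [Real.dist_eq, sub_zero, abs_of_nonneg (integral_nonneg fun x => abs_nonneg _)] at h1
  have i1 := ((integrable_normInfo hmp hP n).sub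
    (integrable_const (μ := μ) (entropyWrt μ T P))).abs
  have h2 := mul_meas_ge_le_integral_of_nonneg (Eventually.of_forall fun x => abs_nonneg _) i1 δ
  have h3 : μ.real {x | δ ≤ |normInfo μ T P n x - entropyWrt μ T P|} ≤ η := by
    have : δ * μ.real {x | δ ≤ |normInfo μ T P n x - entropyWrt μ T P|} ≤ δ * η := h2.trans h1.le
    exact le_of_mul_le_mul_left this hδ
  refine le_trans ?_ h3
  refine ENNReal.toReal_mono (measure_ne_top _ _) (measure_mono_ae ?_)
  filter_upwards [ae_cyl_pos hmp P] with x hx hbad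
  by_contra hlt
  apply hbad
  have hlt' : |normInfo μ T P n x - entropyWrt μ T P| < δ := not_le.1 hlt
  have hc : 0 < cyl μ T P n (nm T P n x) := hx n 0
  rw [abs_lt, normInfo] at hlt'
  obtain ⟨ha, hb⟩ := hlt'
  have ha' : entropyWrt μ T P - δ < -Real.log (cyl μ T P n (nm T P n x)) / n := by linarith
  have hb' : -Real.log (cyl μ T P n (nm T P n x)) / n < entropyWrt μ T P + δ := by linarith
  rw [lt_div_iff₀ hn'] at ha'
  rw [div_lt_iff₀ hn'] at hb'
  constructor
  · rw [← Real.le_log_iff_exp_le hc]; linarith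
  · rw [← Real.log_le_iff_le_exp hc]; linarith

end smb

/-! ### Iterates of an invertible transformation -/

section tz

variable {X : Type*} [MeasurableSpace X] {μ : Measure X} (T : X ≃ᵐ X)

/-- Integer iterates of an invertible transformation. -/
def tz (i : ℤ) (x : X) : X := ((T.toEquiv : Equiv.Perm X) ^ i) x

@[simp] theorem tz_zero (x : X) : tz T 0 x = x := by simp [tz]

theorem tz_add (i j : ℤ) (x : X) : tz T (i + j) x = tz T i (tz T j x) := by
  simp [tz, zpow_add]

@[simp] theorem tz_one (x : X) : tz T 1 x = T x := by simp [tz]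

theorem tz_tz (i j : ℤ) (x : X) : tz T i (tz T j x) = tz T (i + j) x := (tz_add T i j x).symm

theorem tz_neg_one (x : X) : tz T (-1) x = T.symm x := by
  apply T.injective
  rw [← tz_one T, tz_tz]; simp

theorem tz_natCast (n : ℕ) (x : X) : tz T n x = T^[n] x := by
  induction n generalizing x with
  | zero => simp
  | succ n ih => rw [Function.iterate_succ_apply, ← ih, Nat.cast_succ, tz_add, tz_one]

theorem tz_negCast (n : ℕ) (x : X) : tz T (-n) x = T.symm^[n] x := by
  induction n generalizing x with
  | zero => simp
  | succ n ih =>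
    rw [Function.iterate_succ_apply, ← ih, Nat.cast_succ, ← tz_neg_one, tz_tz]
    congr 1; ring

variable {T}

theorem measurePreserving_tz (hT : MeasurePreserving T μ μ) (i : ℤ) :
    MeasurePreserving (tz T i) μ μ := by
  obtain ⟨n, rfl | rfl⟩ := i.eq_nat_or_neg
  · have : tz T (n : ℤ) = T^[n] := funext (tz_natCast T n)
    rw [this]; exact hT.iterate n
  · have : tz T (-(n : ℤ)) = T.symm^[n] := funext (tz_negCast T n)
    rw [this]; exact (MeasurePreserving.symm T hT).iterate n

theorem measurable_tz (i : ℤ) : Measurable (tz T i) := by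
  obtain ⟨n, rfl | rfl⟩ := i.eq_nat_or_neg
  · have : tz T (n : ℤ) = T^[n] := funext (tz_natCast T n)
    rw [this]; exact T.measurable.iterate n
  · have : tz T (-(n : ℤ)) = T.symm^[n] := funext (tz_negCast T n)
    rw [this]; exact T.symm.measurable.iterate n

end tz

/-! ### Rokhlin towers -/

section rokhlin

variable {X : Type*} [MeasurableSpace X] {μ : Measure X} {T : X ≃ᵐ X}

/-- `B` is visited with gaps at least `n`, and in every time window of length `2 n`. -/
structure IsBase (T : X ≃ᵐ X) (n : ℕ) (B : Set X) : Prop where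
  meas : MeasurableSet B
  sep : ∀ x ∈ B, ∀ i : ℤ, 0 < i → i < n → tz T i x ∉ B
  visit : ∀ x, ∃ i : ℤ, 0 ≤ i ∧ i < 2 * n ∧ tz T i x ∈ B

/-- The system has Rokhlin towers with two-sided recurrent bases. -/
def HasBases (μ : Measure X) (T : X ≃ᵐ X) : Prop :=
  ∀ n ≥ 1, ∀ η > 0, ∃ B, IsBase T n B ∧ μ.real {x | ∀ i : ℕ, i < n → tz T (-i) x ∉ B} ≤ η

/-- The sets with large return time and two-sided recurrence give tower bases. -/
theorem hasBases_of_sparse [IsProbabilityMeasure μ] (hT : MeasurePreserving T μ μ)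
    (h : ∀ N : ℕ, N ≥ 1 → ∃ C, MeasurableSet C ∧ (∀ x ∈ C, ∀ i : ℤ, 0 < i → i < N → tz T i x ∉ C) ∧
      (∀ x, ∃ i : ℕ, tz T i x ∈ C) ∧ ∀ x, ∃ i : ℕ, tz T (-i) x ∈ C) : HasBases μ T := by
  classical
  intro n hn η hη
  obtain ⟨K, hK⟩ := exists_nat_gt (1 / η)
  have hK0 : (0 : ℝ) < K := lt_trans (by positivity) hK
  have hK1 : 1 ≤ K := by exact_mod_cast hK0
  obtain ⟨C, hC, hsep, hf, hb⟩ := h (n * K) (Nat.mul_pos hn hK1)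
  set N := n * K with hN
  have hnN : n ≤ N := Nat.le_mul_of_pos_right n hK1
  set p : X → ℕ := fun x => Nat.find (hb x) with hp
  have hpC : ∀ x, tz T (-(p x)) x ∈ C := fun x => Nat.find_spec (hb x)
  have hpmin : ∀ x (i : ℕ), i < p x → tz T (-i) x ∉ C := fun x i hi => Nat.find_min (hb x) hi
  have hpM : Measurable p := by
    refine measurable_find _ fun k => ?_
    exact measurable_tz (T := T) (-(k : ℤ)) hC
  have hpeq : ∀ x (k : ℕ), tz T (-k) x ∈ C → (∀ i : ℕ, i < k → tz T (-i) x ∉ C) → p x = k := by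
    intro x k h1 h2
    exact le_antisymm (Nat.find_min' _ h1) (not_lt.1 fun hlt => h2 _ hlt (hpC x))
  set B : Set X := {x | n ∣ p x ∧ ∀ i : ℕ, 0 < i → i < n → tz T i x ∉ C} with hB
  have hstep : ∀ x (j : ℕ), (∀ i : ℕ, 0 < i → i ≤ j → tz T i x ∉ C) → p (tz T j x) = p x + j := by
    intro x j hj
    apply hpeq
    · rw [tz_tz]; have := hpC x
      convert this using 2; push_cast; ring
    · intro i hi
      rw [tz_tz]
      rcases lt_or_ge i j with hij | hij
      · have := hj (j - i) (by omega) (by omega)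
        convert this using 3; push_cast [Nat.cast_sub hij.le]; ring
      · have := hpmin x (i - j) (by omega)
        convert this using 3; push_cast [Nat.cast_sub hij]; ring
  have hCB : ∀ x ∈ C, x ∈ B := by
    intro x hx
    have : p x = 0 := hpeq x 0 (by simpa using hx) (by simp)
    refine ⟨by simp [this], fun i hi hin => hsep x hx i (by exact_mod_cast hi)
      (by exact_mod_cast (by omega : i < N))⟩
  refine ⟨B, ⟨?_, ?_, ?_⟩, ?_⟩
  · have : B = {x | n ∣ p x} ∩ ⋂ i : ℕ, {x | 0 < i → i < n → tz T i x ∉ C} := by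
      ext x; simp [hB]
    rw [this]
    refine (hpM (MeasurableSet.of_discrete (s := {k | n ∣ k}))).inter
      (MeasurableSet.iInter fun i => ?_)
    by_cases h0 : 0 < i ∧ i < n
    · have : {x | 0 < i → i < n → tz T i x ∉ C} = (tz T i ⁻¹' C)ᶜ := by ext x; simp [h0]
      rw [this]; exact (measurable_tz (T := T) (i : ℤ) hC).compl
    · have : {x | 0 < i → i < n → tz T i x ∉ C} = univ := by
        ext x
        simp only [mem_ofPred_eq, mem_univ, iff_true]
        intro a b; exact absurd ⟨a, b⟩ h0
      rw [this]; exact MeasurableSet.univ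
  · rintro x ⟨hx1, hx2⟩ i hi hin hxi
    lift i to ℕ using hi.le
    have := hstep x i fun j hj hji => hx2 j hj (by omega)
    have h3 := hxi.1
    rw [this] at h3
    have h4 := (Nat.dvd_add_right hx1).1 h3
    have := Nat.le_of_dvd (by omega) h4
    omega
  · intro x
    obtain ⟨i0, hi0, hdvd⟩ : ∃ i0 : ℕ, i0 < n ∧ n ∣ p x + i0 := by
      refine ⟨(n - p x % n) % n, Nat.mod_lt _ hn, ?_⟩
      have h1 := Nat.mod_lt (p x) hn
      rw [Nat.dvd_iff_mod_eq_zero, Nat.add_mod, Nat.mod_mod, ← Nat.add_mod, ← Nat.mod_add_mod]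
      rw [show p x % n + (n - p x % n) = n by omega, Nat.mod_self]
    by_cases hc : ∃ i : ℕ, 0 < i ∧ i < 2 * n ∧ tz T i x ∈ C
    · obtain ⟨i, _, h1, h2⟩ := hc
      exact ⟨i, by omega, by exact_mod_cast h1, hCB _ h2⟩
    · push Not at hc
      refine ⟨i0, by omega, by exact_mod_cast (by omega : i0 < 2 * n), ?_, fun i h1 h2 => ?_⟩
      · rw [hstep x i0 fun i h1 h2 => hc i h1 (by omega)]; exact hdvd
      · rw [tz_tz]
        have := hc (i + i0) (by omega) (by omega)
        convert this using 3; push_cast; ring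
  · have hsub : {x | ∀ i : ℕ, i < n → tz T (-i) x ∉ B} ⊆
        ⋃ i ∈ Finset.range n, tz T (i : ℤ) ⁻¹' C := by
      intro x hx
      have h1 := Nat.mod_lt (p x) hn
      set q := p x % n with hq
      have h2 := hx q h1
      have hqp : q ≤ p x := Nat.mod_le _ _
      have h3 : p (tz T (-q) x) = p x - q := by
        apply hpeq
        · rw [tz_tz]; have := hpC x
          convert this using 2; push_cast [Nat.cast_sub hqp]; ring
        · intro i hi
          rw [tz_tz]
          have := hpmin x (i + q) (by omega)
          convert this using 3; push_cast; ring
      have h4 : n ∣ p (tz T (-q) x) := by rw [h3]; exact Nat.dvd_sub_mod _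
      have h5 : ∃ i : ℕ, 0 < i ∧ i < n ∧ tz T i (tz T (-q) x) ∈ C := by
        by_contra! hcon; exact h2 ⟨h4, hcon⟩
      obtain ⟨i, hi0, hin, hiC⟩ := h5
      rw [tz_tz] at hiC
      have h6 : q < i := by
        by_contra! hle
        rcases Nat.lt_or_ge (q - i) (p x) with h | h
        · apply hpmin x (q - i) h
          convert hiC using 2; push_cast [Nat.cast_sub hle]; ring
        · omega
      simp only [mem_iUnion, Finset.mem_range, mem_preimage]
      refine ⟨i - q, by omega, ?_⟩
      convert hiC using 2; push_cast [Nat.cast_sub h6.le]; ring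
    have hmC : μ.real C * N ≤ 1 := by
      have hdis : Pairwise (Function.onFun Disjoint fun i : Fin N => tz T (i : ℤ) ⁻¹' C) := by
        have key : ∀ i j : Fin N, i < j → Disjoint (tz T (i : ℤ) ⁻¹' C) (tz T (j : ℤ) ⁻¹' C) := by
          intro i j hij
          rw [Set.disjoint_left]
          intro x hxi hxj
          have hij' : (i : ℕ) < j := hij
          refine hsep _ hxi ((j : ℤ) - i) (by omega) (by have := j.2; omega) ?_
          rw [tz_tz]; simpa using hxj
        intro i j hij
        rcases lt_or_gt_of_ne hij with h | h
        · exact key i j h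
        · exact (key j i h).symm
      have h1 := measureReal_iUnion_fintype (μ := μ) hdis fun i => measurable_tz (T := T) (i : ℤ) hC
      have h2 : ∀ i : Fin N, μ.real (tz T (i : ℤ) ⁻¹' C) = μ.real C := fun i =>
        (measurePreserving_tz hT _).measureReal_preimage hC.nullMeasurableSet
      simp only [h2, Finset.sum_const, Finset.card_univ, Fintype.card_fin, nsmul_eq_mul] at h1
      rw [mul_comm, ← h1]; exact measureReal_le_one
    calc μ.real {x | ∀ i : ℕ, i < n → tz T (-i) x ∉ B} ≤
        μ.real (⋃ i ∈ Finset.range n, tz T (i : ℤ) ⁻¹' C) :=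
            measureReal_mono hsub (measure_ne_top _ _)
      _ ≤ ∑ i ∈ Finset.range n, μ.real (tz T (i : ℤ) ⁻¹' C) := measureReal_biUnion_finset_le _ _
      _ = n * μ.real C := by
        rw [Finset.sum_congr rfl fun (i : ℕ) _ =>
          (measurePreserving_tz hT (i : ℤ)).measureReal_preimage hC.nullMeasurableSet]
        simp
      _ ≤ 1 / K := by
        rw [le_div_iff₀ hK0]; rw [hN] at hmC; push_cast at hmC; linarith
      _ ≤ η := by
        rw [div_lt_iff₀ hη] at hK
        rw [div_le_iff₀ hK0]; linarith

theorem exists_small_pos_set [StandardBorelSpace X] [IsProbabilityMeasure μ]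
    [NullSingletonClass μ] {ε : ℝ≥0∞} (hε : 0 < ε) :
    ∃ D, MeasurableSet D ∧ 0 < μ D ∧ μ D < ε := by
  let _ := upgradeStandardBorel X
  let _ := TopologicalSpace.upgradeIsCompletelyMetrizable X
  by_contra! hcon
  have hnull : ∀ x : X, ∃ k : ℕ, μ (Metric.ball x (1 / ((k : ℝ) + 1))) = 0 := by
    intro x
    by_contra! hx
    have hle : ∀ k : ℕ, ε ≤ μ (Metric.ball x (1 / ((k : ℝ) + 1))) := fun k =>
      hcon _ Metric.isOpen_ball.measurableSet (pos_iff_ne_zero.2 (hx k))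
    have hanti : Antitone fun k : ℕ => Metric.ball x (1 / ((k : ℝ) + 1)) := fun i j hij =>
      Metric.ball_subset_ball (one_div_le_one_div_of_le (by positivity) (by gcongr))
    have hlim := tendsto_measure_iInter_atTop (μ := μ)
      (s := fun k : ℕ => Metric.ball x (1 / ((k : ℝ) + 1)))
      (fun k : ℕ => (Metric.isOpen_ball (x := x)
        (ε := 1 / ((k : ℝ) + 1))).measurableSet.nullMeasurableSet)
      hanti ⟨0, measure_ne_top _ _⟩
    have hInter : ⋂ k : ℕ, Metric.ball x (1 / ((k : ℝ) + 1)) = {x} := by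
      ext y
      simp only [mem_iInter, Metric.mem_ball, mem_singleton_iff]
      constructor
      · intro h
        by_contra hne
        obtain ⟨k, hk⟩ := exists_nat_one_div_lt (dist_pos.2 hne)
        exact absurd (h k) (not_lt.2 hk.le)
      · rintro rfl k; rw [dist_self]; positivity
    rw [hInter, measure_singleton] at hlim
    exact absurd (ge_of_tendsto' hlim hle) (not_le.2 hε)
  have h0 : μ (univ : Set X) = 0 := measure_null_of_locally_null _ fun x _ => by
    obtain ⟨k, hk⟩ := hnull x
    exact ⟨_, mem_nhdsWithin_of_mem_nhds (Metric.ball_mem_nhds x (by positivity)), hk⟩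
  simp at h0

theorem exists_sparse_set [StandardBorelSpace X] [IsProbabilityMeasure μ] [NullSingletonClass μ]
    (hT : Ergodic T μ) (N : ℕ) :
    ∃ C, MeasurableSet C ∧ 0 < μ C ∧ ∀ x ∈ C, ∀ i : ℤ, 0 < i → i < N → tz T i x ∉ C := by
  have hmp : MeasurePreserving T μ μ := hT.toMeasurePreserving
  obtain ⟨D, hD, hD0, hD1⟩ := exists_small_pos_set (μ := μ) (X := X)
    (ε := 1 / (2 * ((N : ℝ≥0∞) + 1))) (by
      apply ENNReal.div_pos one_ne_zero; finiteness)
  set E : Set X := ⋃ i ∈ Finset.Ioo 0 N, tz T (i : ℤ) ⁻¹' D with hE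
  have hEm : MeasurableSet E := Finset.measurableSet_biUnion _ fun i _ => measurable_tz _ hD
  refine ⟨D \ E, hD.diff hEm, ?_, ?_⟩
  · by_contra hcon
    have hsub : μ (D \ E) = 0 := by simpa using hcon
    have hle : E ≤ᵐ[μ] T ⁻¹' E := by
      have h1 : μ (T ⁻¹' (D \ E)) = 0 := by
        rw [hmp.measure_preimage (hD.diff hEm).nullMeasurableSet, hsub]
      have h2 : ∀ᵐ x ∂μ, x ∉ T ⁻¹' (D \ E) := measure_eq_zero_iff_ae_notMem.1 h1
      filter_upwards [h2] with x hx hxE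
      change x ∈ E at hxE
      change T x ∈ E
      simp only [hE, mem_iUnion, Finset.mem_Ioo, mem_preimage, exists_prop] at hxE
      obtain ⟨i, ⟨hi0, hiN⟩, hxi⟩ := hxE
      rcases Nat.lt_or_ge 1 i with h | h
      · simp only [hE, mem_iUnion, Finset.mem_Ioo, mem_preimage, exists_prop]
        refine ⟨i - 1, ⟨by omega, by omega⟩, ?_⟩
        rw [← tz_one T, tz_tz]
        convert hxi using 2; push_cast [Nat.cast_sub h.le]; ring
      · have : i = 1 := by omega
        subst this
        by_contra hTE
        exact hx ⟨by simpa using hxi, hTE⟩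
    have hE1 : μ E ≤ N * μ D := by
      refine (measure_biUnion_finset_le _ _).trans ?_
      rw [Finset.sum_congr rfl fun (i : ℕ) _ =>
        (measurePreserving_tz hmp (i : ℤ)).measure_preimage hD.nullMeasurableSet]
      rw [Finset.sum_const, nsmul_eq_mul]
      gcongr
      simp
    have hE2 : μ E < 1 := by
      refine hE1.trans_lt ?_
      calc (N : ℝ≥0∞) * μ D ≤ ((N : ℝ≥0∞) + 1) * (1 / (2 * ((N : ℝ≥0∞) + 1))) := by
            gcongr
            exact le_self_add
        _ = 1 / 2 := by
            rw [one_div, ENNReal.mul_inv (by simp) (by simp), mul_comm, mul_assoc,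
              ENNReal.inv_mul_cancel (by simp) (by finiteness)]
            simp
        _ < 1 := by simp
    have hE3 : 0 < μ E := by
      refine hD0.trans_le ?_
      calc μ D ≤ μ (D \ E ∪ E) := measure_mono (by simp)
        _ ≤ μ (D \ E) + μ E := measure_union_le _ _
        _ = μ E := by rw [hsub, zero_add]
    rcases hT.ae_empty_or_univ_of_ae_le_preimage hEm.nullMeasurableSet hle
      with h | h
    · rw [measure_congr h] at hE3; simp at hE3
    · rw [measure_congr h] at hE2; simp at hE2
  · rintro x ⟨hxD, hxE⟩ i hi0 hiN hxi
    apply hxE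
    lift i to ℕ using hi0.le
    simp only [hE, mem_iUnion, Finset.mem_Ioo, mem_preimage, exists_prop]
    exact ⟨i, ⟨by exact_mod_cast hi0, by exact_mod_cast hiN⟩, hxi.1⟩

theorem ae_exists_iterate_mem [IsProbabilityMeasure μ] (hT : Ergodic T μ) {C : Set X}
    (hC : MeasurableSet C) (h0 : 0 < μ C) : ∀ᵐ x ∂μ, ∃ i : ℕ, T^[i] x ∈ C := by
  have hmp : MeasurePreserving T μ μ := hT.toMeasurePreserving
  set F : Set X := ⋃ i : ℕ, T^[i] ⁻¹' C with hF
  have hFm : MeasurableSet F := MeasurableSet.iUnion fun i => (T.measurable.iterate i) hC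
  have hsub : T ⁻¹' F ⊆ F := by
    intro x hx
    simp only [hF, mem_preimage, mem_iUnion] at hx ⊢
    obtain ⟨i, hi⟩ := hx
    exact ⟨i + 1, by rwa [Function.iterate_succ_apply]⟩
  have hCF : C ⊆ F := fun x hx => mem_iUnion.2 ⟨0, hx⟩
  rcases hT.ae_empty_or_univ_of_preimage_ae_le hFm.nullMeasurableSet
    (show T ⁻¹' F ≤ F from hsub).eventuallyLE with h | h
  · have := h0.trans_le (measure_mono hCF)
    rw [measure_congr h] at this; simp at this
  · filter_upwards [h.mem_iff] with x hx
    have : x ∈ F := by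
      exact hx.2 trivial
    simpa [hF] using this

end rokhlin

/-! ### Positions in a tower -/

section tower

variable {X : Type*} [MeasurableSpace X] {μ : Measure X} {T : X ≃ᵐ X}

/-- The time elapsed since the last visit to `B`. -/
noncomputable def bpos (T : X ≃ᵐ X) (B : Set X) (x : X) : ℕ := sInf {j : ℕ | tz T (-(j : ℤ)) x ∈ B}

theorem bpos_le {B : Set X} {x : X} {j : ℕ} (h : tz T (-(j : ℤ)) x ∈ B) : bpos T B x ≤ j :=
  Nat.sInf_le h

theorem IsBase.exists_back {n : ℕ} {B : Set X} (hB : IsBase T n B) (x : X) :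
    ∃ j : ℕ, j < 2 * n ∧ tz T (-(j : ℤ)) x ∈ B := by
  obtain ⟨i, hi0, hi, hiB⟩ := hB.visit (tz T (-(2 * n - 1 : ℤ)) x)
  rw [tz_tz] at hiB
  refine ⟨(2 * n - 1 - i).toNat, by omega, ?_⟩
  rw [show (-((2 * n - 1 - i).toNat : ℤ)) = i + -(2 * n - 1 : ℤ) by omega]
  exact hiB

theorem IsBase.bpos_mem {n : ℕ} {B : Set X} (hB : IsBase T n B) (x : X) :
    tz T (-(bpos T B x : ℤ)) x ∈ B :=
  Nat.sInf_mem (s := {j : ℕ | tz T (-(j : ℤ)) x ∈ B}) ⟨_, (hB.exists_back x).choose_spec.2⟩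

theorem IsBase.bpos_lt {n : ℕ} {B : Set X} (hB : IsBase T n B) (x : X) : bpos T B x < 2 * n := by
  obtain ⟨j, hj, hjB⟩ := hB.exists_back x
  exact (bpos_le hjB).trans_lt hj

theorem bpos_eq {B : Set X} {x : X} (hx : x ∈ B) {j : ℤ} (hj0 : 0 ≤ j)
    (h : ∀ i : ℤ, 0 < i → i ≤ j → tz T i x ∉ B) : (bpos T B (tz T j x) : ℤ) = j := by
  lift j to ℕ using hj0
  have h1 : tz T (-(j : ℤ)) (tz T j x) ∈ B := by rw [tz_tz]; simpa using hx
  have h2 := bpos_le h1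
  have h3 : tz T (-(bpos T B (tz T j x) : ℤ)) (tz T j x) ∈ B :=
    Nat.sInf_mem (s := {l : ℕ | tz T (-(l : ℤ)) (tz T j x) ∈ B}) ⟨j, h1⟩
  by_contra hne
  rw [tz_tz] at h3
  exact h _ (by omega) (by omega) h3

theorem IsBase.bpos_eq {n : ℕ} {B : Set X} (hB : IsBase T n B) {x : X} (hx : x ∈ B) {j : ℤ}
    (hj0 : 0 ≤ j) (hj : j < n) : (bpos T B (tz T j x) : ℤ) = j :=
  _root_.bpos_eq hx hj0 fun i hi hij => hB.sep x hx i hi (by omega)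

/-- Between the last visit to `B` and the present there is no other visit. -/
theorem not_mem_of_lt_bpos {B : Set X} {x : X} {i : ℤ} (h0 : 0 ≤ i) (hi : i < bpos T B x) :
    tz T (-i) x ∉ B := by
  intro h
  lift i to ℕ using h0
  have := bpos_le h
  omega

theorem IsBase.bpos_map {n : ℕ} {B : Set X} (hB : IsBase T n B) {x : X} (hx : T x ∉ B) :
    bpos T B (T x) = bpos T B x + 1 := by
  have h := _root_.bpos_eq (hB.bpos_mem x) (j := bpos T B x + 1) (by positivity) (by
    intro i hi0 hi
    rw [tz_tz]
    rcases eq_or_lt_of_le hi with h | h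
    · rw [h]; simpa using hx
    · have := not_mem_of_lt_bpos (T := T) (B := B) (x := x) (i := bpos T B x - i) (by omega)
        (by omega)
      rwa [show i + -(bpos T B x : ℤ) = -(bpos T B x - i) by ring])
  rw [tz_tz] at h
  have h2 : (bpos T B x + 1 + -(bpos T B x) : ℤ) = 1 := by ring
  rw [h2, tz_one] at h
  exact_mod_cast h

theorem IsBase.measurable_bpos {n : ℕ} {B : Set X} (hB : IsBase T n B) :
    Measurable (bpos T B) := by
  classical
  have hex : ∀ x, ∃ j : ℕ, tz T (-(j : ℤ)) x ∈ B := fun x => ⟨_, hB.bpos_mem x⟩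
  have : bpos T B = fun x => Nat.find (hex x) := funext fun x => Nat.sInf_def (hex x)
  rw [this]
  exact measurable_find _ fun k => measurable_tz (T := T) (-(k : ℤ)) hB.meas

theorem measureReal_exists_tz_mem_le [IsProbabilityMeasure μ] (hT : MeasurePreserving T μ μ)
    {B : Set X} (hB : MeasurableSet B) (a b : ℤ) :
    μ.real {x | ∃ i : ℤ, a ≤ i ∧ i ≤ b ∧ tz T i x ∈ B} ≤ (b + 1 - a).toNat * μ.real B := by
  have hsub : {x | ∃ i : ℤ, a ≤ i ∧ i ≤ b ∧ tz T i x ∈ B} ⊆ ⋃ i ∈ Finset.Icc a b, tz T i ⁻¹' B := by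
    rintro x ⟨i, h1, h2, h3⟩
    simp only [mem_iUnion, Finset.mem_Icc]
    exact ⟨i, ⟨h1, h2⟩, h3⟩
  refine (measureReal_mono hsub (measure_ne_top _ _)).trans ?_
  refine (measureReal_biUnion_finset_le _ _).trans ?_
  rw [Finset.sum_congr rfl fun (i : ℤ) _ =>
    (measurePreserving_tz hT i).measureReal_preimage hB.nullMeasurableSet]
  simp

theorem IsBase.disjoint_preimage {n : ℕ} {B : Set X} (hB : IsBase T n B) :
    Pairwise (Function.onFun Disjoint fun i : Fin n => tz T (i : ℤ) ⁻¹' B) := by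
  have key : ∀ i j : Fin n, i < j → Disjoint (tz T (i : ℤ) ⁻¹' B) (tz T (j : ℤ) ⁻¹' B) := by
    intro i j hij
    rw [Set.disjoint_left]
    intro x hxi hxj
    have hij' : (i : ℕ) < j := hij
    refine hB.sep _ hxi ((j : ℤ) - i) (by omega) (by have := j.2; omega) ?_
    rw [tz_tz]; simpa using hxj
  intro i j hij
  rcases lt_or_gt_of_ne hij with h | h
  · exact key i j h
  · exact (key j i h).symm

theorem IsBase.measureReal_le [IsProbabilityMeasure μ] (hT : MeasurePreserving T μ μ) {n : ℕ}
    {B : Set X} (hB : IsBase T n B) : n * μ.real B ≤ 1 := by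
  have h1 := measureReal_iUnion_fintype (μ := μ) hB.disjoint_preimage
    fun i => measurable_tz (T := T) (i : ℤ) hB.meas
  have h2 : ∀ i : Fin n, μ.real (tz T (i : ℤ) ⁻¹' B) = μ.real B := fun i =>
    (measurePreserving_tz hT _).measureReal_preimage hB.meas.nullMeasurableSet
  simp only [h2, Finset.sum_const, Finset.card_univ, Fintype.card_fin, nsmul_eq_mul] at h1
  rw [← h1]; exact measureReal_le_one

theorem IsBase.preimage {n : ℕ} {B : Set X} (hB : IsBase T n B) (j : ℤ) :
    IsBase T n (tz T j ⁻¹' B) where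
  meas := measurable_tz j hB.meas
  sep x hx i h0 hi h := by
    refine hB.sep _ hx i h0 hi ?_
    rw [mem_preimage, tz_tz] at h
    rw [tz_tz, add_comm]; exact h
  visit x := by
    obtain ⟨i, h0, hi, h⟩ := hB.visit (tz T j x)
    refine ⟨i, h0, hi, ?_⟩
    rw [tz_tz] at h
    rw [mem_preimage, tz_tz, add_comm]; exact h

/-- Tower bases can be chosen to meet a given set proportionally to its measure. -/
theorem HasBases.exists_avoid [IsProbabilityMeasure μ] (hT : MeasurePreserving T μ μ)
    (h : HasBases μ T) {n : ℕ} (hn : 1 ≤ n) {η : ℝ} (hη : 0 < η) {E : Set X}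
    (hE : MeasurableSet E) :
    ∃ B, IsBase T n B ∧ μ.real {x | n ≤ bpos T B x} ≤ η ∧ n * μ.real (B ∩ E) ≤ μ.real E := by
  obtain ⟨B, hB, hBη⟩ := h n hn η hη
  have hdis : Pairwise (Function.onFun Disjoint fun i : Fin n => tz T (i : ℤ) ⁻¹' B ∩ E) :=
    fun i j hij => (hB.disjoint_preimage hij).mono inter_subset_left inter_subset_left
  have h1 := measureReal_iUnion_fintype (μ := μ) hdis
    fun i => (measurable_tz (T := T) (i : ℤ) hB.meas).inter hE
  have h2 : ∑ i : Fin n, μ.real (tz T (i : ℤ) ⁻¹' B ∩ E) ≤ ∑ _i : Fin n, μ.real E / n := by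
    rw [← h1]
    have hn0 : (n : ℝ) ≠ 0 := by positivity
    simp only [Finset.sum_const, Finset.card_univ, Fintype.card_fin, nsmul_eq_mul]
    rw [mul_div_cancel₀ _ hn0]
    exact measureReal_mono (iUnion_subset fun i => inter_subset_right) (measure_ne_top _ _)
  have : Nonempty (Fin n) := ⟨⟨0, hn⟩⟩
  obtain ⟨j, -, hj⟩ := Finset.exists_le_of_sum_le (s := Finset.univ) Finset.univ_nonempty h2
  refine ⟨tz T (j : ℤ) ⁻¹' B, hB.preimage _, ?_, ?_⟩
  · have h3 := (measurePreserving_tz (T := T) hT (j : ℤ)).measureReal_preimage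
      (s := {x | ∀ i : ℕ, i < n → tz T (-i) x ∉ B}) (by
        have : {x | ∀ i : ℕ, i < n → tz T (-i) x ∉ B} =
            ⋂ i : ℕ, ⋂ _ : i < n, (tz T (-(i : ℤ)) ⁻¹' B)ᶜ := by ext; simp
        rw [this]
        exact (MeasurableSet.iInter fun i => MeasurableSet.iInter fun _ =>
          (measurable_tz (T := T) _ hB.meas).compl).nullMeasurableSet)
    refine le_trans (measureReal_mono ?_ (measure_ne_top _ _)) (h3.trans_le hBη)
    intro x hx i hi hxi
    have hx' : n ≤ bpos T (tz T (j : ℤ) ⁻¹' B) x := hx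
    have := bpos_le (T := T) (B := tz T (j : ℤ) ⁻¹' B) (x := x) (j := i) (by
      rw [mem_preimage, tz_tz]; rw [tz_tz] at hxi; rwa [add_comm])
    omega
  · have hn0 : (0 : ℝ) < n := by positivity
    rwa [le_div_iff₀ hn0, mul_comm] at hj

end tower

section target

variable {Y : Type*} [MetricSpace Y]

/-- Orbit segments of points of `H` can be glued within `δ`, in the order of time, as long as the
gap before a segment of length `m` is at least `τ * m + N`. -/
def GlueAt (f : Y → Y) (H : Set Y) (δ τ : ℝ) (N : ℕ) : Prop :=
  ∀ (a m : ℕ → ℕ) (y : ℕ → Y), (∀ j, y j ∈ H) →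
    (∀ j, (a j + m j + τ * m (j + 1) + N : ℝ) ≤ a (j + 1)) →
    ∀ J : ℕ, ∃ z ∈ H, ∀ j ≤ J, ∀ i < m j, dist (f^[a j + i] z) (f^[i] (y j)) ≤ δ

/-- The properties of a dynamical system used to embed ergodic systems of entropy below `c`. -/
structure IsTarget (f : Y → Y) (H : Set Y) (o : Y) (ε c : ℝ) : Prop where
  cont : Continuous f
  inj : Function.Injective f
  maps : ∀ z ∈ H, f z ∈ H
  eps_pos : 0 < ε
  glue : ∀ δ > 0, ∀ τ > 0, ∃ N, GlueAt f H δ τ N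
  codes : ∃ s₀ L₀ : ℕ, ∀ L ≥ L₀, ∃ E : Finset Y, (∀ z ∈ E, z ∈ H) ∧ Real.exp (c * L) ≤ E.card ∧
    (∀ z ∈ E, ∀ z' ∈ E, z ≠ z' → ∃ i < L, 10 * ε ≤ dist (f^[i] z) (f^[i] z')) ∧
    ∀ z ∈ E, ∀ a, a + s₀ ≤ L → ∃ i, a ≤ i ∧ i < a + s₀ ∧ 10 * ε ≤ dist (f^[i] z) o
  marker : ∃ s₁ : ℕ, ∀ m, ∃ z ∈ H, (∀ i, i + s₁ ≤ m → dist (f^[i] z) o < ε) ∧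
    ∀ i < m, 10 * ε ≤ dist (f^[i] z) (f^[m] z)

end target

/-! ### Gluing a block -/

section build

variable {X : Type*} [MeasurableSpace X] {μ : Measure X} {T : X ≃ᵐ X}

/-- The points which visit `B` within the next `g` steps. -/
def buf (T : X ≃ᵐ X) (g : ℕ) (B : Set X) : Set X := {x | ∃ i : ℤ, 1 ≤ i ∧ i ≤ g ∧ tz T i x ∈ B}

theorem measurableSet_buf {g : ℕ} {B : Set X} (hB : MeasurableSet B) :
    MeasurableSet (buf T g B) := by
  have : buf T g B = ⋃ i : ℤ, ⋃ _ : 1 ≤ i ∧ i ≤ g, tz T i ⁻¹' B := by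
    ext x; simp [buf, and_assoc]
  rw [this]
  exact MeasurableSet.iUnion fun i => MeasurableSet.iUnion fun _ => measurable_tz _ hB

/-- A countably valued choice of solutions of a constraint on countably valued data. -/
theorem exists_CM_choice {β Y : Type*} [Nonempty Y] {D : X → β} (hD : CM D) {r : β → Y → Prop}
    (h : ∀ x, ∃ z, r (D x) z) : ∃ Z : X → Y, CM Z ∧ ∀ x, r (D x) (Z x) := by
  classical
  refine ⟨fun x => Classical.epsilon (r (D x)), hD.comp fun d => Classical.epsilon (r d),
    fun x => Classical.epsilon_spec (h x)⟩

theorem CM.select {β : Type*} {p : X → ℕ} (hp : Measurable p) {G : ℕ → X → β}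
    (hG : ∀ j, CM (G j)) : CM fun x => G (p x) x := by
  refine ⟨(countable_iUnion fun j => (hG j).1).mono ?_, fun b => ?_⟩
  · rintro _ ⟨x, rfl⟩
    exact mem_iUnion.2 ⟨p x, x, rfl⟩
  · have : (fun x => G (p x) x) ⁻¹' {b} = ⋃ j, p ⁻¹' {j} ∩ G j ⁻¹' {b} := by
      ext x; simp
    rw [this]
    exact MeasurableSet.iUnion fun j => (hp (measurableSet_singleton j)).inter ((hG j).2 b)

theorem iterate_eq_of_not_mem {Y : Type*} {f : Y → Y} {B : Set X} {Ψ : X → Y}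
    (h : ∀ x, T x ∉ B → Ψ (T x) = f (Ψ x)) (x : X) (l : ℕ)
    (hl : ∀ i : ℤ, 0 < i → i ≤ l → tz T i x ∉ B) : Ψ (tz T l x) = f^[l] (Ψ x) := by
  induction l with
  | zero => simp
  | succ l ih =>
    rw [Function.iterate_succ_apply', ← ih fun i h0 hi => hl i h0 (by push_cast; omega)]
    have h1 : tz T ((l + 1 : ℕ) : ℤ) x = T (tz T l x) := by
      rw [← tz_one T, tz_tz]; congr 1; push_cast; ring
    rw [h1]
    apply h
    rw [← h1]
    exact hl _ (by positivity) le_rfl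

/-- Gluing a marker, a code word and the surviving parts of the previous approximation. -/
theorem exists_glued {Y : Type*} [MetricSpace Y] {f : Y → Y} {H : Set Y} {δ τ : ℝ} {N : ℕ}
    (hglue : GlueAt f H δ τ N) (hτ : 0 ≤ τ) {n g : ℕ} {B : Set X} (hB : IsBase T n B) (hgn : g ≤ n)
    (hg : τ * (2 * n) + N ≤ g) {Ψ : X → Y} (hΨH : ∀ x, Ψ x ∈ H)
    (hΨ : ∀ x, T x ∉ B → Ψ (T x) = f (Ψ x)) {m L ac t₀ : ℕ} (hac : m + τ * L + N ≤ ac)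
    (ht₀ : ac + L + g ≤ t₀) {y w : Y} (hy : y ∈ H) (hw : w ∈ H) (M : ℕ) (x : X) :
    ∃ z ∈ H, (∀ i < m, dist (f^[i] z) (f^[i] y) ≤ δ) ∧
      (∀ i < L, dist (f^[ac + i] z) (f^[i] w) ≤ δ) ∧
      ∀ i < M, (∃ b : ℕ, t₀ ≤ b ∧ b ≤ i ∧ tz T b x ∈ B) → tz T i x ∉ buf T g B →
        dist (f^[i] z) (Ψ (tz T i x)) ≤ δ := by
  classical
  set p : ℕ → Prop := fun b => t₀ ≤ b ∧ tz T b x ∈ B with hp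
  have hnext : ∀ k : ℕ, t₀ ≤ k → ∃ b, k ≤ b ∧ b < k + 2 * n ∧ p b := by
    intro k hk
    obtain ⟨i, h0, hi, hiB⟩ := hB.visit (tz T k x)
    refine ⟨k + i.toNat, by omega, by omega, by omega, ?_⟩
    rw [tz_tz] at hiB
    rwa [show ((k + i.toNat : ℕ) : ℤ) = i + k by omega]
  have hinf : {b | p b}.Infinite := by
    rw [Set.infinite_iff_exists_gt]
    intro a
    obtain ⟨b, h1, -, h2⟩ := hnext (a + 1 + t₀) (by omega)
    exact ⟨b, h2, by omega⟩
  set b : ℕ → ℕ := Nat.nth p with hb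
  have hbp : ∀ j, p (b j) := fun j => Nat.nth_mem_of_infinite hinf j
  have hbm : StrictMono b := Nat.nth_strictMono hinf
  have hbgap : ∀ j, b (j + 1) ≤ b j + 2 * n := by
    intro j
    obtain ⟨k, h1, h2, h3⟩ := hnext (b j + 1) (by have := (hbp j).1; omega)
    obtain ⟨l, rfl⟩ : ∃ l, b l = k := Nat.exists_lt_card_nth_eq h3 |>.imp fun _ h => h.2
    have : j < l := hbm.lt_iff_lt.1 (by omega)
    have : b (j + 1) ≤ b l := hbm.monotone this
    omega
  have hbno : ∀ j k, b j < k → k < b (j + 1) → ¬ p k := by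
    intro j k h1 h2 hk
    obtain ⟨l, rfl⟩ : ∃ l, b l = k := Nat.exists_lt_card_nth_eq hk |>.imp fun _ h => h.2
    have h3 := hbm.lt_iff_lt.1 h1
    have h4 := hbm.lt_iff_lt.1 h2
    omega
  have hbsep : ∀ j, b j + n ≤ b (j + 1) := by
    intro j
    by_contra hlt
    refine hB.sep _ (hbp j).2 ((b (j + 1) : ℤ) - b j) ?_ (by omega) ?_
    · have : b j < b (j + 1) := hbm (Nat.lt_succ_self j)
      omega
    · rw [tz_tz]; simpa using (hbp (j + 1)).2
  obtain ⟨z, hzH, hz⟩ := hglue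
    (fun j => match j with | 0 => 0 | 1 => ac | (j + 2) => b j)
    (fun j => match j with | 0 => m | 1 => L | (j + 2) => b (j + 1) - b j - g)
    (fun j => match j with | 0 => y | 1 => w | (j + 2) => Ψ (tz T (b j) x))
    (by rintro (_ | _ | j); exacts [hy, hw, hΨH _])
    (by
      have hle : ∀ j, ((b (j + 1) - b j - g : ℕ) : ℝ) ≤ 2 * n := fun j => by
        have := hbgap j; exact_mod_cast (by omega : b (j + 1) - b j - g ≤ 2 * n)
      have hle' := fun j => mul_le_mul_of_nonneg_left (hle j) hτ
      rintro (_ | _ | j)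
      · simpa using hac
      · have h1 : ((ac + L + g : ℕ) : ℝ) ≤ b 0 := by exact_mod_cast ht₀.trans (hbp 0).1
        push_cast at h1
        have := hle' 0
        simp only [zero_add] at this ⊢
        linarith
      · have h1 : ((b j : ℝ) + (b (j + 1) - b j - g : ℕ) + g) = b (j + 1) := by
          have := hbsep j
          exact_mod_cast (by omega : b j + (b (j + 1) - b j - g) + g = b (j + 1))
        have := hle' (j + 1)
        simp only at this ⊢
        linarith) (M + 2)
  refine ⟨z, hzH, fun i hi => by simpa using hz 0 (by omega) i hi,
    fun i hi => hz 1 (by omega) i hi, ?_⟩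
  rintro i hiM ⟨k, hk1, hk2, hkB⟩ hiZ
  obtain ⟨l, hl⟩ : ∃ l, b l = k :=
    Nat.exists_lt_card_nth_eq (p := p) ⟨hk1, hkB⟩ |>.imp fun _ h => h.2
  have hex : ∃ j, i < b (j + 1) := ⟨i, lt_of_lt_of_le (Nat.lt_succ_self i) (hbm.le_apply)⟩
  set j := Nat.find hex with hj
  have hj1 : i < b (j + 1) := Nat.find_spec hex
  have hj2 : b j ≤ i := by
    rcases Nat.eq_zero_or_pos j with h | h
    · rw [h]; exact (hbm.monotone (Nat.zero_le l)).trans (hl.le.trans hk2)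
    · have := Nat.find_min hex (m := j - 1) (by omega)
      rw [Nat.sub_add_cancel h] at this; omega
  have hjM : j + 2 ≤ M + 2 := by
    have := hbm.le_apply (x := j); omega
  have him : i - b j < b (j + 1) - b j - g := by
    by_contra hcon
    refine hiZ ⟨(b (j + 1) : ℤ) - i, by omega, by omega, ?_⟩
    rw [tz_tz]; simpa using (hbp (j + 1)).2
  have hfin := hz (j + 2) hjM (i - b j) him
  simp only at hfin
  rw [Nat.add_sub_cancel' hj2, ← iterate_eq_of_not_mem hΨ, tz_tz] at hfin
  · rwa [show ((i - b j : ℕ) : ℤ) + (b j : ℤ) = i by omega] at hfin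
  · intro q hq0 hq hqB
    rw [tz_tz] at hqB
    refine hbno j (b j + q.toNat) (by omega) (by omega) ⟨by have := (hbp j).1; omega, ?_⟩
    rwa [show ((b j + q.toNat : ℕ) : ℤ) = q + b j by omega]

end build

/-! ### Approximate embeddings with a prescribed block structure -/

section layout

variable {X : Type*} [MeasurableSpace X] {μ : Measure X} {T : X ≃ᵐ X}
variable {Y : Type*} [MetricSpace Y]

/-- The approximate embedding `Ψ'` follows the marker `z₀` at the beginning of each block of `B'`,
the code word `w` after time `ac`, and the approximate embedding `Ψ` after time `t₁`. -/
structure Layout (T : X ≃ᵐ X) (f : Y → Y) (δ : ℝ) (Z : Set X) (Ψ : X → Y) (B' : Set X)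
    (Ψ' : X → Y) (m ac L t₁ : ℕ) (z₀ : Y) (w : X → Y) : Prop where
  marker : ∀ x ∈ B', ∀ i : ℕ, i ≤ m → dist (Ψ' (tz T i x)) (f^[i] z₀) ≤ δ
  code : ∀ x ∈ B', ∀ i : ℕ, i < L → dist (Ψ' (tz T (ac + i : ℕ) x)) (f^[i] (w x)) ≤ δ
  rest : ∀ x ∈ B', ∀ i : ℕ, t₁ ≤ i → (∀ j : ℤ, 0 < j → j ≤ i → tz T j x ∉ B') →
    tz T i x ∉ Z → dist (Ψ' (tz T i x)) (Ψ (tz T i x)) ≤ δ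

theorem IsBase.not_mem_buf {n g : ℕ} {B : Set X} (hB : IsBase T n B) {x : X} (hx : x ∈ B) {i : ℤ}
    (h0 : 0 ≤ i) (hi : i + g < n) : tz T i x ∉ buf T g B := by
  rintro ⟨j, h1, h2, h3⟩
  rw [tz_tz] at h3
  exact hB.sep x hx _ (by omega) (by omega) h3

theorem exists_layout {f : Y → Y} {H : Set Y} {δ τ : ℝ} {N : ℕ} (hfH : ∀ z ∈ H, f z ∈ H)
    (hglue : GlueAt f H δ τ N) (hτ : 0 ≤ τ) {n g : ℕ} {B : Set X} (hB : IsBase T n B) (hgn : g ≤ n)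
    (hg : τ * (2 * n) + N ≤ g) {Ψ : X → Y} (hΨC : CM Ψ) (hΨH : ∀ x, Ψ x ∈ H)
    (hΨ : ∀ x, T x ∉ B → Ψ (T x) = f (Ψ x)) {m L ac t₁ : ℕ} (hac : m + 1 + τ * L + N ≤ ac)
    (ht₁ : ac + L + g + 2 * n ≤ t₁) {z₀ : Y} (hz₀ : z₀ ∈ H) {w : X → Y} (hwC : CM w)
    (hw : ∀ x, w x ∈ H) {n' : ℕ} {B' : Set X} (hB' : IsBase T n' B') (hm : m < n')
    (hL : ac + L < n') :
    ∃ Ψ' : X → Y, CM Ψ' ∧ (∀ x, Ψ' x ∈ H) ∧ (∀ x, T x ∉ B' → Ψ' (T x) = f (Ψ' x)) ∧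
      Layout T f δ (buf T g B) Ψ B' Ψ' m ac L t₁ z₀ w := by
  classical
  have : Nonempty Y := ⟨z₀⟩
  set t₀ := ac + L + g with ht₀
  have hDC : CM fun x => (w x, (fun i : Fin (2 * n') => ((∃ b : ℕ, t₀ ≤ b ∧ b ≤ i ∧ tz T b x ∈ B),
      tz T i x ∉ buf T g B, Ψ (tz T i x)))) := by
    refine hwC.prodMk (CM.pi fun i => ?_)
    refine CM.prodMk ?_ (CM.prodMk ?_ ?_)
    · refine CM.prop (s := {x | ∃ b : ℕ, t₀ ≤ b ∧ b ≤ i ∧ tz T b x ∈ B}) ?_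
      have : {x | ∃ b : ℕ, t₀ ≤ b ∧ b ≤ i ∧ tz T b x ∈ B} =
          ⋃ b : ℕ, ⋃ _ : t₀ ≤ b ∧ b ≤ i, tz T b ⁻¹' B := by
        ext x; simp [and_assoc]
      rw [this]
      exact MeasurableSet.iUnion fun i => MeasurableSet.iUnion fun _ => measurable_tz _ hB.meas
    · exact CM.prop (s := (tz T (i : ℤ) ⁻¹' buf T g B)ᶜ)
        (measurable_tz _ (measurableSet_buf hB.meas)).compl
    · exact hΨC.compMeas (measurable_tz _)
  obtain ⟨Z, hZC, hZ⟩ := exists_CM_choice (Y := Y) hDC (r := fun d z => z ∈ H ∧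
      (∀ i < m + 1, dist (f^[i] z) (f^[i] z₀) ≤ δ) ∧
      (∀ i < L, dist (f^[ac + i] z) (f^[i] d.1) ≤ δ) ∧
      ∀ i : Fin (2 * n'), (d.2 i).1 → (d.2 i).2.1 → dist (f^[i] z) (d.2 i).2.2 ≤ δ) (by
    intro x
    obtain ⟨z, h1, h2, h3, h4⟩ := exists_glued hglue hτ hB hgn hg hΨH hΨ (m := m + 1) (L := L)
      (ac := ac) (t₀ := t₀) (by push_cast; linarith) le_rfl hz₀ (hw x) (2 * n') x
    exact ⟨z, h1, h2, h3, fun i hi1 hi2 => h4 i i.2 hi1 hi2⟩)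
  have hHit : ∀ (j : ℕ) z, z ∈ H → f^[j] z ∈ H := by
    intro j
    induction j with
    | zero => intro z hz; exact hz
    | succ j ih => intro z hz; exact ih _ (hfH z hz)
  have hval : ∀ x ∈ B', ∀ i : ℕ, (∀ j : ℤ, 0 < j → j ≤ i → tz T j x ∉ B') →
      f^[bpos T B' (tz T i x)] (Z (tz T (-(bpos T B' (tz T i x) : ℤ)) (tz T i x))) =
        f^[i] (Z x) := by
    intro x hx i hi
    have h := bpos_eq hx (j := i) (by positivity) hi
    have h' : bpos T B' (tz T i x) = i := by exact_mod_cast h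
    rw [h', tz_tz]; simp
  refine ⟨fun x => f^[bpos T B' x] (Z (tz T (-(bpos T B' x : ℤ)) x)), ?_, ?_, ?_, ?_, ?_, ?_⟩
  · exact CM.select (G := fun j x => f^[j] (Z (tz T (-(j : ℤ)) x))) hB'.measurable_bpos fun j =>
      (hZC.compMeas (measurable_tz _)).comp fun y => f^[j] y
  · exact fun x => hHit _ _ (hZ _).1
  · intro x hx
    simp only
    rw [hB'.bpos_map hx, Function.iterate_succ_apply', ← tz_one T x, tz_tz]
    congr 4; push_cast; ring
  · intro x hx i hi
    rw [hval x hx i fun j h0 hj => hB'.sep x hx j h0 (by omega)]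
    exact (hZ x).2.1 i (by omega)
  · intro x hx i hi
    rw [hval x hx _ fun j h0 hj => hB'.sep x hx j h0 (by push_cast at hj; omega)]
    exact (hZ x).2.2.1 i hi
  · intro x hx i hi hno hiZ
    rw [hval x hx _ hno]
    have hi2 : i < 2 * n' := by
      have h := bpos_eq hx (j := i) (by positivity) hno
      have := hB'.bpos_lt (tz T i x)
      omega
    refine (hZ x).2.2.2 ⟨i, hi2⟩ ?_ hiZ
    obtain ⟨b, hb0, hb1, hb⟩ := hB.visit (tz T t₀ x)
    refine ⟨t₀ + b.toNat, by omega, by simp only; omega, ?_⟩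
    rw [tz_tz] at hb
    rwa [show ((t₀ + b.toNat : ℕ) : ℤ) = b + t₀ by omega]

/-- A point whose image is close to the image of a block start is itself a block start. -/
theorem Layout.sync {f : Y → Y} {δ : ℝ} {Z : Set X} {Ψ : X → Y} {B' : Set X} {Ψ' : X → Y}
    {m ac L t₁ : ℕ} {z₀ : Y} {w : X → Y} (hl : Layout T f δ Z Ψ B' Ψ' m ac L t₁ z₀ w)
    {n' g' : ℕ} (hB' : IsBase T n' B') {o : Y} {ε e a : ℝ} {s₀ s₁ s : ℕ}
    (hz₀ : ∀ i, i + s₁ ≤ m → dist (f^[i] z₀) o < ε)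
    (hz₀' : ∀ i < m, 10 * ε ≤ dist (f^[i] z₀) (f^[m] z₀))
    (hw : ∀ x, ∀ b, b + s₀ ≤ L → ∃ i, b ≤ i ∧ i < b + s₀ ∧ 10 * ε ≤ dist (f^[i] (w x)) o)
    (hΨ : ∀ x, ∃ i : ℕ, i < s ∧ tz T i x ∉ Z ∧ a ≤ dist (Ψ (tz T i x)) o)
    (hm : m + g' < n') (hL : ac + L + g' < n') (hacm : ac + s₀ + s₁ ≤ 2 * m)
    (ht₁ : s₀ + t₁ + s + g' + s₁ ≤ ac + L + m) (hLt : ac + L ≤ t₁) (hsL : s₀ ≤ L)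
    (he1 : 2 * δ + e ≤ 10 * ε) (he2 : 2 * δ + ε + e ≤ 10 * ε) (he3 : 2 * δ + ε + e ≤ a)
    {x x' : X} (hx : x ∈ B')
    (hc : ∀ i : ℕ, i ≤ m → tz T i x ∉ buf T g' B' → tz T i x' ∉ buf T g' B' →
      dist (Ψ' (tz T i x)) (Ψ' (tz T i x')) < e) : x' ∈ B' := by
  by_contra hx'
  set u := bpos T B' x' with hu
  set y := tz T (-(u : ℤ)) x' with hy
  have hyB : y ∈ B' := hB'.bpos_mem x'
  have hyx : ∀ i : ℤ, tz T i x' = tz T (u + i) y := by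
    intro i; rw [hy, tz_tz]; congr 1; ring
  have hu0 : 0 < u := by
    rcases Nat.eq_zero_or_pos u with h | h
    · rw [hy, h] at hyB; simp at hyB; exact absurd hyB hx'
    · exact h
  have hxZ : ∀ i : ℕ, i ≤ m → tz T i x ∉ buf T g' B' := fun i hi =>
    hB'.not_mem_buf hx (by positivity) (by omega)
  have hsep : ∀ i : ℕ, i ≤ m → ∀ v ∈ B', ∀ k : ℕ, k ≤ m → tz T i x' = tz T k v →
      10 * ε ≤ dist (f^[i] z₀) (f^[k] z₀) → False := by
    intro i hi v hv k hk hik hd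
    have h1 := hc i hi (hxZ i hi) (by
      rw [hik]; exact hB'.not_mem_buf hv (by positivity) (by omega))
    have h2 := hl.marker x hx i hi
    have h3 := hl.marker v hv k hk
    rw [hik] at h1
    have h4 := dist_triangle4 (f^[i] z₀) (Ψ' (tz T i x)) (Ψ' (tz T k v)) (f^[k] z₀)
    rw [dist_comm (f^[i] z₀) (Ψ' (tz T i x))] at h4
    linarith
  by_cases hum : u ≤ m
  · refine hsep (m - u) (by omega) y hyB m le_rfl ?_ (hz₀' _ (by omega))
    rw [hyx]; congr 1; omega
  push Not at hum
  by_cases hj : ∃ j : ℕ, 0 < j ∧ j ≤ m ∧ tz T j x' ∈ B'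
  · obtain ⟨j, hj0, hjm, hjB⟩ := hj
    refine hsep m le_rfl _ hjB (m - j) (by omega) ?_ ?_
    · rw [tz_tz]; congr 1; omega
    · rw [dist_comm]; exact hz₀' _ (by omega)
  push Not at hj
  have hyno : ∀ j : ℤ, 0 < j → j ≤ u + m → tz T j y ∉ B' := by
    intro j h0 hjm hjB
    rcases lt_or_ge j (u : ℤ) with h | h
    · refine not_mem_of_lt_bpos (T := T) (B := B') (x := x') (i := u - j) (by omega) (by omega) ?_
      rwa [hyx, show (u + -(u - j) : ℤ) = j by ring]
    · have h2 : tz T (j - u) x' ∈ B' := by rwa [hyx, show (u + (j - u) : ℤ) = j by ring]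
      rcases eq_or_lt_of_le h with h3 | h3
      · rw [← h3, sub_self, tz_zero] at h2; exact hx' h2
      · refine hj (j - u).toNat (by omega) (by omega) ?_
        rwa [show (((j - u).toNat : ℕ) : ℤ) = j - u by omega]
  have hyZ : ∀ v : ℕ, v + g' ≤ u + m → tz T v y ∉ buf T g' B' := by
    rintro v hv ⟨i, hi1, hi2, hi3⟩
    rw [tz_tz] at hi3
    exact hyno _ (by omega) (by omega) hi3
  have hfar : ∀ v : ℕ, u ≤ v → v + s₁ ≤ u + m → tz T v y ∉ buf T g' B' →
      2 * δ + ε + e ≤ dist (Ψ' (tz T v y)) o + δ → False := by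
    intro v huv hvm hvZ hd
    have hv : tz T ((v - u : ℕ) : ℤ) x' = tz T v y := by rw [hyx]; congr 1; omega
    have h1 := hc (v - u) (by omega) (hxZ _ (by omega)) (by rwa [hv])
    have h2 := hl.marker x hx (v - u) (by omega)
    have h3 := hz₀ (v - u) (by omega)
    rw [hv] at h1
    have h4 := dist_triangle4 (Ψ' (tz T v y)) (Ψ' (tz T ((v - u : ℕ) : ℤ) x)) (f^[v - u] z₀) o
    rw [dist_comm (Ψ' (tz T v y)) (Ψ' (tz T ((v - u : ℕ) : ℤ) x))] at h4
    linarith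
  by_cases hcode : max u ac + s₀ ≤ ac + L
  · obtain ⟨i, hi1, hi2, hi3⟩ := hw y (max u ac - ac) (by omega)
    have h1 := hl.code y hyB i (by omega)
    refine hfar (ac + i) (by omega) (by omega) ?_ ?_
    · exact hB'.not_mem_buf hyB (by positivity) (by push_cast; omega)
    · have := dist_triangle (f^[i] (w y)) (Ψ' (tz T (ac + i : ℕ) y)) o
      rw [dist_comm (Ψ' (tz T (ac + i : ℕ) y))] at h1
      linarith
  · push Not at hcode
    obtain ⟨i, hi1, hi2, hi3⟩ := hΨ (tz T (max u t₁ : ℕ) y)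
    rw [tz_tz, ← Nat.cast_add] at hi2 hi3
    have h1 := hl.rest y hyB (i + max u t₁) (by omega)
      (fun j h0 hj => hyno j h0 (by push_cast at hj; omega)) hi2
    refine hfar (i + max u t₁) (by omega) (by omega) (hyZ _ (by omega)) ?_
    have := dist_triangle (Ψ (tz T (i + max u t₁ : ℕ) y)) (Ψ' (tz T (i + max u t₁ : ℕ) y)) o
    rw [dist_comm (Ψ' (tz T (i + max u t₁ : ℕ) y))] at h1
    linarith

/-- The images of the orbits of `x` and `x'` are `e`-close over the time window `[-R, R]`, outside
of the buffer `Z`. -/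
def IsClose (T : X ≃ᵐ X) (Ψ : X → Y) (Z : Set X) (e : ℝ) (R : ℕ) (x x' : X) : Prop :=
  ∀ i : ℤ, -R ≤ i → i ≤ R → tz T i x ∉ Z → tz T i x' ∉ Z → dist (Ψ (tz T i x)) (Ψ (tz T i x')) < e

theorem IsClose.symm {Ψ : X → Y} {Z : Set X} {e : ℝ} {R : ℕ} {x x' : X}
    (h : IsClose T Ψ Z e R x x') : IsClose T Ψ Z e R x' x := fun i h1 h2 h3 h4 => by
  rw [dist_comm]; exact h i h1 h2 h4 h3

/-- Points with close images have the same position in their blocks. -/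
theorem IsClose.bpos_eq {Ψ' : X → Y} {B' : Set X} {n' g' : ℕ} (hB' : IsBase T n' B') {m : ℕ}
    (hm : m < n') {e : ℝ}
    (hsync : ∀ x x', x ∈ B' → (∀ i : ℕ, i ≤ m → tz T i x ∉ buf T g' B' →
      tz T i x' ∉ buf T g' B' → dist (Ψ' (tz T i x)) (Ψ' (tz T i x')) < e) → x' ∈ B')
    {R : ℕ} (hR : 2 * n' ≤ R) {x x' : X} (h : IsClose T Ψ' (buf T g' B') e R x x') :
    bpos T B' x = bpos T B' x' := by
  have key : ∀ x x', IsClose T Ψ' (buf T g' B') e R x x' → bpos T B' x' ≤ bpos T B' x := by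
    intro x x' h
    have hp := hB'.bpos_lt x
    apply bpos_le
    refine hsync _ _ (hB'.bpos_mem x) fun i hi h1 h2 => ?_
    simp only [tz_tz] at h1 h2 ⊢
    exact h _ (by omega) (by omega) h1 h2
  exact le_antisymm (key _ _ h.symm) (key _ _ h)

/-- Points with close images have blocks which carry the same code word. -/
theorem Layout.code_eq {f : Y → Y} {δ : ℝ} {Z : Set X} {Ψ : X → Y} {B' : Set X} {Ψ' : X → Y}
    {m ac L t₁ : ℕ} {z₀ : Y} {w : X → Y} (hl : Layout T f δ Z Ψ B' Ψ' m ac L t₁ z₀ w)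
    {n' g' : ℕ} (hB' : IsBase T n' B') {ε e : ℝ}
    (hw : ∀ x x', w x ≠ w x' → ∃ i < L, 10 * ε ≤ dist (f^[i] (w x)) (f^[i] (w x')))
    (hL : ac + L + g' < n') (he : 2 * δ + e ≤ 10 * ε) {R : ℕ} (hR : n' ≤ R) {x x' : X}
    (hx : x ∈ B') (hx' : x' ∈ B')
    (h : ∀ i : ℕ, i ≤ R → tz T i x ∉ buf T g' B' → tz T i x' ∉ buf T g' B' →
      dist (Ψ' (tz T i x)) (Ψ' (tz T i x')) < e) : w x = w x' := by
  by_contra hne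
  obtain ⟨i, hi, hd⟩ := hw _ _ hne
  have h1 := hl.code x hx i hi
  have h2 := hl.code x' hx' i hi
  have h3 := h (ac + i) (by omega)
    (hB'.not_mem_buf hx (by positivity) (by push_cast; omega))
    (hB'.not_mem_buf hx' (by positivity) (by push_cast; omega))
  have h4 := dist_triangle4 (f^[i] (w x)) (Ψ' (tz T (ac + i : ℕ) x)) (Ψ' (tz T (ac + i : ℕ) x'))
    (f^[i] (w x'))
  rw [dist_comm (f^[i] (w x)) (Ψ' (tz T (ac + i : ℕ) x))] at h4
  linarith

/-- Closeness for the new approximation implies closeness for the previous one. -/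
theorem Layout.isClose_rest {f : Y → Y} {δ : ℝ} {Z : Set X} {Ψ : X → Y} {B' : Set X} {Ψ' : X → Y}
    {m ac L t₁ : ℕ} {z₀ : Y} {w : X → Y} (hl : Layout T f δ Z Ψ B' Ψ' m ac L t₁ z₀ w)
    {n' g' : ℕ} (hB' : IsBase T n' B') {e e' : ℝ} (he : 2 * δ + e' ≤ e) {R : ℕ} {x x' : X}
    (hx : x ∈ B') (hx' : x' ∈ B')
    (h : ∀ i : ℕ, i ≤ n' → tz T i x ∉ buf T g' B' → tz T i x' ∉ buf T g' B' →
      dist (Ψ' (tz T i x)) (Ψ' (tz T i x')) < e') {i : ℕ} (hi : t₁ + R ≤ i)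
    (hi' : i + R + g' < n') : IsClose T Ψ Z e R (tz T i x) (tz T i x') := by
  intro l hl1 hl2 hZ hZ'
  obtain ⟨k, hk⟩ : ∃ k : ℕ, (l + i : ℤ) = k := ⟨(l + i).toNat, by omega⟩
  simp only [tz_tz, hk] at hZ hZ' ⊢
  have h1 := hl.rest x hx k (by omega) (fun j h0 hj => hB'.sep x hx j h0 (by omega)) hZ
  have h2 := hl.rest x' hx' k (by omega) (fun j h0 hj => hB'.sep x' hx' j h0 (by omega)) hZ'
  have h3 := h k (by omega) (hB'.not_mem_buf hx (by positivity) (by omega))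
    (hB'.not_mem_buf hx' (by positivity) (by omega))
  have h4 := dist_triangle4 (Ψ (tz T k x)) (Ψ' (tz T k x)) (Ψ' (tz T k x')) (Ψ (tz T k x'))
  rw [dist_comm (Ψ (tz T k x)) (Ψ' (tz T k x))] at h4
  linarith

end layout

/-! ### Coding names by words -/

section code

variable {X : Type*} [MeasurableSpace X] {μ : Measure X}

/-- Names of large probability can be encoded injectively, given the value of an observable whose
values have small probability. -/
theorem exists_encoding [IsProbabilityMeasure μ] {α β Y : Type*} [Fintype α] {A : X → α}
    (hA : CM A) (φ : α → β) {G : Set α} {a b : ℝ} (ha : 0 < a)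
    (hGa : ∀ v ∈ G, a ≤ μ.real (A ⁻¹' {v})) (hGb : ∀ v ∈ G, μ.real {x | φ (A x) = φ v} ≤ b)
    {E : Finset Y} (hE : b / a ≤ E.card) (hE0 : E.Nonempty) :
    ∃ enc : α → Y, (∀ v, enc v ∈ E) ∧
      ∀ v ∈ G, ∀ v' ∈ G, φ v = φ v' → enc v = enc v' → v = v' := by
  classical
  have hY : Nonempty Y := ⟨hE0.choose⟩
  have hfib : ∀ u : β, ∃ g : α → Y, (∀ v, v ∈ G → φ v = u → g v ∈ E) ∧
      InjOn g {v | v ∈ G ∧ φ v = u} := by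
    intro u
    set S : Finset α := Finset.univ.filter fun v => v ∈ G ∧ φ v = u with hS
    have hScard : S.card ≤ E.card := by
      rcases S.eq_empty_or_nonempty with h | ⟨v₀, hv₀⟩
      · simp [h]
      have hv₀' := (Finset.mem_filter.1 hv₀).2
      have h1 : (S.card : ℝ) * a ≤ b := by
        calc (S.card : ℝ) * a = ∑ _v ∈ S, a := by simp
          _ ≤ ∑ v ∈ S, μ.real (A ⁻¹' {v}) :=
            Finset.sum_le_sum fun v hv => hGa v (Finset.mem_filter.1 hv).2.1
          _ = μ.real (⋃ v ∈ S, A ⁻¹' {v}) := by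
            rw [measureReal_biUnion_finset]
            · intro v _ v' _ hvv'
              exact Disjoint.preimage _ (by simpa using hvv')
            · intro v _; exact hA.2 v
          _ ≤ μ.real {x | φ (A x) = φ v₀} := by
            refine measureReal_mono (iUnion₂_subset fun v hv x hx => ?_) (measure_ne_top _ _)
            have hx' : A x = v := hx
            change φ (A x) = φ v₀
            rw [hx', (Finset.mem_filter.1 hv).2.2, hv₀'.2]
          _ ≤ b := hGb v₀ hv₀'.1
      have h2 : (S.card : ℝ) ≤ b / a := by rwa [le_div_iff₀ ha]
      exact_mod_cast h2.trans hE
    obtain ⟨g, hg1, hg2⟩ :=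
      Set.Finite.exists_injOn_of_encard_le (s := (S : Set α)) (t := (E : Set Y))
      S.finite_toSet (by simpa [Set.encard_coe_eq_coe_finsetCard] using hScard)
    have hmem : ∀ v, v ∈ G → φ v = u → v ∈ (S : Set α) := fun v h1 h2 => by simp [hS, h1, h2]
    exact ⟨g, fun v h1 h2 => hg1 (hmem v h1 h2), hg2.mono fun v hv => hmem v hv.1 hv.2⟩
  choose g hg1 hg2 using hfib
  refine ⟨fun v => if v ∈ G then g (φ v) v else hE0.choose, fun v => ?_, ?_⟩
  · by_cases h : v ∈ G
    · simpa [h] using hg1 _ _ h rfl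
    · simpa [h] using hE0.choose_spec
  · intro v hv v' hv' hφ he
    simp only [hv, hv', if_true] at he
    rw [← hφ] at he
    exact hg2 _ ⟨hv, rfl⟩ ⟨hv', hφ.symm⟩ he

/-- Long names of an observable `P` are determined, up to a small set, by a name of `Q` and a code
taking not too many values. -/
theorem exists_code [IsProbabilityMeasure μ] {T : X → X} (hT : Ergodic T μ)
    {α β Y : Type*} [Fintype α] [Fintype β] {P : X → α} {Q : X → β}
    (hP : CM P) (hQ : CM Q) {h ζ ρ : ℝ} (hh : entropyWrt μ T (fun x => (P x, Q x)) ≤ h)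
    (hζ : 0 < ζ) (hρ : 0 < ρ) :
    ∃ n₀ : ℕ, ∀ n t n' : ℕ, n₀ ≤ n' → t + n' ≤ n → ∀ E : Finset Y, E.Nonempty →
      Real.exp (n * (h + ζ) - n' * (entropyWrt μ T Q - ζ)) ≤ E.card →
      ∃ (w : X → Y) (dec : Y → (Fin n' → β) → Fin n → α) (bad : Set X), CM w ∧ (∀ x, w x ∈ E) ∧
        MeasurableSet bad ∧ μ.real bad ≤ ρ ∧
        ∀ x, x ∉ bad → dec (w x) (nm T Q n' (T^[t] x)) = nm T P n x := by
  classical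
  have hmp : MeasurePreserving T μ μ := hT.toMeasurePreserving
  obtain ⟨x₀⟩ : Nonempty X := nonempty_of_isProbabilityMeasure μ
  set S : X → α × β := fun x => (P x, Q x) with hS
  have hSC : CM S := hP.prodMk hQ
  obtain ⟨n₁, hn₁⟩ := exists_shannonMcMillan hT hSC hζ (half_pos hρ)
  obtain ⟨n₂, hn₂⟩ := exists_shannonMcMillan hT hQ hζ (half_pos hρ)
  refine ⟨max n₁ n₂, fun n t n' hn' htn E hE0 hE => ?_⟩
  set φ : (Fin n → α × β) → (Fin n' → β) := fun v i => (v ⟨t + i, by omega⟩).2 with hφ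
  have hφnm : ∀ x, φ (nm T S n x) = nm T Q n' (T^[t] x) := by
    intro x; funext i
    simp only [hφ, nm, hS]
    rw [← Function.iterate_add_apply, add_comm]
  have hAC := hSC.nm hmp.measurable n
  set a := Real.exp (-(n * (entropyWrt μ T S + ζ))) with ha
  set b := Real.exp (-(n' * (entropyWrt μ T Q - ζ))) with hb
  set G : Set (Fin n → α × β) := {v | a ≤ cyl μ T S n v ∧ cyl μ T Q n' (φ v) ≤ b} with hG
  obtain ⟨enc, henc, hinj⟩ := exists_encoding (μ := μ) hAC φ (G := G) (a := a) (b := b)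
    (Real.exp_pos _) (fun v hv => hv.1) (fun v hv => by
      refine le_trans (le_of_eq ?_) hv.2
      have := (hmp.iterate t).measureReal_preimage
        (((hQ.nm hmp.measurable n').2 (φ v)).nullMeasurableSet)
      rw [cyl, ← this]
      congr 1; ext x
      simp only [hφnm]; rfl) (E := E) (by
      refine le_trans ?_ hE
      rw [ha, hb, ← Real.exp_sub]
      apply Real.exp_le_exp.2
      have : (n : ℝ) * (entropyWrt μ T S) ≤ n * h := by gcongr
      linarith) hE0
  set bad : Set X := {x | nm T S n x ∉ G} with hbad
  refine ⟨fun x => enc (nm T S n x), fun y u => ?_, bad, hAC.comp enc, fun x => henc _,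
    hAC.setOf fun v => v ∉ G, ?_, ?_⟩
  · exact if hv : ∃ v ∈ G, φ v = u ∧ enc v = y then fun i => (hv.choose i).1 else
      nm T P n x₀
  · have h1 := hn₁ n (by omega)
    have h2 := hn₂ n' (by omega)
    have h3 :=
      (hmp.iterate t).measureReal_preimage (s := {x | ¬ (b ≤ b ∧ cyl μ T Q n' (nm T Q n' x) ≤ b)})
      (((hQ.nm hmp.measurable n').setOf fun v => ¬ (b ≤ b ∧ cyl μ T Q n' v ≤ b)).nullMeasurableSet)
    have hsub : bad ⊆ {x | ¬ (a ≤ cyl μ T S n (nm T S n x) ∧ cyl μ T S n (nm T S n x) ≤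
        Real.exp (-(n * (entropyWrt μ T S - ζ))))} ∪
        T^[t] ⁻¹' {x | ¬ (b ≤ b ∧ cyl μ T Q n' (nm T Q n' x) ≤ b)} := by
      intro x hx
      by_contra hcon
      simp only [mem_union, not_or, mem_preimage, mem_ofPred_eq, not_not] at hcon
      exact hx ⟨hcon.1.1, by rw [hφnm]; exact hcon.2.2⟩
    have h4 : μ.real {x | ¬ (b ≤ b ∧ cyl μ T Q n' (nm T Q n' x) ≤ b)} ≤ ρ / 2 := by
      refine le_trans (measureReal_mono ?_ (measure_ne_top _ _)) h2
      intro x hx hx'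
      exact hx ⟨le_rfl, hx'.2⟩
    refine (measureReal_mono hsub (measure_ne_top _ _)).trans ((measureReal_union_le _ _).trans ?_)
    linarith
  · intro x hx
    have hxG : nm T S n x ∈ G := not_not.1 hx
    have hv : ∃ v ∈ G, φ v = nm T Q n' (T^[t] x) ∧ enc v = enc (nm T S n x) :=
      ⟨_, hxG, hφnm x, rfl⟩
    have heq : hv.choose = nm T S n x := hinj _ hv.choose_spec.1 _ hxG
      (by rw [hv.choose_spec.2.1, hφnm]) hv.choose_spec.2.2
    simp only [hv, dif_pos]
    funext i
    rw [heq]; rfl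

end code

/-! ### Refining an approximate embedding -/

section stage

variable {X : Type*} [MeasurableSpace X] {μ : Measure X} {T : X ≃ᵐ X}
variable {Y : Type*} [MetricSpace Y]

/-- An approximate embedding `Ψ`, which is equivariant off `B`, together with an observable `Q`
which is determined by the images of orbit segments up to errors of size `e`. -/
structure Stage (T : X ≃ᵐ X) (f : Y → Y) (H : Set Y) (o : Y) (e a δ τ : ℝ) where
  n : ℕ
  g : ℕ
  N : ℕ
  s : ℕ
  q : ℕ
  B : Set X
  Ψ : X → Y
  Q : X → Fin q
  isBase : IsBase T n B
  buf_le : g ≤ n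
  glue : GlueAt f H δ τ N
  le_buf : τ * (2 * n) + N ≤ g
  cm : CM Ψ
  mem : ∀ x, Ψ x ∈ H
  equivariant : ∀ x, T x ∉ B → Ψ (T x) = f (Ψ x)
  window : ∀ x, ∃ i : ℕ, i < s ∧ tz T i x ∉ buf T g B ∧ a ≤ dist (Ψ (tz T i x)) o
  cmQ : CM Q
  robust : ∀ x x', IsClose T Ψ (buf T g B) e (2 * n) x x' → Q x = Q x'

theorem exists_large_nat {τ κ θ C : ℝ} (hτ : 0 < τ) (hκ : 0 < κ) (hθ : 0 < θ) :
    ∃ n : ℕ, C ≤ τ * n ∧ C ≤ κ * n ∧ C ≤ θ * n ∧ C ≤ n := by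
  have h : ∀ t : ℝ, 0 < t → ∀ᶠ n : ℕ in atTop, C ≤ t * n := fun t ht =>
    (tendsto_natCast_atTop_atTop.const_mul_atTop ht).eventually_ge_atTop C
  obtain ⟨n, h1, h2, h3, h4⟩ := ((h τ hτ).and ((h κ hκ).and ((h θ hθ).and
    (h 1 one_pos)))).exists
  exact ⟨n, h1, h2, h3, by simpa using h4⟩

/-- The lengths of the pieces of a block: marker `m`, code `L` starting at `ac`, old material from
`t₁` on, and buffer `g'`, in a block of length `n'`. -/
theorem exists_sizes {h hQ c τ τ' θ : ℝ} (hQ0 : 0 ≤ hQ) (hQh : hQ ≤ h) (hc : 0 ≤ c)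
    (hτ' : 0 < τ') (hττ : τ' ≤ τ) (hθ0 : 0 < θ)
    (hθc : θ * (c - hQ) = h - hQ + 2 * τ + 9 * τ * h) (hκ : 0 < 1 - θ - 9 * τ)
    (n g N N' s s₀ s₁ L₀ n₀ : ℕ) :
    ∃ n' m L ac t₁ g' n'' : ℕ, 1 ≤ n' ∧ (m + 1 + τ * L + N : ℝ) ≤ ac ∧
      t₁ = ac + L + g + 2 * n ∧ (τ' * (2 * n') + N' : ℝ) ≤ g' ∧ t₁ + 4 * n + g' + n'' = n' ∧
      ac + L + g' < n' ∧ ac + s₀ + s₁ ≤ 2 * m ∧ s₀ + t₁ + s + g' + s₁ ≤ ac + L + m ∧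
      s₀ + L₀ ≤ L ∧ n₀ ≤ n'' ∧ (n' * (h + τ) - n'' * (hQ - τ) : ℝ) ≤ c * L ∧
      (2 * (2 * n + t₁ + g') + 1 : ℝ) ≤ (2 * θ + 20 * τ) * n' := by
  have hτ : 0 < τ := hτ'.trans_le hττ
  obtain ⟨n', hn1, hn2, hn3, hn4⟩ := exists_large_nat
    (C := 12 + 2 * τ + N + 2 * N' + 2 * g + 10 * n + s₀ + s₁ + s + L₀ + n₀) hτ hκ hθ0
  have hn'0 : (0 : ℝ) ≤ n' := Nat.cast_nonneg _
  obtain ⟨m, hm1, hm2⟩ : ∃ m : ℕ, 5 * (τ * n') ≤ m ∧ (m : ℝ) < 5 * (τ * n') + 1 :=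
    ⟨⌈5 * (τ * n')⌉₊, Nat.le_ceil _, Nat.ceil_lt_add_one (by positivity)⟩
  obtain ⟨L, hL1, hL2⟩ : ∃ L : ℕ, θ * n' ≤ L ∧ (L : ℝ) < θ * n' + 1 :=
    ⟨⌈θ * n'⌉₊, Nat.le_ceil _, Nat.ceil_lt_add_one (by positivity)⟩
  obtain ⟨u, hu1, hu2⟩ : ∃ u : ℕ, τ * L ≤ u ∧ (u : ℝ) < τ * L + 1 :=
    ⟨⌈τ * L⌉₊, Nat.le_ceil _, Nat.ceil_lt_add_one (by positivity)⟩
  obtain ⟨v, hv1, hv2⟩ : ∃ v : ℕ, τ' * (2 * n') ≤ v ∧ (v : ℝ) < τ' * (2 * n') + 1 :=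
    ⟨⌈τ' * (2 * n')⌉₊, Nat.le_ceil _, Nat.ceil_lt_add_one (by positivity)⟩
  have hτL : τ * L ≤ τ * n' + τ := by
    have hθ1 : θ * n' ≤ 1 * n' := by gcongr; linarith
    nlinarith only [hτ, hL2, hθ1]
  have hτn : τ' * n' ≤ τ * n' := by gcongr
  have hκn : (1 - θ - 9 * τ) * n' = n' - θ * n' - 9 * (τ * n') := by ring
  have hτh : τ' * (2 * n') = 2 * (τ' * n') := by ring
  rw [hκn] at hn2
  rw [hτh] at hv1 hv2
  set A := τ * n'
  set A' := τ' * n'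
  set M := θ * n'
  have hcast : ∀ k : ℕ, (0 : ℝ) ≤ k := fun k => Nat.cast_nonneg k
  have hz1 := hcast N; have hz2 := hcast N'; have hz3 := hcast g; have hz4 := hcast n
  have hz5 := hcast s₀; have hz6 := hcast s₁; have hz7 := hcast s; have hz8 := hcast L₀
  have hz9 := hcast n₀; have hz10 := hcast u
  have hsize : (((m + 1 + u + N) + L + g + 2 * n + 4 * n + (v + N') : ℕ) : ℝ) ≤
      n' - n₀ := by
    push_cast
    linarith only [hm2, hL2, hu2, hv2, hτL, hτn, hn1, hn2, hz1, hz2, hz3, hz4, hz5, hz6, hz7, hz8,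
      hz9, hτ]
  have hsize2 : (((m + 1 + u + N) + L + g + 2 * n + 4 * n + (v + N') : ℕ) : ℝ) ≤
      M + 9 * A := by
    push_cast
    linarith only [hm2, hL2, hu2, hv2, hτL, hτn, hn1, hn2, hz1, hz2, hz3, hz4, hz5, hz6, hz7, hz8,
      hz9, hτ]
  have hsize' : (m + 1 + u + N) + L + g + 2 * n + 4 * n + (v + N') + n₀ ≤ n' := by
    have := add_le_of_le_sub_right hsize
    exact_mod_cast this
  obtain ⟨n'', hn''⟩ : ∃ n'', (m + 1 + u + N) + L + g + 2 * n + 4 * n + (v + N') + n'' = n' :=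
    ⟨n' - ((m + 1 + u + N) + L + g + 2 * n + 4 * n + (v + N')), by omega⟩
  have hn''c : (((m + 1 + u + N) + L + g + 2 * n + 4 * n + (v + N') : ℕ) : ℝ) + n'' = n' := by
    exact_mod_cast hn''
  refine ⟨n', m, L, m + 1 + u + N, (m + 1 + u + N) + L + g + 2 * n,
    v + N', n'', ?_, ?_, rfl, ?_, hn'',
    ?_, ?_, ?_, ?_, by omega, ?_, ?_⟩
  · have : (1 : ℝ) ≤ n' := by
      linarith only [hn4, hz1, hz2, hz3, hz4, hz5, hz6, hz7, hz8, hz9, hτ]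
    exact_mod_cast this
  · push_cast; linarith only [hu1]
  · push_cast; linarith only [hτh, hv1]
  · have : (((m + 1 + u + N) + L + (v + N') : ℕ) : ℝ) < n' := by
      push_cast
      linarith only [hm2, hL2, hu2, hv2, hτL, hτn, hn1, hn2, hz1, hz2, hz3, hz4, hz5, hz6, hz7, hz8,
        hz9, hτ]
    exact_mod_cast this
  · have : (((m + 1 + u + N) + s₀ + s₁ : ℕ) : ℝ) ≤ (2 * m : ℕ) := by
      push_cast
      linarith only [hm1, hu2, hτL, hn1, hz1, hz2, hz3, hz4, hz5, hz6, hz7, hz8, hz9, hτ]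
    exact_mod_cast this
  · have : ((s₀ + ((m + 1 + u + N) + L + g + 2 * n) + s + (v + N') + s₁ : ℕ) : ℝ) ≤
        (m + 1 + u + N + L + m : ℕ) := by
      push_cast
      linarith only [hm1, hv2, hτn, hn1, hz1, hz2, hz3, hz4, hz5, hz6, hz7, hz8, hz9, hτ]
    exact_mod_cast this
  · have : ((s₀ + L₀ : ℕ) : ℝ) ≤ L := by
      push_cast
      linarith only [hL1, hn3, hz1, hz2, hz3, hz4, hz5, hz6, hz7, hz8, hz9, hτ]
    exact_mod_cast this
  · have h1 : c * M ≤ c * L := by gcongr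
    have h2 : (n' - (M + 9 * A)) * hQ ≤ n'' * hQ := by
      gcongr; linarith only [hsize2, hn''c]
    have h3 : n'' * τ ≤ n' * τ := by
      gcongr; omega
    have h4 : (θ * (c - hQ)) * n' = (h - hQ + 2 * τ + 9 * τ * h) * n' := by rw [hθc]
    have h6 : (θ * (c - hQ)) * n' = c * M - M * hQ := by ring
    have h7 : (h - hQ + 2 * τ + 9 * τ * h) * n' =
      n' * h - n' * hQ + 2 * (n' * τ) + 9 * (A * h) := by
      ring
    have h5 : A * hQ ≤ A * h := by gcongr
    have h8 : (n' - (M + 9 * A)) * hQ = n' * hQ - M * hQ - 9 * (A * hQ) := by ring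
    linarith only [h1, h2, h3, h4, h5, h6, h7, h8]
  · have h1 : (2 * θ + 20 * τ) * n' = 2 * M + 20 * A := by ring
    rw [h1]
    have hb := hz10
    push_cast
    linarith only [hm2, hL2, hu2, hv2, hτL, hτn, hn1, hn2, hz1, hz2, hz3, hz4, hz5, hz6, hz7, hz8,
      hz9, hτ]

set_option maxHeartbeats 1000000 in
theorem Stage.exists_next [IsProbabilityMeasure μ] (hT : Ergodic T μ) (hbases : HasBases μ T)
    (hfin : ksEntropy μ T ≠ ∞) {f : Y → Y} {H : Set Y} {o : Y} {ε c : ℝ}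
    (htar : IsTarget f H o ε c) (hc : (ksEntropy μ T).toReal < c) {e a δ τ : ℝ}
    (S : Stage T f H o e a δ τ) {e' a' δ' τ' : ℝ} (hτ' : 0 < τ') (hττ : τ' ≤ τ) (hδ' : 0 < δ')
    (he : 2 * δ + e' ≤ e) (he1 : 2 * δ + e' ≤ 10 * ε)
    (he2 : 2 * δ + ε + e' ≤ 10 * ε) (he3 : 2 * δ + ε + e' ≤ a) (ha' : a' ≤ 10 * ε - δ)
    (hτc : τ * (18 * c + 2) < c - (ksEntropy μ T).toReal)
    {p : ℕ} {P : X → Fin p} (hP : CM P) {ρ : ℝ} (hρ : 0 < ρ) {tol : ℝ}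
    (htol : 2 * (((ksEntropy μ T).toReal - entropyWrt μ T S.Q + 2 * τ +
      9 * τ * (ksEntropy μ T).toReal) / (c - entropyWrt μ T S.Q)) + 20 * τ ≤ tol) :
    ∃ S' : Stage T f H o e' a' δ' τ', S.n ≤ S'.n ∧ ∃ P' : X → Fin p, CM P' ∧
      μ.real {x | P' x ≠ P x} ≤ ρ ∧ (∀ x x', S'.Q x = S'.Q x' → P' x = P' x') ∧
      entropyWrt μ T P' ≤ entropyWrt μ T S'.Q ∧
      ∃ D t₁ : ℕ, ((2 * D + 1) / S'.n : ℝ) ≤ tol ∧ 2 * S.n + S'.g ≤ D ∧ 2 * S.n + t₁ ≤ D ∧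
        ∀ x, (∀ j : ℤ, -t₁ ≤ j → j ≤ t₁ → tz T j x ∉ S'.B) → x ∉ buf T S.g S.B →
          dist (S'.Ψ x) (S.Ψ x) ≤ δ := by
  classical
  have hmp : MeasurePreserving T μ μ := hT.toMeasurePreserving
  obtain ⟨xx⟩ : Nonempty X := nonempty_of_isProbabilityMeasure μ
  obtain ⟨n, g, N, s, q, B, Ψ, Q, hB, hgn, hglue, hg, hΨC, hΨH, hΨ, hwin, hQC, hrob⟩ := S
  simp only at htol ⊢
  set h := (ksEntropy μ T).toReal with hh
  set hQ := entropyWrt μ T Q with hhQ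
  have hτ : 0 < τ := hτ'.trans_le hττ
  have hh0 : 0 ≤ h := ENNReal.toReal_nonneg
  have hQ0 : 0 ≤ hQ := entropyWrt_nonneg hmp hQC
  have hQh : hQ ≤ h := entropyWrt_le_ksEntropy hmp hfin hQC
  have hcQ : 0 < c - hQ := by linarith
  have hc0 : 0 < c := by linarith
  set θ := (h - hQ + 2 * τ + 9 * τ * h) / (c - hQ) with hθ
  have hθ0 : 0 < θ := by
    apply div_pos _ hcQ
    have := mul_nonneg hτ.le hh0
    linarith
  have hθc : θ * (c - hQ) = h - hQ + 2 * τ + 9 * τ * h := div_mul_cancel₀ _ hcQ.ne'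
  have hκ : 0 < 1 - θ - 9 * τ := by
    have h1 : 0 < (1 - θ - 9 * τ) * (c - hQ) := by
      have : (1 - θ - 9 * τ) * (c - hQ) = (c - hQ) - θ * (c - hQ) - 9 * τ * (c - hQ) := by ring
      rw [this, hθc]
      nlinarith [mul_nonneg hτ.le hQ0, mul_lt_mul_of_pos_left hc hτ]
    exact pos_of_mul_pos_left h1 hcQ.le
  obtain ⟨N', hglue'⟩ := htar.glue δ' hδ' τ' hτ'
  obtain ⟨s₀, L₀, hcodes⟩ := htar.codes
  obtain ⟨s₁, hmarker⟩ := htar.marker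
  obtain ⟨n₀, hn₀⟩ := exists_code (Y := Y) hT hP hQC (h := h) (ζ := τ) (ρ := ρ / 2)
    (entropyWrt_le_ksEntropy hmp hfin (hP.prodMk hQC)) hτ (half_pos hρ)
  obtain ⟨n', m, L, ac, t₁, g', n'', hn'1, hacr, ht₁, hg', hsum, hR2, hR3, hR4, hR5, hR8, hexp,
    htoln⟩ :=
    exists_sizes hQ0 hQh hc0.le hτ' hττ hθ0 hθc hκ n g N N' s s₀ s₁ L₀ n₀
  have hmac : m + 1 ≤ ac := by
    have : (m + 1 : ℝ) ≤ ac := by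
      have h1 : (0 : ℝ) ≤ N := Nat.cast_nonneg _
      have h2 : 0 ≤ τ * L := by positivity
      linarith only [hacr, h1, h2]
    exact_mod_cast this
  have hR1 : m + g' < n' := by omega
  have hnn' : n ≤ n' := by omega
  obtain ⟨E, hEH, hEcard, hEsep, hEwin⟩ := hcodes L (by omega)
  have hE0 : E.Nonempty := by
    rw [← Finset.card_pos]
    have := (Real.exp_pos (c * L)).trans_le hEcard
    exact_mod_cast this
  obtain ⟨w, dec, bad, hwC, hwE, hbadm, hbad, hdec⟩ := hn₀ n' (t₁ + 2 * n) n'' hR8 (by omega) E hE0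
    ((Real.exp_le_exp.2 hexp).trans hEcard)
  obtain ⟨z₀, hz₀H, hz₀1, hz₀2⟩ := hmarker m
  obtain ⟨B', hB', hB'η, hB'bad⟩ := hbases.exists_avoid hmp hn'1 (half_pos hρ) hbadm
  obtain ⟨Ψ', hΨ'C, hΨ'H, hΨ', hlay⟩ :=
    exists_layout (w := w) (t₁ := t₁) (ac := ac) (L := L) (m := m)
    htar.maps hglue hτ.le hB hgn hg hΨC hΨH hΨ
    hacr ht₁.ge hz₀H hwC (fun x => hEH _ (hwE x)) hB' (by omega)
    (by omega)
  have hsync : ∀ x x', x ∈ B' → (∀ i : ℕ, i ≤ m → tz T i x ∉ buf T g' B' →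
      tz T i x' ∉ buf T g' B' → dist (Ψ' (tz T i x)) (Ψ' (tz T i x')) < e') → x' ∈ B' :=
    fun x x' hx hcl => hlay.sync hB' hz₀1 hz₀2 (fun x => hEwin _ (hwE x)) hwin hR1 hR2 hR3 hR4
      (by omega) (by omega) he1 he2 he3 hx hcl
  set P' : X → Fin p := fun x => if hp : bpos T B' x < n' then
    dec (w (tz T (-(bpos T B' x : ℤ)) x))
      (nm T Q n'' (T^[t₁ + 2 * n] (tz T (-(bpos T B' x : ℤ)) x)))
        ⟨bpos T B' x, hp⟩ else P xx with hP'
  have hP'C : CM P' := by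
    refine CM.select (G := fun j x => if hp : j < n' then dec (w (tz T (-(j : ℤ)) x))
      (nm T Q n'' (T^[t₁ + 2 * n] (tz T (-(j : ℤ)) x))) ⟨j, hp⟩ else P xx) hB'.measurable_bpos
      fun j => ?_
    by_cases hj : j < n'
    · simp only [hj, dif_pos]
      refine CM.comp (P := fun x => (w (tz T (-(j : ℤ)) x),
        nm T Q n'' (T^[t₁ + 2 * n] (tz T (-(j : ℤ)) x)))) ?_ fun d => dec d.1 d.2 ⟨j, hj⟩
      exact (hwC.prodMk ((hQC.nm hmp.measurable n'').compMeas
        (hmp.measurable.iterate _))).compMeas (measurable_tz _)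
    · simp only [hj, dif_neg, not_false_iff]
      exact CM.const _
  have hdist : ∀ x, (∀ j : ℤ, -t₁ ≤ j → j ≤ t₁ → tz T j x ∉ B') → x ∉ buf T g B →
      dist (Ψ' x) (Ψ x) ≤ δ := by
    intro x hx hxZ
    have hpt : t₁ ≤ bpos T B' x := by
      by_contra hlt
      exact hx _ (by omega) (by omega) (hB'.bpos_mem x)
    have hxx : tz T (bpos T B' x : ℕ) (tz T (-(bpos T B' x : ℤ)) x) = x := by rw [tz_tz]; simp
    have := hlay.rest _ (hB'.bpos_mem x) (bpos T B' x) hpt (by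
      intro j h0 hj
      rw [tz_tz]
      rcases lt_or_ge ((bpos T B' x : ℤ) - j) t₁ with h1 | h1
      · exact hx _ (by omega) (by omega)
      · have := not_mem_of_lt_bpos (T := T) (B := B') (x := x) (i := bpos T B' x - j) (by omega)
          (by omega)
        rwa [show -((bpos T B' x : ℤ) - j) = j + -(bpos T B' x : ℤ) by ring] at this) (by rwa [hxx])
    rwa [hxx] at this
  refine ⟨⟨n', g', N', 4 * n', p, B', Ψ', P', hB', by omega, hglue', hg', hΨ'C, hΨ'H, hΨ',
    ?_, hP'C, ?_⟩, hnn', P', hP'C, ?_, fun x x' h => h, le_rfl, 2 * n + t₁ + g', t₁, ?_,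
    by simp only; omega, by omega, hdist⟩
  · intro x
    obtain ⟨j, hj0, hj, hjB⟩ := hB'.visit x
    obtain ⟨i, -, hi, hid⟩ := hEwin _ (hwE (tz T j x)) 0 (by omega)
    have hcode := hlay.code _ hjB i (by omega)
    have hbuf : tz T ((ac + i : ℕ) : ℤ) (tz T j x) ∉ buf T g' B' :=
      hB'.not_mem_buf hjB (by positivity) (by push_cast; omega)
    have heq : tz T ((ac + i : ℕ) : ℤ) (tz T j x) = tz T ((ac + i + j.toNat : ℕ) : ℤ) x := by
      rw [tz_tz]; congr 1; push_cast; omega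
    rw [heq] at hbuf hcode
    refine ⟨ac + i + j.toNat, by omega, hbuf, ?_⟩
    have := dist_triangle (f^[i] (w (tz T j x))) (Ψ' (tz T ((ac + i + j.toNat : ℕ) : ℤ) x)) o
    rw [dist_comm (f^[i] (w (tz T j x))) (Ψ' _)] at this
    linarith
  · intro x x' hcl
    have hpp : bpos T B' x = bpos T B' x' := hcl.bpos_eq hB' (by omega) hsync le_rfl
    have hpl := hB'.bpos_lt x
    have hxB := hB'.bpos_mem x
    have hxB' := hB'.bpos_mem x'
    rw [← hpp] at hxB'
    set k := bpos T B' x with hk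
    have hcl' : ∀ i : ℕ, i ≤ n' → tz T i (tz T (-(k : ℤ)) x) ∉ buf T g' B' →
        tz T i (tz T (-(k : ℤ)) x') ∉ buf T g' B' →
        dist (Ψ' (tz T i (tz T (-(k : ℤ)) x))) (Ψ' (tz T i (tz T (-(k : ℤ)) x'))) < e' := by
      intro i hi h1 h2
      simp only [tz_tz] at h1 h2 ⊢
      exact hcl _ (by push_cast; omega) (by push_cast; omega) h1 h2
    have hww : w (tz T (-(k : ℤ)) x) = w (tz T (-(k : ℤ)) x') :=
      hlay.code_eq hB' (fun x x' hne => hEsep _ (hwE x) _ (hwE x') hne) (by omega) he1 le_rfl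
        hxB hxB' hcl'
    have hnn : nm T Q n'' (T^[t₁ + 2 * n] (tz T (-(k : ℤ)) x)) =
        nm T Q n'' (T^[t₁ + 2 * n] (tz T (-(k : ℤ)) x')) := by
      funext i
      have hi := i.2
      simp only [nm]
      rw [← Function.iterate_add_apply, ← Function.iterate_add_apply, ← tz_natCast, ← tz_natCast]
      exact hrob _ _ (hlay.isClose_rest hB' he hxB hxB' hcl' (by omega) (by omega))
    simp only [hP', ← hpp, ← hk, hww, hnn]
  · have hsub : {x | P' x ≠ P x} ⊆ {x | n' ≤ bpos T B' x} ∪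
        ⋃ i ∈ Finset.range n', tz T (-((i : ℕ) : ℤ)) ⁻¹' (B' ∩ bad) := by
      intro x hx
      by_contra hcon
      simp only [mem_union, not_or, mem_ofPred_eq, mem_iUnion, Finset.mem_range, not_exists,
        not_le] at hcon
      have hnb : tz T (-(bpos T B' x : ℤ)) x ∉ bad := fun hb => hcon.2 _ hcon.1 ⟨hB'.bpos_mem x, hb⟩
      apply hx
      simp only [hP', hcon.1, dif_pos]
      rw [hdec _ hnb, nm, ← tz_natCast, tz_tz]
      simp
    refine (measureReal_mono hsub (measure_ne_top _ _)).trans ((measureReal_union_le _ _).trans ?_)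
    have h1 : μ.real (⋃ i ∈ Finset.range n', tz T (-((i : ℕ) : ℤ)) ⁻¹' (B' ∩ bad)) ≤ ρ / 2 := by
      refine (measureReal_biUnion_finset_le _ _).trans ?_
      rw [Finset.sum_congr rfl fun (i : ℕ) _ =>
        (measurePreserving_tz hmp (-(i : ℤ))).measureReal_preimage
          (hB'.meas.inter hbadm).nullMeasurableSet]
      simp only [Finset.sum_const, Finset.card_range, nsmul_eq_mul]
      linarith
    linarith
  · simp only
    have hn'pos : (0 : ℝ) < n' := by exact_mod_cast hn'1
    rw [div_le_iff₀ hn'pos]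
    have : (2 * θ + 20 * τ) * n' ≤ tol * n' := by gcongr
    push_cast
    linarith only [this, htoln]

end stage

/-! ### Limits of approximate embeddings -/

section limit

variable {X : Type*} [MeasurableSpace X] {μ : Measure X} {T : X ≃ᵐ X}

theorem exists_separating_partition [IsProbabilityMeasure μ] (hT : MeasurePreserving T μ μ)
    (hfin : ksEntropy μ T ≠ ∞) {U : ℕ → Set X} (hU : ∀ i, MeasurableSet (U i)) (k : ℕ) {η : ℝ}
    (hη : 0 < η) :
    ∃ (p : ℕ) (P : X → Fin p), CM P ∧ (ksEntropy μ T).toReal - η < entropyWrt μ T P ∧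
      ∀ x x', P x = P x' → ∀ i ≤ k, (x ∈ U i ↔ x' ∈ U i) := by
  classical
  obtain ⟨q, P, hP, hPη⟩ := exists_entropyWrt_gt hT hfin hη
  set R : X → Fin q × (Fin (k + 1) → Prop) := fun x => (P x, fun i => x ∈ U i) with hR
  have hRC : CM R := hP.prodMk (CM.pi fun i => CM.prop (s := U i) (hU i))
  let φ := Fintype.equivFin (Fin q × (Fin (k + 1) → Prop))
  refine ⟨_, fun x => φ (R x), hRC.comp φ, hPη.trans_le ?_, fun x x' h i hi => ?_⟩
  · have := entropyWrt_comp_le hT (hRC.comp φ) fun v => (φ.symm v).1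
    simpa [hR] using this
  · have h1 := congrFun (congrArg Prod.snd (φ.injective h)) ⟨i, by omega⟩
    exact iff_of_eq h1

variable {Y : Type*} [MetricSpace Y]

/-- `S'` refines the stage `S` and recovers the first separating sets up to a small error. -/
def Stage.Next (μ : Measure X) (U : ℕ → Set X) (k : ℕ) (tol : ℝ) {f : Y → Y} {H : Set Y} {o : Y}
    {e a δ τ e' a' δ' τ' : ℝ} (S : Stage T f H o e a δ τ) (S' : Stage T f H o e' a' δ' τ') : Prop :=
  S.n ≤ S'.n ∧ (∃ E : Set X, μ.real E ≤ (1 / 2) ^ k ∧ ∀ x x', S'.Q x = S'.Q x' → x ∉ E → x' ∉ E →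
    ∀ i ≤ k, (x ∈ U i ↔ x' ∈ U i)) ∧
    ∃ D t₁ : ℕ, ((2 * D + 1) / S'.n : ℝ) ≤ tol ∧ 2 * S.n + S'.g ≤ D ∧ 2 * S.n + t₁ ≤ D ∧
      ∀ x, (∀ j : ℤ, -t₁ ≤ j → j ≤ t₁ → tz T j x ∉ S'.B) → x ∉ buf T S.g S.B →
        dist (S'.Ψ x) (S.Ψ x) ≤ δ

theorem exists_stage_next [IsProbabilityMeasure μ] (hT : Ergodic T μ) (hbases : HasBases μ T)
    (hfin : ksEntropy μ T ≠ ∞) {f : Y → Y} {H : Set Y} {o : Y} {ε c : ℝ}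
    (htar : IsTarget f H o ε c) (hc : (ksEntropy μ T).toReal < c)
    {U : ℕ → Set X} (hU : ∀ i, MeasurableSet (U i)) {τ₀ K : ℝ} (hτ₀ : 0 < τ₀)
    (hτc : τ₀ * (18 * c + 2) < c - (ksEntropy μ T).toReal)
    (hK : K = 2 * (((ksEntropy μ T).toReal + 1 + 2 * τ₀ + 9 * τ₀ * (ksEntropy μ T).toReal) /
      (c - (ksEntropy μ T).toReal)) + 20 * τ₀) (k : ℕ) {r r' : ℝ} (hr : r = (1 / 2) ^ k)
    (hr' : r' = r / 2)
    (S : Stage T f H o (ε * (1 + r)) (ε * (4 + r)) (ε * r / 4) (τ₀ * r))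
    (hS : (ksEntropy μ T).toReal - ((ksEntropy μ T).toReal + 1) * r ≤ entropyWrt μ T S.Q) :
    ∃ S' : Stage T f H o (ε * (1 + r')) (ε * (4 + r')) (ε * r' / 4) (τ₀ * r'),
      ((ksEntropy μ T).toReal - ((ksEntropy μ T).toReal + 1) * r' ≤ entropyWrt μ T S'.Q) ∧
      S.Next μ U k (K * r) S' := by
  subst hr'
  set h := (ksEntropy μ T).toReal with hh
  have hh0 : 0 ≤ h := ENNReal.toReal_nonneg
  have hr0 : 0 < r := by rw [hr]; positivity
  have hr1 : r ≤ 1 := by rw [hr]; exact pow_le_one₀ (by norm_num) (by norm_num)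
  have hmp := hT.toMeasurePreserving
  have hε := htar.eps_pos
  have hη : 0 < (h + 1) * r / 4 := by positivity
  obtain ⟨p, P, hP, hPη, hPU⟩ := exists_separating_partition hmp hfin hU k hη
  obtain ⟨ρ, hρ, hPρ⟩ := exists_entropyWrt_close (Fin p) hmp hη
  have hεr : 0 < ε * r := by positivity
  have hεr1 : ε * r ≤ ε := mul_le_of_le_one_right hε.le hr1
  obtain ⟨S', hn, P', hP', hPP', hPQ, hent, hlast⟩ := S.exists_next hT hbases hfin htar hc
    (e' := ε * (1 + r / 2)) (a' := ε * (4 + r / 2)) (δ' := ε * (r / 2) / 4) (τ' := τ₀ * (r / 2))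
    (by positivity) (by gcongr; linarith) (by positivity) (by linarith) (by linarith) (by linarith)
    (by linarith) (by linarith) (by
      refine lt_of_le_of_lt ?_ hτc
      have : 0 ≤ c := by linarith
      gcongr
      exact mul_le_of_le_one_right hτ₀.le hr1) hP (ρ := min (ρ / 2) ((1 / 2) ^ k))
    (by positivity) (tol := K * r) (by
      have hch : 0 < c - h := by linarith
      have hQh : entropyWrt μ T S.Q ≤ h := entropyWrt_le_ksEntropy hmp hfin S.cmQ
      have : (h - entropyWrt μ T S.Q + 2 * (τ₀ * r) + 9 * (τ₀ * r) * h) / (c - entropyWrt μ T S.Q) ≤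
          ((h + 1 + 2 * τ₀ + 9 * τ₀ * h) * r) / (c - h) := by
        gcongr
        linarith [mul_nonneg hτ₀.le hh0, mul_nonneg (mul_nonneg hτ₀.le hh0) hr0.le, mul_pos hτ₀ hr0]
      have h2 : (h + 1 + 2 * τ₀ + 9 * τ₀ * h) * r / (c - h) =
        (h + 1 + 2 * τ₀ + 9 * τ₀ * h) / (c - h) * r := mul_div_right_comm _ _ _
      rw [h2] at this
      have h3 := congrArg (· * r) hK
      linarith only [this, h3])
  refine ⟨S', ?_, hn, ⟨{x | P' x ≠ P x}, hPP'.trans (min_le_right _ _), ?_⟩, hlast⟩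
  · have h1 := hPρ P P' hP hP' (by
      have : {x | P x ≠ P' x} = {x | P' x ≠ P x} := by ext x; exact ne_comm
      rw [this]
      exact hPP'.trans_lt ((min_le_left _ _).trans_lt (half_lt_self hρ)))
    linarith
  · intro x x' hQ hx hx' i hi
    refine hPU x x' ?_ i hi
    have h1 : P' x = P x := by simpa using hx
    have h2 : P' x' = P x' := by simpa using hx'
    rw [← h1, ← h2]
    exact hPQ x x' hQ

theorem exists_stage_zero [IsProbabilityMeasure μ] (hbases : HasBases μ T)
    {f : Y → Y} {H : Set Y} {o : Y} {ε c : ℝ} (htar : IsTarget f H o ε c) {e a δ τ : ℝ}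
    (ha : a ≤ 10 * ε) (hδ : 0 < δ) (hτ : 0 < τ) (hτ1 : τ ≤ 1 / 8) :
    ∃ S : Stage T f H o e a δ τ, 1 ≤ S.n := by
  classical
  obtain ⟨N, hN⟩ := htar.glue δ hδ τ hτ
  obtain ⟨s₀, L₀, hcodes⟩ := htar.codes
  obtain ⟨E, hEH, hEcard, -, hEwin⟩ := hcodes (L₀ + s₀) (by omega)
  obtain ⟨z, hz⟩ : E.Nonempty := by
    rw [← Finset.card_pos]
    have := (Real.exp_pos (c * (L₀ + s₀ : ℕ))).trans_le hEcard
    exact_mod_cast this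
  obtain ⟨i, -, hi, hid⟩ := hEwin z hz 0 (by omega)
  have hHit : ∀ j : ℕ, f^[j] z ∈ H := by
    intro j
    induction j with
    | zero => exact hEH z hz
    | succ j ih => rw [Function.iterate_succ_apply']; exact htar.maps _ ih
  obtain ⟨B, hB, -⟩ := hbases (4 * (N + s₀ + 1)) (by omega) 1 one_pos
  refine ⟨⟨4 * (N + s₀ + 1), 2 * (N + s₀ + 1), N, 4 * (4 * (N + s₀ + 1)), 1, B,
    fun x => f^[bpos T B x] z, fun _ => 0, hB, by omega, hN, ?_, ?_, fun x => hHit _, ?_, ?_,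
    CM.const _, fun x x' _ => rfl⟩, ?_⟩
  · push_cast
    nlinarith [Nat.cast_nonneg (α := ℝ) N, Nat.cast_nonneg (α := ℝ) s₀]
  · exact (CM.of_countable fun j => hB.measurable_bpos (measurableSet_singleton j)).comp fun j =>
      f^[j] z
  · intro x hx
    rw [hB.bpos_map hx, Function.iterate_succ_apply']
  · intro x
    obtain ⟨j, hj0, hj, hjB⟩ := hB.visit x
    have heq : tz T ((i + j.toNat : ℕ) : ℤ) x = tz T i (tz T j x) := by
      rw [tz_tz]; congr 1; push_cast; omega
    refine ⟨i + j.toNat, by omega, ?_, ?_⟩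
    · rw [heq]
      exact hB.not_mem_buf hjB (by positivity) (by push_cast; omega)
    · have := hB.bpos_eq hjB (j := i) (by positivity) (by push_cast; omega)
      simp only [heq, (by exact_mod_cast this : bpos T B (tz T i (tz T j x)) = i)]
      linarith
  · simp only; omega

theorem exists_stages [IsProbabilityMeasure μ] (hT : Ergodic T μ)
    (hbases : HasBases μ T) (hfin : ksEntropy μ T ≠ ∞) {f : Y → Y} {H : Set Y} {o : Y} {ε c : ℝ}
    (htar : IsTarget f H o ε c) (hc : (ksEntropy μ T).toReal < c)
    {U : ℕ → Set X} (hU : ∀ i, MeasurableSet (U i)) :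
    ∃ (τ₀ K : ℝ) (S : ∀ k : ℕ, Stage T f H o (ε * (1 + (1 / 2) ^ k)) (ε * (4 + (1 / 2) ^ k))
      (ε * (1 / 2) ^ k / 4) (τ₀ * (1 / 2) ^ k)),
      1 ≤ (S 0).n ∧ ∀ k, (S k).Next μ U k (K * (1 / 2) ^ k) (S (k + 1)) := by
  set h := (ksEntropy μ T).toReal with hh
  have hh0 : 0 ≤ h := ENNReal.toReal_nonneg
  have hmp := hT.toMeasurePreserving
  have hε := htar.eps_pos
  have hc0 : 0 < 18 * c + 2 := by linarith
  have hch : 0 < c - h := by linarith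
  obtain ⟨τ₀, hτ₀, hτ1, hτc⟩ : ∃ τ₀ : ℝ, 0 < τ₀ ∧ τ₀ ≤ 1 / 8 ∧ τ₀ * (18 * c + 2) < c - h := by
    refine ⟨min (1 / 8) ((c - h) / (18 * c + 2) / 2), by positivity, min_le_left _ _, ?_⟩
    rw [← lt_div_iff₀ hc0]
    exact (min_le_right _ _).trans_lt (half_lt_self (by positivity))
  obtain ⟨K, hK⟩ : ∃ K, K = 2 * ((h + 1 + 2 * τ₀ + 9 * τ₀ * h) / (c - h)) + 20 * τ₀ := ⟨_, rfl⟩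
  let St := fun k : ℕ => {S : Stage T f H o (ε * (1 + (1 / 2) ^ k)) (ε * (4 + (1 / 2) ^ k))
    (ε * (1 / 2) ^ k / 4) (τ₀ * (1 / 2) ^ k) // h - (h + 1) * (1 / 2) ^ k ≤ entropyWrt μ T S.Q}
  have hnext : ∀ k (S : St k), ∃ S' : St (k + 1), S.1.Next μ U k (K * (1 / 2) ^ k) S'.1 := by
    rintro k ⟨S, hS⟩
    obtain ⟨S', h1, h2⟩ := exists_stage_next hT hbases hfin htar hc hU hτ₀ hτc hK k rfl
      (r' := (1 / 2) ^ (k + 1)) (by rw [pow_succ]; ring) S hS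
    exact ⟨⟨S', h1⟩, h2⟩
  obtain ⟨S₀, hS₀⟩ := exists_stage_zero hbases htar (e := ε * (1 + (1 / 2) ^ 0))
    (a := ε * (4 + (1 / 2) ^ 0)) (δ := ε * (1 / 2) ^ 0 / 4) (τ := τ₀ * (1 / 2) ^ 0)
    (by rw [pow_zero]; linarith) (by positivity) (by positivity) (by simpa using hτ1)
  have hS0' : h - (h + 1) * (1 / 2) ^ 0 ≤ entropyWrt μ T S₀.Q := by
    have h1 : h - (h + 1) * (1 / 2) ^ 0 ≤ 0 := by rw [pow_zero]; linarith
    exact h1.trans (entropyWrt_nonneg hmp S₀.cmQ)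
  choose nxt hnxt using hnext
  let S : ∀ k, St k := fun k => Nat.rec (motive := St) ⟨S₀, hS0'⟩ (fun k S => nxt k S) k
  exact ⟨τ₀, K, fun k => (S k).1, hS₀, fun k => hnxt k (S k)⟩

variable [CompleteSpace Y] [MeasurableSpace Y] [BorelSpace Y]

theorem exists_embedding_of_stages [IsProbabilityMeasure μ] (hT : MeasurePreserving T μ μ)
    {f : Y → Y} (hf : Continuous f) (hinj : Function.Injective f) {H : Set Y} {o : Y}
    {U : ℕ → Set X} (hsep : ∀ x x', (∀ i, x ∈ U i ↔ x' ∈ U i) → x = x') {ε τ₀ K : ℝ} (hε : 0 < ε)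
    (S : ∀ k : ℕ, Stage T f H o (ε * (1 + (1 / 2) ^ k)) (ε * (4 + (1 / 2) ^ k))
      (ε * (1 / 2) ^ k / 4) (τ₀ * (1 / 2) ^ k))
    (hS₀ : 1 ≤ (S 0).n) (hS : ∀ k, (S k).Next μ U k (K * (1 / 2) ^ k) (S (k + 1))) :
    ∃ Ψ : X → Y, IsMeasEmbedding μ T f Ψ := by
  classical
  have hmono : Monotone fun k => (S k).n := monotone_nat_of_le_succ fun k => (hS k).1
  have hn1 : ∀ k, 1 ≤ (S k).n := fun k => le_trans hS₀ (hmono (Nat.zero_le k))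
  choose E hE hEU using fun k => (hS k).2.1
  choose D t₁ hDt hDg hDt₁ hΨ using fun k => (hS k).2.2
  set W : ℕ → Set X := fun k => {x | ∃ j : ℤ, -D k ≤ j ∧ j ≤ D k ∧ tz T j x ∈ (S (k + 1)).B}
    with hW
  have hsum : Summable fun k : ℕ => (1 / 2 : ℝ) ^ k := summable_geometric_two
  have hWμ : ∀ k, μ.real (W k) ≤ K * (1 / 2) ^ k := by
    intro k
    have hn : (0 : ℝ) < (S (k + 1)).n := by exact_mod_cast hn1 (k + 1)
    have h1 := (S (k + 1)).isBase.measureReal_le hT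
    refine (measureReal_exists_tz_mem_le hT (S (k + 1)).isBase.meas _ _).trans
      (le_trans ?_ (hDt k))
    have h2 : (D k + 1 - -(D k : ℤ)).toNat = 2 * D k + 1 := by omega
    have h3 : ((D k + 1 - -(D k : ℤ)).toNat : ℝ) = 2 * D k + 1 := by rw [h2]; push_cast; ring
    have h4 : μ.real (S (k + 1)).B ≤ 1 / (S (k + 1)).n := by
      rw [le_div_iff₀ hn, mul_comm]; exact h1
    calc _ ≤ (2 * D k + 1 : ℝ) * (1 / (S (k + 1)).n) := by rw [h3]; gcongr
      _ = _ := by ring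
  have hBC : ∀ (V : ℕ → Set X) (C : ℝ), (∀ k, μ.real (V k) ≤ C * (1 / 2) ^ k) →
      ∀ᵐ x ∂μ, ∀ᶠ k in atTop, x ∉ V k := by
    intro V C hV
    refine ae_eventually_notMem (ne_of_lt ?_)
    have h1 : Summable fun k => μ.real (V k) :=
      Summable.of_nonneg_of_le (fun k => measureReal_nonneg) hV (hsum.mul_left C)
    have h2 := h1.tsum_ofReal_lt_top
    simpa [measureReal_def] using h2
  have hn_top : ∀ i : ℤ, ∀ᶠ k in atTop, -(2 * (S k).n : ℤ) ≤ i ∧ i ≤ 2 * (S k).n := by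
    intro i
    have h1 : Tendsto (fun k : ℕ => K * (1 / 2 : ℝ) ^ k) atTop (nhds 0) := by
      have := (tendsto_pow_atTop_nhds_zero_of_lt_one (r := (1 / 2 : ℝ)) (by norm_num)
        (by norm_num)).const_mul K
      simpa using this
    have h2 := h1.eventually_lt_const (show (0 : ℝ) < 1 / (i.natAbs + 1) by positivity)
    refine (eventually_atTop.2 ?_)
    obtain ⟨k, hk⟩ := h2.exists
    refine ⟨k + 1, fun l hl => ?_⟩
    have hn : (0 : ℝ) < (S (k + 1)).n := by exact_mod_cast hn1 (k + 1)
    have h3 : (1 : ℝ) / (S (k + 1)).n < 1 / (i.natAbs + 1) := by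
      refine lt_of_le_of_lt (le_trans ?_ (hDt k)) hk
      gcongr
      linarith [Nat.cast_nonneg (α := ℝ) (D k)]
    rw [one_div_lt_one_div hn (by positivity)] at h3
    have h4 : i.natAbs + 1 < (S (k + 1)).n := by exact_mod_cast h3
    have h5 : (S (k + 1)).n ≤ (S l).n := hmono hl
    omega
  -- the stages are close to each other along orbit segments
  have hstep : ∀ x k, x ∉ W k → ∀ i : ℤ, -(2 * (S k).n : ℤ) ≤ i → i ≤ 2 * (S k).n →
      tz T i x ∉ buf T (S k).g (S k).B →
      dist ((S (k + 1)).Ψ (tz T i x)) ((S k).Ψ (tz T i x)) ≤ ε * (1 / 2) ^ k / 4 := by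
    intro x k hx i hi1 hi2 hbuf
    have h1 := hDt₁ k
    refine hΨ k _ (fun j hj1 hj2 hj => hx ⟨j + i, by omega, by omega, ?_⟩) hbuf
    rwa [tz_tz] at hj
  have hbuf : ∀ x k, x ∉ W k → ∀ i : ℤ, -(2 * (S k).n : ℤ) ≤ i → i ≤ 2 * (S k).n →
      tz T i x ∉ buf T (S (k + 1)).g (S (k + 1)).B := by
    rintro x k hx i hi1 hi2 ⟨j, hj1, hj2, hj⟩
    have h1 := hDg k
    refine hx ⟨j + i, by omega, by omega, ?_⟩
    rwa [tz_tz] at hj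
  have hstep' : ∀ x l, (∀ k ≥ l, x ∉ W k) → ∀ i : ℤ, -(2 * (S l).n : ℤ) ≤ i → i ≤ 2 * (S l).n →
      ∀ k ≥ l + 1,
      dist ((S (k + 1)).Ψ (tz T i x)) ((S k).Ψ (tz T i x)) ≤ ε * (1 / 2) ^ k / 4 := by
    intro x l hx i hi1 hi2 k hk
    obtain ⟨k, rfl⟩ : ∃ k', k = k' + 1 := ⟨k - 1, by omega⟩
    have h1 : (S l).n ≤ (S k).n := hmono (by omega)
    have h2 : (S k).n ≤ (S (k + 1)).n := hmono (by omega)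
    exact hstep x _ (hx _ (by omega)) i (by omega) (by omega)
      (hbuf x k (hx _ (by omega)) i (by omega) (by omega))
  have hgood := (hBC W K hWμ).and (hBC E 1 (fun k => by rw [one_mul]; exact hE k))
  have hlim : ∀ x, (∀ᶠ k in atTop, x ∉ W k) → ∀ i : ℤ,
      ∃ y, Tendsto (fun k => (S k).Ψ (tz T i x)) atTop (nhds y) := by
    intro x hx i
    obtain ⟨l, hl⟩ := eventually_atTop.1 (hx.and (hn_top i))
    have h1 : CauchySeq fun m => (S (m + (l + 1))).Ψ (tz T i x) := by
      refine cauchySeq_of_le_geometric (1 / 2) (ε / 4) (by norm_num) fun m => ?_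
      have := hstep' x l (fun k hk => (hl k hk).1) i (hl l le_rfl).2.1 (hl l le_rfl).2.2
        (m + (l + 1)) (by omega)
      rw [dist_comm, show m + 1 + (l + 1) = m + (l + 1) + 1 by ring]
      refine this.trans ?_
      have h2 : (1 / 2 : ℝ) ^ (m + (l + 1)) ≤ (1 / 2) ^ m :=
        pow_le_pow_of_le_one (by norm_num) (by norm_num) (by omega)
      nlinarith
    obtain ⟨y, hy⟩ := cauchySeq_tendsto_of_complete h1
    exact ⟨y, (tendsto_add_atTop_iff_nat (l + 1)).1 hy⟩
  obtain ⟨Ψ, hΨm, hΨlim⟩ := measurable_limit_of_tendsto_metrizable_ae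
    (fun k => (S k).cm.measurable.aemeasurable) (μ := μ)
    (hgood.mono fun x hx => by simpa using hlim x hx.1 0)
  have hall : ∀ᵐ x ∂μ, ∀ i : ℤ, Tendsto (fun k => (S k).Ψ (tz T i x)) atTop (nhds (Ψ (tz T i x))) :=
    ae_all_iff.2 fun i => (measurePreserving_tz hT i).quasiMeasurePreserving.ae hΨlim
  have hequiv : ∀ x, (∀ᶠ k in atTop, x ∉ W k) →
      (∀ i : ℤ, Tendsto (fun k => (S k).Ψ (tz T i x)) atTop (nhds (Ψ (tz T i x)))) →
      ∀ i : ℤ, Ψ (tz T (i + 1) x) = f (Ψ (tz T i x)) := by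
    intro x hx hlim i
    refine tendsto_nhds_unique (hlim (i + 1)) (((hf.tendsto _).comp (hlim i)).congr' ?_)
    have hsucc : ∀ᶠ k in atTop, (S (k + 1)).Ψ (tz T (i + 1) x) = f ((S (k + 1)).Ψ (tz T i x)) := by
      filter_upwards [hx, hn_top (i + 1)] with k hk hik
      have h1 : tz T (i + 1) x = T (tz T i x) := by rw [add_comm, tz_add, tz_one]
      rw [h1]
      refine (S (k + 1)).equivariant _ fun hB => hk ⟨i + 1, ?_, ?_, by rwa [h1]⟩
      · have := hDg k; omega
      · have := hDg k; omega
    obtain ⟨l, hl⟩ := eventually_atTop.1 hsucc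
    refine eventually_atTop.2 ⟨l + 1, fun k hk => ?_⟩
    obtain ⟨k, rfl⟩ : ∃ k', k = k' + 1 := ⟨k - 1, by omega⟩
    exact (hl k (by omega)).symm
  have hdist : ∀ x l, (∀ k ≥ l, x ∉ W k) →
      (∀ i : ℤ, Tendsto (fun k => (S k).Ψ (tz T i x)) atTop (nhds (Ψ (tz T i x)))) →
      ∀ i : ℤ, -(2 * (S l).n : ℤ) ≤ i → i ≤ 2 * (S l).n → tz T i x ∉ buf T (S l).g (S l).B →
      dist ((S l).Ψ (tz T i x)) (Ψ (tz T i x)) ≤ ε * (1 / 2) ^ l / 2 := by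
    intro x l hx hlim i hi1 hi2 hib
    have h1 : ∀ m : ℕ, dist ((S (m + l)).Ψ (tz T i x)) ((S (m + 1 + l)).Ψ (tz T i x)) ≤
        ε * (1 / 2) ^ l / 4 * (1 / 2) ^ m := by
      intro m
      have h2 : dist ((S (m + l + 1)).Ψ (tz T i x)) ((S (m + l)).Ψ (tz T i x)) ≤
          ε * (1 / 2) ^ (m + l) / 4 := by
        rcases Nat.eq_zero_or_pos m with rfl | hm
        · rw [zero_add]
          exact hstep x l (hx l le_rfl) i hi1 hi2 hib
        · exact hstep' x l hx i hi1 hi2 (m + l) (by omega)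
      rw [dist_comm, show m + 1 + l = m + l + 1 by ring]
      refine h2.trans (le_of_eq ?_)
      rw [pow_add]; ring
    have h2 := dist_le_of_le_geometric_of_tendsto₀ (f := fun m => (S (m + l)).Ψ (tz T i x))
      (1 / 2) _ (by norm_num) h1 ((tendsto_add_atTop_iff_nat l).2 (hlim i))
    rw [show 0 + l = l by omega] at h2
    refine h2.trans (le_of_eq ?_)
    ring
  have hgoodall := hgood.and hall
  set G := {x | ((∀ᶠ k in atTop, x ∉ W k) ∧ ∀ᶠ k in atTop, x ∉ E k) ∧
    ∀ i : ℤ, Tendsto (fun k => (S k).Ψ (tz T i x)) atTop (nhds (Ψ (tz T i x)))} with hG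
  have hGμ : μ Gᶜ = 0 := hgoodall
  have hGsub : ∀ x ∈ (toMeasurable μ Gᶜ)ᶜ, x ∈ G := fun x hx => by
    by_contra h
    exact hx (subset_toMeasurable _ _ h)
  refine ⟨Ψ, hΨm, (toMeasurable μ Gᶜ)ᶜ, (measurableSet_toMeasurable _ _).compl, ?_, ?_, ?_⟩
  · rw [compl_compl, measure_toMeasurable, hGμ]
  · intro x hx x' hx' hxx
    obtain ⟨⟨hW1, hE1⟩, hl1⟩ := hGsub x hx
    obtain ⟨⟨hW2, hE2⟩, hl2⟩ := hGsub x' hx'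
    have heq1 := hequiv x hW1 hl1
    have heq2 := hequiv x' hW2 hl2
    have hΨi : ∀ i : ℤ, Ψ (tz T i x) = Ψ (tz T i x') := by
      intro i
      induction i with
      | zero => simpa using hxx
      | succ i ih => rw [heq1, heq2, ih]
      | pred i ih =>
        apply hinj
        rw [← heq1, ← heq2]
        simpa using ih
    refine hsep _ _ fun i => ?_
    obtain ⟨l, hl⟩ := eventually_atTop.1 (((hW1.and hE1).and (hW2.and hE2)).and
      (eventually_ge_atTop i))
    have hli := hl l le_rfl
    refine hEU l x x' ((S (l + 1)).robust x x' ?_) hli.1.1.2 hli.1.2.2 i hli.2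
    intro j hj1 hj2 hb1 hb2
    have h1 := hdist x (l + 1) (fun k hk => (hl k (by omega)).1.1.1) hl1 j
      (by push_cast at hj1; omega) (by push_cast at hj2; omega) hb1
    have h2 := hdist x' (l + 1) (fun k hk => (hl k (by omega)).1.2.1) hl2 j
      (by push_cast at hj1; omega) (by push_cast at hj2; omega) hb2
    rw [← hΨi j] at h2
    have h3 :=
      dist_triangle_right ((S (l + 1)).Ψ (tz T j x)) ((S (l + 1)).Ψ (tz T j x')) (Ψ (tz T j x))
    linarith
  · intro x hx
    obtain ⟨⟨hW1, -⟩, hl1⟩ := hGsub x hx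
    simpa using hequiv x hW1 hl1 0

/-- An ergodic system with Rokhlin towers and entropy below `c` embeds in the target. -/
theorem exists_embedding_of_target [IsProbabilityMeasure μ] (hT : Ergodic T μ)
    (hbases : HasBases μ T) (hfin : ksEntropy μ T ≠ ∞) {f : Y → Y} {H : Set Y} {o : Y} {ε c : ℝ}
    (htar : IsTarget f H o ε c) (hc : (ksEntropy μ T).toReal < c)
    {U : ℕ → Set X} (hU : ∀ i, MeasurableSet (U i))
    (hsep : ∀ x x', (∀ i, x ∈ U i ↔ x' ∈ U i) → x = x') :
    ∃ Ψ : X → Y, IsMeasEmbedding μ T f Ψ := by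
  obtain ⟨τ₀, K, S, hS₀, hS⟩ := exists_stages hT hbases hfin htar hc hU
  exact exists_embedding_of_stages hT.toMeasurePreserving htar.cont htar.inj hsep htar.eps_pos S
    hS₀ hS

end limit

/-! ### The embedding theorem -/

section core

variable {X : Type*} [MeasurableSpace X] {μ : Measure X} {T : X ≃ᵐ X}

/-- The restriction of an invertible transformation to an invariant set. -/
def restrictEquiv (T : X ≃ᵐ X) {s : Set X} (hs : ∀ x, T x ∈ s ↔ x ∈ s) : s ≃ᵐ s where
  toFun x := ⟨T x, (hs x).2 x.2⟩
  invFun x := ⟨T.symm x, (hs _).1 (by simp)⟩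
  left_inv x := by simp
  right_inv x := by simp
  measurable_toFun := (T.measurable.comp measurable_subtype_coe).subtype_mk
  measurable_invFun := (T.symm.measurable.comp measurable_subtype_coe).subtype_mk

theorem coe_restrictEquiv {s : Set X} (hs : ∀ x, T x ∈ s ↔ x ∈ s) (x : s) :
    (restrictEquiv T hs x : X) = T x := rfl

theorem coe_restrictEquiv_iterate {s : Set X} (hs : ∀ x, T x ∈ s ↔ x ∈ s) (n : ℕ) (x : s) :
    ((restrictEquiv T hs)^[n] x : X) = T^[n] x := by
  induction n with
  | zero => rfl
  | succ n ih => rw [Function.iterate_succ_apply', Function.iterate_succ_apply', coe_restrictEquiv,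
    ih]

theorem coe_tz_restrictEquiv {s : Set X} (hs : ∀ x, T x ∈ s ↔ x ∈ s) (i : ℤ) (x : s) :
    ((tz (restrictEquiv T hs) i x : s) : X) = tz T i x := by
  obtain ⟨n, rfl | rfl⟩ := i.eq_nat_or_neg
  · rw [tz_natCast, tz_natCast, coe_restrictEquiv_iterate]
  · have h := coe_restrictEquiv_iterate hs n (tz (restrictEquiv T hs) (-(n : ℤ)) x)
    rw [← tz_natCast, tz_tz, ← tz_natCast] at h
    simp only [add_neg_cancel, tz_zero] at h
    rw [h, tz_tz]; simp

theorem measurePreserving_coe {s : Set X} (hs : MeasurableSet s) (h0 : μ sᶜ = 0) :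
    MeasurePreserving ((↑) : s → X) (μ.comap (↑)) μ :=
  ⟨measurable_subtype_coe, by
    rw [map_comap_subtype_coe hs, Measure.restrict_eq_self_of_ae_mem]
    exact h0⟩

theorem ergodic_restrictEquiv (hT : Ergodic T μ) {s : Set X} (hs : ∀ x, T x ∈ s ↔ x ∈ s)
    (hsm : MeasurableSet s) (h0 : μ sᶜ = 0) :
    Ergodic (restrictEquiv T hs) (μ.comap ((↑) : s → X)) := by
  have hval := measurePreserving_coe hsm h0
  have hmp : MeasurePreserving (restrictEquiv T hs) (μ.comap ((↑) : s → X)) (μ.comap (↑)) := by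
    refine ⟨(restrictEquiv T hs).measurable, ?_⟩
    ext A hA
    rw [Measure.map_apply (restrictEquiv T hs).measurable hA]
    obtain ⟨V, hV, rfl⟩ := hA
    rw [← preimage_comp, show ((↑) : s → X) ∘ restrictEquiv T hs = T ∘ (↑) from rfl, preimage_comp,
      hval.measure_preimage (T.measurable hV).nullMeasurableSet,
      hval.measure_preimage hV.nullMeasurableSet,
      hT.toMeasurePreserving.measure_preimage hV.nullMeasurableSet]
  refine ⟨hmp, ⟨fun A hA hinv => ?_⟩⟩
  have hV : MeasurableSet ((↑) '' A : Set X) := hsm.subtype_image hA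
  have hTV : T ⁻¹' ((↑) '' A) = (↑) '' A := by
    ext x
    constructor
    · rintro ⟨y, hy, hyx⟩
      have hx : x ∈ s := (hs x).1 (hyx ▸ y.2)
      refine ⟨⟨x, hx⟩, ?_, rfl⟩
      rw [← hinv]
      have : restrictEquiv T hs ⟨x, hx⟩ = y := Subtype.ext hyx.symm
      rwa [mem_preimage, this]
    · rintro ⟨y, hy, rfl⟩
      rw [← hinv] at hy
      exact ⟨_, hy, rfl⟩
  have h1 := (hT.aeconst_set hV hTV).comp_tendsto hval.quasiMeasurePreserving.tendsto_ae
  have h2 : ((↑) ⁻¹' ((↑) '' A : Set X) : Set s) = A := preimage_image_eq _ Subtype.val_injective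
  rw [← h2]
  exact h1

theorem ksEntropy_restrictEquiv_le [IsProbabilityMeasure μ] {s : Set X}
    (hs : ∀ x, T x ∈ s ↔ x ∈ s) (hsm : MeasurableSet s) (h0 : μ sᶜ = 0) :
    ksEntropy (μ.comap ((↑) : s → X)) (restrictEquiv T hs) ≤ ksEntropy μ T := by
  classical
  have hval := measurePreserving_coe hsm h0
  obtain ⟨x₀, hx₀⟩ : s.Nonempty := by
    rw [nonempty_iff_ne_empty]
    rintro rfl
    simp at h0
  refine iSup_le fun k => iSup_le fun P => iSup_le fun hP => ?_
  let R : X → Fin k := fun x => if hx : x ∈ s then P ⟨x, hx⟩ else P ⟨x₀, hx₀⟩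
  have hR : Measurable R := by
    refine Measurable.dite (s := s) (f := fun x : s => P x) (g := fun _ => P ⟨x₀, hx₀⟩) ?_ ?_ hsm
    · exact hP
    · exact measurable_const
  refine le_trans ?_ (le_iSup_of_le k (le_iSup_of_le R (le_iSup_of_le hR le_rfl)))
  refine le_of_eq ?_
  congr 1
  unfold entropyWrt infoEntropy
  congr 1
  funext n
  congr 1
  refine Finset.sum_congr rfl fun v _ => ?_
  congr 2
  rw [← hval.measure_preimage]
  · congr 1
    ext x
    simp only [mem_preimage, mem_singleton_iff]
    have : ∀ i : Fin n, R (T^[(i : ℕ)] x) = P ((restrictEquiv T hs)^[(i : ℕ)] x) := by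
      intro i
      rw [← coe_restrictEquiv_iterate hs]
      simp [R]
    simp only [this]
  · refine MeasurableSet.nullMeasurableSet ?_
    exact (measurable_pi_lambda _ fun i => hR.comp (T.measurable.iterate _))
      (measurableSet_singleton v)

variable {Y : Type*} [MetricSpace Y] [CompleteSpace Y] [MeasurableSpace Y] [BorelSpace Y]

theorem exists_embedding [StandardBorelSpace X] [IsProbabilityMeasure μ] [NullSingletonClass μ]
    (hT : Ergodic T μ) (hfin : ksEntropy μ T ≠ ∞) {f : Y → Y} {H : Set Y} {o : Y} {ε c : ℝ}
    (htar : IsTarget f H o ε c) (hc : (ksEntropy μ T).toReal < c) :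
    ∃ Ψ : X → Y, IsMeasEmbedding μ T f Ψ := by
  classical
  choose C hC hC0 hCsep using exists_sparse_set hT
  set s : Set X := {x | ∀ N : ℕ, ∀ j : ℤ, (∃ i : ℕ, tz T (i + j) x ∈ C N) ∧
    ∃ i : ℕ, tz T (-i + j) x ∈ C N} with hs_def
  have hs : ∀ x, T x ∈ s ↔ x ∈ s := by
    intro x
    constructor
    · intro h N j
      have := h N (j - 1)
      rw [← tz_one T x] at this
      simp only [tz_tz] at this
      simpa [add_assoc] using this
    · intro h N j
      have := h N (j + 1)
      rw [← tz_one T x]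
      simp only [tz_tz]
      simpa [add_assoc] using this
  have hsm : MeasurableSet s := by
    have : s = ⋂ N : ℕ, ⋂ j : ℤ,
      (⋃ i : ℕ, tz T (i + j) ⁻¹' C N) ∩ ⋃ i : ℕ, tz T (-i + j) ⁻¹' C N := by
      ext x; simp [hs_def]
    rw [this]
    exact MeasurableSet.iInter fun N => MeasurableSet.iInter fun j =>
      (MeasurableSet.iUnion fun i => measurable_tz _ (hC N)).inter
        (MeasurableSet.iUnion fun i => measurable_tz _ (hC N))
  have h0 : μ sᶜ = 0 := by
    have : ∀ᵐ x ∂μ, ∀ N : ℕ, ∀ j : ℤ, (∃ i : ℕ, tz T (i + j) x ∈ C N) ∧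
        ∃ i : ℕ, tz T (-i + j) x ∈ C N := by
      rw [ae_all_iff]; intro N
      rw [ae_all_iff]; intro j
      have hq := (measurePreserving_tz hT.toMeasurePreserving j).quasiMeasurePreserving
      filter_upwards [hq.ae (ae_exists_iterate_mem hT (hC N) (hC0 N)),
        hq.ae (ae_exists_iterate_mem hT.symm (hC N) (hC0 N))] with x h1 h2
      constructor
      · obtain ⟨i, hi⟩ := h1
        exact ⟨i, by rwa [← tz_natCast, tz_tz] at hi⟩
      · obtain ⟨i, hi⟩ := h2
        exact ⟨i, by rwa [← tz_negCast, tz_tz] at hi⟩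
    exact this
  have hval := measurePreserving_coe hsm h0
  have hprob : IsProbabilityMeasure (μ.comap ((↑) : s → X)) := ⟨by
    rw [← measure_univ (μ := μ), ← hval.measure_preimage MeasurableSet.univ.nullMeasurableSet,
      preimage_univ]⟩
  have hT₀ := ergodic_restrictEquiv hT hs hsm h0
  have hks := ksEntropy_restrictEquiv_le (T := T) hs hsm h0
  have hbases : HasBases (μ.comap ((↑) : s → X)) (restrictEquiv T hs) := by
    refine hasBases_of_sparse hT₀.toMeasurePreserving fun N _ => ⟨((↑) : s → X) ⁻¹' C N,
      hC N |>.preimage measurable_subtype_coe, fun x hx i hi0 hi => ?_, fun x => ?_, fun x => ?_⟩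
    · rw [mem_preimage, coe_tz_restrictEquiv]
      exact hCsep N x hx i hi0 hi
    · obtain ⟨i, hi⟩ := (x.2 N 0).1
      exact ⟨i, by rw [mem_preimage, coe_tz_restrictEquiv]; simpa using hi⟩
    · obtain ⟨i, hi⟩ := (x.2 N 0).2
      exact ⟨i, by rw [mem_preimage, coe_tz_restrictEquiv]; simpa using hi⟩
  obtain ⟨U, hU, hUsep⟩ := exists_seq_separating X (p := MeasurableSet) MeasurableSet.empty univ
  obtain ⟨Ψ, hΨ, X', hX', hX'0, hinj, hequiv⟩ := exists_embedding_of_target hT₀ hbases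
    (ne_top_of_le_ne_top hfin hks) htar ((ENNReal.toReal_mono hfin hks).trans_lt hc)
    (U := fun i => ((↑) : s → X) ⁻¹' U i) (fun i => measurable_subtype_coe (hU i))
    (fun x x' h => Subtype.ext (hUsep _ (mem_univ _) _ (mem_univ _) h))
  refine ⟨fun x => if hx : x ∈ s then Ψ ⟨x, hx⟩ else o, ?_, (↑) '' X', hsm.subtype_image hX', ?_,
    ?_, ?_⟩
  · exact Measurable.dite (s := s) (f := Ψ) (g := fun _ => o) hΨ measurable_const hsm
  · rw [← hval.measure_preimage (hsm.subtype_image hX').compl.nullMeasurableSet, preimage_compl,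
      preimage_image_eq _ Subtype.val_injective, hX'0]
  · rintro _ ⟨x, hx, rfl⟩ _ ⟨x', hx', rfl⟩ h
    simp only [Subtype.coe_prop, dif_pos, Subtype.coe_eta] at h
    rw [hinj hx hx' h]
  · rintro _ ⟨x, hx, rfl⟩
    have := hequiv x hx
    simp only [Subtype.coe_prop, (hs x).2 x.2, dif_pos, Subtype.coe_eta]
    exact this

end core

/-! ### Growth of vectors under a matrix -/

section split

section growth

variable {𝕜 V : Type*} [NormedField 𝕜] [NormedAddCommGroup V] [NormedSpace 𝕜 V]

/-- The vectors whose forward orbit decays exponentially. -/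
def expDecay (B : Module.End 𝕜 V) : Submodule 𝕜 V where
  carrier := {v | ∃ κ : ℝ, 0 < κ ∧ κ < 1 ∧ ∃ C : ℝ, 0 ≤ C ∧ ∀ n : ℕ, ‖(B ^ n) v‖ ≤ C * κ ^ n}
  zero_mem' := ⟨1 / 2, by norm_num, by norm_num, 0, le_rfl, fun n => by simp⟩
  add_mem' := by
    rintro v w ⟨κ, h0, h1, C, hC, h⟩ ⟨κ', h0', h1', C', hC', h'⟩
    refine ⟨max κ κ', lt_max_of_lt_left h0, max_lt h1 h1', C + C', by positivity, fun n => ?_⟩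
    rw [map_add, add_mul]
    refine (norm_add_le _ _).trans (add_le_add ((h n).trans ?_) ((h' n).trans ?_))
    · gcongr; exact le_max_left _ _
    · gcongr; exact le_max_right _ _
  smul_mem' := by
    rintro a v ⟨κ, h0, h1, C, hC, h⟩
    refine ⟨κ, h0, h1, ‖a‖ * C, by positivity, fun n => ?_⟩
    rw [map_smul, norm_smul, mul_assoc]
    exact mul_le_mul_of_nonneg_left (h n) (norm_nonneg a)

/-- The vectors whose forward orbit grows subexponentially. -/
def subexpGrowth (B : Module.End 𝕜 V) : Submodule 𝕜 V where
  carrier := {v | ∀ η : ℝ, 0 < η → ∃ C : ℝ, 0 ≤ C ∧ ∀ n : ℕ, ‖(B ^ n) v‖ ≤ C * Real.exp η ^ n}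
  zero_mem' := fun η _ => ⟨0, le_rfl, fun n => by simp⟩
  add_mem' := by
    intro v w hv hw η hη
    obtain ⟨C, hC, h⟩ := hv η hη
    obtain ⟨C', hC', h'⟩ := hw η hη
    refine ⟨C + C', by positivity, fun n => ?_⟩
    rw [map_add, add_mul]
    exact (norm_add_le _ _).trans (add_le_add (h n) (h' n))
  smul_mem' := by
    intro a v hv η hη
    obtain ⟨C, hC, h⟩ := hv η hη
    refine ⟨‖a‖ * C, by positivity, fun n => ?_⟩
    rw [map_smul, norm_smul, mul_assoc]
    exact mul_le_mul_of_nonneg_left (h n) (norm_nonneg a)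

theorem exists_norm_pow_apply_le (B : Module.End 𝕜 V) {l : 𝕜} {ρ : ℝ} (hl : ‖l‖ < ρ) (k : ℕ) :
    ∀ v, ((B - algebraMap 𝕜 _ l) ^ k) v = 0 → ∃ C : ℝ, 0 ≤ C ∧ ∀ n : ℕ,
      ‖(B ^ n) v‖ ≤ C * ρ ^ n := by
  induction k with
  | zero => intro v hv; exact ⟨0, le_rfl, fun n => by simp at hv; simp [hv]⟩
  | succ k ih =>
    intro v hv
    rw [pow_succ, Module.End.mul_apply] at hv
    obtain ⟨C, hC, h⟩ := ih _ hv
    have hρ : 0 < ρ - ‖l‖ := by linarith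
    refine ⟨max ‖v‖ (C / (ρ - ‖l‖)), le_max_of_le_left (norm_nonneg v), fun n => ?_⟩
    induction n with
    | zero => simp
    | succ n ihn =>
      have e : (B ^ (n + 1)) v = l • (B ^ n) v + (B ^ n) ((B - algebraMap 𝕜 _ l) v) := by
        rw [LinearMap.sub_apply, Module.algebraMap_end_apply, map_sub, map_smul, pow_succ,
          Module.End.mul_apply]
        abel
      rw [e]
      have hC' : C ≤ max ‖v‖ (C / (ρ - ‖l‖)) * (ρ - ‖l‖) := by
        rw [← div_le_iff₀ hρ]; exact le_max_right _ _
      have hp : 0 ≤ ρ ^ n := pow_nonneg ((norm_nonneg l).trans hl.le) n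
      calc _ ≤ ‖l‖ * ‖(B ^ n) v‖ + C * ρ ^ n := by
            refine (norm_add_le _ _).trans (add_le_add (norm_smul_le _ _) (h n))
        _ ≤ ‖l‖ * (max ‖v‖ (C / (ρ - ‖l‖)) * ρ ^ n) + max ‖v‖ (C / (ρ - ‖l‖)) *
          (ρ - ‖l‖) * ρ ^ n := by
            gcongr
        _ = _ := by rw [pow_succ]; ring

end growth

theorem expDecay_sup_subexpGrowth_complex {V : Type*} [NormedAddCommGroup V] [NormedSpace ℂ V]
    [FiniteDimensional ℂ V] (f g : Module.End ℂ V) (hgf : g * f = 1) (hfg : f * g = 1) :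
    expDecay g ⊔ subexpGrowth f = ⊤ := by
  rw [eq_top_iff, ← Module.End.iSup_maxGenEigenspace_eq_top f]
  refine iSup_le fun l => ?_
  intro v hv
  rw [Module.End.mem_maxGenEigenspace] at hv
  obtain ⟨k, hk⟩ := hv
  have hk' : ((f - algebraMap ℂ _ l) ^ k) v = 0 := hk
  rcases le_or_gt ‖l‖ 1 with hl | hl
  · refine Submodule.mem_sup_right fun η hη => ?_
    exact exists_norm_pow_apply_le f (hl.trans_lt (by simpa using hη)) k v hk'
  · refine Submodule.mem_sup_left ?_
    have hl0 : l ≠ 0 := by rintro rfl; simp at hl; linarith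
    have hlt : ‖l⁻¹‖ < 1 := by rw [norm_inv]; exact inv_lt_one_of_one_lt₀ hl
    obtain ⟨κ, h1, h2⟩ := exists_between hlt
    refine ⟨κ, (norm_nonneg _).trans_lt h1, h2, ?_⟩
    refine exists_norm_pow_apply_le g h1 k v ?_
    have e : g - algebraMap ℂ _ l⁻¹ = (-(l⁻¹ • g)) * (f - algebraMap ℂ _ l) := by
      rw [mul_sub, neg_mul, smul_mul_assoc, hgf, neg_mul, smul_mul_assoc,
        Algebra.algebraMap_eq_smul_one,
        Algebra.algebraMap_eq_smul_one, mul_smul_comm, mul_one, smul_smul, inv_mul_cancel₀ hl0]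
      simp only [one_smul]; abel
    have hc : Commute (-(l⁻¹ • g)) (f - algebraMap ℂ _ l) := by
      refine Commute.neg_left (Commute.smul_left (Commute.sub_right ?_ ?_) _)
      · rw [Commute, SemiconjBy, hgf, hfg]
      · exact (Algebra.commutes l g).symm
    rw [e, hc.mul_pow, Module.End.mul_apply, hk', map_zero]

theorem expDecay_sup_subexpGrowth {d : ℕ} (M N : Matrix (Fin d) (Fin d) ℝ) (hMN : M * N = 1) :
    expDecay N.toLin' ⊔ subexpGrowth M.toLin' = ⊤ := by
  have hNM : N * M = 1 := mul_eq_one_comm.1 hMN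
  have hmul : ∀ P Q : Matrix (Fin d) (Fin d) ℝ, P * Q = 1 →
      (P.map ((↑) : ℝ → ℂ)).toLin' * (Q.map ((↑) : ℝ → ℂ)).toLin' = 1 := by
    intro P Q h
    have : P.map ((↑) : ℝ → ℂ) * Q.map ((↑) : ℝ → ℂ) = 1 := by
      rw [← Matrix.map_one Complex.ofRealHom (map_zero _) (map_one _), ← h]
      exact (Matrix.map_mul (f := Complex.ofRealHom)).symm
    rw [Module.End.mul_eq_comp, ← Matrix.toLin'_mul, this, Matrix.toLin'_one]; rfl
  have key := expDecay_sup_subexpGrowth_complex _ _ (hmul N M hNM) (hmul M N hMN)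
  have hre : ∀ (B : Matrix (Fin d) (Fin d) ℝ) (n : ℕ) (w : Fin d → ℂ),
      (fun i => (((B.map ((↑) : ℝ → ℂ)).toLin' ^ n) w i).re) =
        (B.toLin' ^ n) fun i => (w i).re := by
    intro B n
    induction n with
    | zero => intro w; rfl
    | succ n ih =>
      intro w
      rw [pow_succ, Module.End.mul_apply, ih, pow_succ, Module.End.mul_apply]
      congr 1
      ext i
      simp [Matrix.toLin'_apply, Matrix.mulVec, dotProduct]
  have hnorm : ∀ w : Fin d → ℂ, ‖fun i => (w i).re‖ ≤ ‖w‖ := fun w => by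
    rw [pi_norm_le_iff_of_nonneg (norm_nonneg _)]
    intro i
    exact (Complex.abs_re_le_norm _).trans (norm_le_pi_norm w i)
  rw [eq_top_iff]
  intro v _
  have hv : (fun i => (v i : ℂ)) ∈ expDecay (N.map ((↑) : ℝ → ℂ)).toLin' ⊔
    subexpGrowth (M.map ((↑) : ℝ → ℂ)).toLin' := key ▸ Submodule.mem_top
  obtain ⟨y, ⟨κ, h0, h1, C, hC, hy⟩, z, hz, hyz⟩ := Submodule.mem_sup.1 hv
  refine Submodule.mem_sup.2 ⟨fun i => (y i).re, ⟨κ, h0, h1, C, hC, fun n => ?_⟩,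
    fun i => (z i).re, fun η hη => ?_, ?_⟩
  · rw [← hre]; exact (hnorm _).trans (hy n)
  · obtain ⟨C, hC, h⟩ := hz η hη
    refine ⟨C, hC, fun n => ?_⟩
    rw [← hre]; exact (hnorm _).trans (h n)
  · ext i
    have := congrArg Complex.re (congrFun hyz i)
    simpa using this

/-- A projection onto the expanding subspace of `f` along a subspace of subexponential growth. -/
structure IsSplitting {V : Type*} [NormedAddCommGroup V] [NormedSpace ℝ V]
    (f g p : Module.End ℝ V) (κ C : ℝ) (D : ℝ → ℝ) : Prop where
  gf : ∀ v, g (f v) = v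
  fg : ∀ v, f (g v) = v
  idem : ∀ v, p (p v) = p v
  f_mem : ∀ v, p v = v → p (f v) = f v
  g_mem : ∀ v, p v = v → p (g v) = g v
  pos : 0 < κ
  lt_one : κ < 1
  C_pos : 0 < C
  le : ∀ (n : ℕ) v, p v = v → ‖(g ^ n) v‖ ≤ C * κ ^ n * ‖v‖
  norm_le : ∀ v, ‖p v‖ ≤ C * ‖v‖
  D_pos : ∀ η, 0 < η → 0 < D η
  le_exp : ∀ η, 0 < η → ∀ (n : ℕ) v, ‖(f ^ n) (v - p v)‖ ≤ D η * Real.exp η ^ n * ‖v‖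

theorem exists_uniform_expDecay {d : ℕ} {V : Type*} [NormedAddCommGroup V] [NormedSpace ℝ V]
    (g : Module.End ℝ V) (p : (Fin d → ℝ) →ₗ[ℝ] V) (h : ∀ v, p v ∈ expDecay g) :
    ∃ κ C : ℝ, 0 < κ ∧ κ < 1 ∧ 0 < C ∧ ∀ (n : ℕ) v, ‖(g ^ n) (p v)‖ ≤ C * κ ^ n * ‖v‖ := by
  choose κ h0 h1 C hC hb using fun i : Fin d => h (Pi.single i 1)
  obtain ⟨K, hK0, hK1, hK⟩ : ∃ K : ℝ, 0 < K ∧ K < 1 ∧ ∀ i, κ i ≤ K := by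
    rcases isEmpty_or_nonempty (Fin d) with he | he
    · exact ⟨1 / 2, by norm_num, by norm_num, fun i => he.elim i⟩
    · obtain ⟨i, hi⟩ := Finite.exists_max κ
      exact ⟨κ i, h0 i, h1 i, hi⟩
  refine ⟨K, ∑ i, C i + 1, hK0, hK1,
    by have := Finset.sum_nonneg fun i (_ : i ∈ Finset.univ) => hC i; linarith,
    fun n v => ?_⟩
  have hv : v = ∑ i, v i • (Pi.single i 1 : Fin d → ℝ) := by
    ext j; simp [Finset.sum_apply, Pi.single_apply]
  calc ‖(g ^ n) (p v)‖ = ‖∑ i, v i • (g ^ n) (p (Pi.single i 1))‖ := by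
        conv_lhs => rw [hv]
        simp only [map_sum, map_smul]
    _ ≤ ∑ i, ‖v‖ * (C i * K ^ n) := by
        refine norm_sum_le_of_le _ fun i _ => ?_
        rw [norm_smul]
        refine mul_le_mul (norm_le_pi_norm v i) ((hb i n).trans ?_) (norm_nonneg _) (norm_nonneg _)
        exact mul_le_mul_of_nonneg_left (pow_le_pow_left₀ (h0 i).le (hK i) n) (hC i)
    _ = (∑ i, C i) * K ^ n * ‖v‖ := by rw [← Finset.mul_sum, ← Finset.sum_mul]; ring
    _ ≤ _ := by gcongr; linarith

theorem exists_uniform_subexpGrowth {d : ℕ} {V : Type*} [NormedAddCommGroup V] [NormedSpace ℝ V]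
    (f : Module.End ℝ V) (p : (Fin d → ℝ) →ₗ[ℝ] V) (h : ∀ v, p v ∈ subexpGrowth f)
    {η : ℝ} (hη : 0 < η) :
    ∃ C : ℝ, 0 < C ∧ ∀ (n : ℕ) v, ‖(f ^ n) (p v)‖ ≤ C * Real.exp η ^ n * ‖v‖ := by
  choose C hC hb using fun i : Fin d => h (Pi.single i 1) η hη
  refine ⟨∑ i, C i + 1,
    by have := Finset.sum_nonneg fun i (_ : i ∈ Finset.univ) => hC i; linarith,
    fun n v => ?_⟩
  have hv : v = ∑ i, v i • (Pi.single i 1 : Fin d → ℝ) := by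
    ext j; simp [Finset.sum_apply, Pi.single_apply]
  calc ‖(f ^ n) (p v)‖ = ‖∑ i, v i • (f ^ n) (p (Pi.single i 1))‖ := by
        conv_lhs => rw [hv]
        simp only [map_sum, map_smul]
    _ ≤ ∑ i, ‖v‖ * (C i * Real.exp η ^ n) := by
        refine norm_sum_le_of_le _ fun i _ => ?_
        rw [norm_smul]
        exact mul_le_mul (norm_le_pi_norm v i) (hb i n) (norm_nonneg _) (norm_nonneg _)
    _ = (∑ i, C i) * Real.exp η ^ n * ‖v‖ := by rw [← Finset.mul_sum, ← Finset.sum_mul]; ring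
    _ ≤ _ := by gcongr; linarith

theorem mem_expDecay_of_inverse {V : Type*} [NormedAddCommGroup V] [NormedSpace ℝ V]
    {f g : Module.End ℝ V} (hgf : ∀ v, g (f v) = v) {v : V} (hv : v ∈ expDecay g) :
    f v ∈ expDecay g := by
  obtain ⟨κ, h0, h1, C, hC, h⟩ := hv
  refine ⟨κ, h0, h1, ‖f v‖ + C / κ, by positivity, fun n => ?_⟩
  cases n with
  | zero => simp; positivity
  | succ n =>
    rw [pow_succ g, Module.End.mul_apply, hgf]
    have : C * κ ^ n = C / κ * κ ^ (n + 1) := by rw [pow_succ]; field_simp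
    rw [add_mul, ← this]
    exact (h n).trans (le_add_of_nonneg_left (by positivity))

theorem expDecay_map_mem {V : Type*} [NormedAddCommGroup V] [NormedSpace ℝ V]
    {g : Module.End ℝ V} {v : V} (hv : v ∈ expDecay g) : g v ∈ expDecay g := by
  obtain ⟨κ, h0, h1, C, hC, h⟩ := hv
  refine ⟨κ, h0, h1, C * κ, by positivity, fun n => ?_⟩
  have := h (n + 1)
  rw [pow_succ g, Module.End.mul_apply] at this
  exact this.trans (le_of_eq (by ring))

theorem exists_isSplitting_of_sup {d : ℕ} {f g : Module.End ℝ (Fin d → ℝ)} (hgf : ∀ v, g (f v) = v)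
    (hfg : ∀ v, f (g v) = v) (hsup : expDecay g ⊔ subexpGrowth f = ⊤) :
    ∃ p κ C D, IsSplitting f g p κ C D := by
  obtain ⟨W, hWle, hW⟩ : ∃ W ≤ subexpGrowth f, IsCompl (expDecay g) W := by
    obtain ⟨W, h1, h2⟩ := IsModularLattice.exists_disjoint_and_sup_eq
      (inf_le_right : expDecay g ⊓ subexpGrowth f ≤ subexpGrowth f)
    have hle : W ≤ subexpGrowth f := h2 ▸ le_sup_right
    refine ⟨W, hle, ?_, ?_⟩
    · rw [disjoint_iff_inf_le]
      exact (le_inf (le_inf inf_le_left (inf_le_right.trans hle)) inf_le_right).trans h1.le_bot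
    · rw [codisjoint_iff_le_sup, ← hsup]
      refine sup_le le_sup_left ?_
      rw [← h2]
      exact sup_le (inf_le_left.trans le_sup_left) le_sup_right
  obtain ⟨p, hp, hq, hfix⟩ : ∃ p : Module.End ℝ (Fin d → ℝ), (∀ v, p v ∈ expDecay g) ∧
      (∀ v, v - p v ∈ subexpGrowth f) ∧ ∀ v ∈ expDecay g, p v = v :=
    ⟨(expDecay g).projection W hW, fun v => Submodule.projection_apply_mem hW v,
      fun v => hWle (Submodule.sub_projection_mem hW v),
      fun v hv => Submodule.projection_apply_of_mem_left hW hv⟩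
  obtain ⟨κ, C, h0, h1, hC, hb⟩ := exists_uniform_expDecay g p hp
  obtain ⟨q, hqp⟩ : ∃ q : (Fin d → ℝ) →ₗ[ℝ] (Fin d → ℝ), ∀ v, q v = v - p v :=
    ⟨LinearMap.id - p, fun v => rfl⟩
  have hD : ∀ η : ℝ, ∃ D : ℝ, 0 < η → 0 < D ∧
      ∀ (n : ℕ) v, ‖(f ^ n) (v - p v)‖ ≤ D * Real.exp η ^ n * ‖v‖ := by
    intro η
    by_cases hη : 0 < η
    · obtain ⟨D, hD, h⟩ := exists_uniform_subexpGrowth f q (fun v => (hqp v).symm ▸ hq v) hη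
      exact ⟨D, fun _ => ⟨hD, fun n v => hqp v ▸ h n v⟩⟩
    · exact ⟨0, fun h => absurd h hη⟩
  choose D hD using hD
  refine ⟨p, κ, C, D, hgf, hfg, fun v => hfix _ (hp v), fun v hv => ?_, fun v hv => ?_, h0, h1, hC,
    fun n v hv => ?_, fun v => ?_, fun η hη => (hD η hη).1, fun η hη => (hD η hη).2⟩
  · exact hfix _ (mem_expDecay_of_inverse hgf (hv ▸ hp v))
  · exact hfix _ (expDecay_map_mem (hv ▸ hp v))
  · have := hb n v
    rwa [hv] at this
  · simpa using hb 0 v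

theorem exists_isSplitting {d : ℕ} (M N : Matrix (Fin d) (Fin d) ℝ) (hMN : M * N = 1) :
    ∃ p κ C D, IsSplitting M.toLin' N.toLin' p κ C D := by
  have hNM : N * M = 1 := mul_eq_one_comm.1 hMN
  exact exists_isSplitting_of_sup (fun v => by simp [hNM]) (fun v => by simp [hMN])
    (expDecay_sup_subexpGrowth M N hMN)

end split

/-! ### Integer linear forms on the expanding subspace -/

section dioph

variable {d : ℕ}

/-- The linear form on `ℝ^d` with integer coefficients `ξ`. -/
def zdot (ξ : Fin d → ℤ) : (Fin d → ℝ) →ₗ[ℝ] ℝ where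
  toFun v := ∑ i, (ξ i : ℝ) * v i
  map_add' v w := by simp [mul_add, Finset.sum_add_distrib]
  map_smul' a v := by simp [Finset.mul_sum, mul_left_comm]

theorem zdot_apply (ξ : Fin d → ℤ) (v : Fin d → ℝ) : zdot ξ v = ∑ i, (ξ i : ℝ) * v i := rfl

theorem zdot_add (ξ ξ' : Fin d → ℤ) (v : Fin d → ℝ) : zdot (ξ + ξ') v = zdot ξ v + zdot ξ' v := by
  simp [zdot_apply, add_mul, Finset.sum_add_distrib]

theorem zdot_sub (ξ ξ' : Fin d → ℤ) (v : Fin d → ℝ) : zdot (ξ - ξ') v = zdot ξ v - zdot ξ' v := by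
  simp [zdot_apply, sub_mul, Finset.sum_sub_distrib]

theorem zdot_smul (a : ℤ) (ξ : Fin d → ℤ) (v : Fin d → ℝ) : zdot (a • ξ) v = a * zdot ξ v := by
  simp [zdot_apply, Finset.mul_sum, mul_assoc]

theorem zdot_single (ξ : Fin d → ℤ) (i : Fin d) : zdot ξ (Pi.single i 1) = ξ i := by
  simp [zdot_apply, Pi.single_apply]

theorem abs_zdot_le {ξ : Fin d → ℤ} {K : ℝ} (hξ : ∀ i, |(ξ i : ℝ)| ≤ K) (v : Fin d → ℝ) :
    |zdot ξ v| ≤ d * K * ‖v‖ := by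
  rw [zdot_apply]
  refine (Finset.abs_sum_le_sum_abs _ _).trans ?_
  calc _ ≤ ∑ _i : Fin d, K * ‖v‖ := by
        refine Finset.sum_le_sum fun i _ => ?_
        rw [abs_mul]
        exact mul_le_mul (hξ i) (norm_le_pi_norm v i) (abs_nonneg _) ((abs_nonneg _).trans (hξ i))
    _ = _ := by simp [mul_assoc]

theorem zdot_vecMul (A : Matrix (Fin d) (Fin d) ℤ) (ξ : Fin d → ℤ) (v : Fin d → ℝ) :
    zdot (Matrix.vecMul ξ A) v = zdot ξ ((A.map ((↑) : ℤ → ℝ)).toLin' v) := by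
  simp only [zdot_apply, Matrix.vecMul, Matrix.toLin'_apply, Matrix.mulVec, dotProduct,
    Matrix.map_apply, Int.cast_sum, Int.cast_mul, Finset.sum_mul, Finset.mul_sum]
  rw [Finset.sum_comm]
  simp only [mul_assoc]

theorem zdot_vecMul_pow (A : Matrix (Fin d) (Fin d) ℤ) (n : ℕ) (ξ : Fin d → ℤ) (v : Fin d → ℝ) :
    zdot (Matrix.vecMul ξ (A ^ n)) v = zdot ξ (((A.map ((↑) : ℤ → ℝ)).toLin' ^ n) v) := by
  induction n generalizing v with
  | zero => simp
  | succ n ih => rw [pow_succ, ← Matrix.vecMul_vecMul, zdot_vecMul, ih, pow_succ,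
    Module.End.mul_apply]

/-- The size of an integer linear form on the range of `p`. -/
noncomputable def formSize (p : Module.End ℝ (Fin d → ℝ)) (ξ : Fin d → ℤ) : ℝ :=
  ∑ i, |zdot ξ (p (Pi.single i 1))|

theorem formSize_nonneg (p : Module.End ℝ (Fin d → ℝ)) (ξ : Fin d → ℤ) : 0 ≤ formSize p ξ :=
  Finset.sum_nonneg fun _ _ => abs_nonneg _

theorem formSize_add_le (p : Module.End ℝ (Fin d → ℝ)) (ξ ξ' : Fin d → ℤ) :
    formSize p (ξ + ξ') ≤ formSize p ξ + formSize p ξ' := by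
  unfold formSize
  rw [← Finset.sum_add_distrib]
  exact Finset.sum_le_sum fun i _ => by rw [zdot_add]; exact abs_add_le _ _

theorem formSize_smul (p : Module.End ℝ (Fin d → ℝ)) (a : ℤ) (ξ : Fin d → ℤ) :
    formSize p (a • ξ) = |(a : ℝ)| * formSize p ξ := by
  simp only [formSize, zdot_smul, abs_mul, Finset.mul_sum]

theorem abs_zdot_le_formSize (p : Module.End ℝ (Fin d → ℝ)) (ξ : Fin d → ℤ) {v : Fin d → ℝ}
    (hv : p v = v) : |zdot ξ v| ≤ formSize p ξ * ‖v‖ := by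
  have hv' : v = ∑ i, v i • (Pi.single i 1 : Fin d → ℝ) := by
    ext j; simp [Finset.sum_apply, Pi.single_apply]
  have : zdot ξ v = ∑ i, v i * zdot ξ (p (Pi.single i 1)) := by
    conv_lhs => rw [← hv, hv']
    simp only [map_sum, map_smul, smul_eq_mul]
  rw [this, formSize, Finset.sum_mul]
  refine (Finset.abs_sum_le_sum_abs _ _).trans (Finset.sum_le_sum fun i _ => ?_)
  rw [abs_mul, mul_comm]
  exact mul_le_mul_of_nonneg_left (norm_le_pi_norm v i) (abs_nonneg _)

theorem norm_single_one_le (i : Fin d) : ‖(Pi.single i 1 : Fin d → ℝ)‖ ≤ 1 := by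
  rw [pi_norm_le_iff_of_nonneg zero_le_one]
  intro j
  by_cases h : j = i
  · subst h; simp
  · simp [h]

theorem eq_zero_of_expanding (N : (Fin d → ℤ) → ℝ) (hadd : ∀ ξ ξ', N (ξ + ξ') ≤ N ξ + N ξ')
    (hsmul : ∀ (a : ℤ) ξ, N (a • ξ) = |(a : ℝ)| * N ξ) (φ : ℕ → Fin d → ℤ) (h0 : 0 < N (φ 0))
    (h : ∀ j, 4 * N (φ j) ≤ N (φ (j + 1))) (b : ℕ → ℤ) (hb : ∀ j, |b j| ≤ 1) (J : ℕ)
    (hsum : ∑ j ∈ Finset.range J, b j • φ j = 0) : ∀ j < J, b j = 0 := by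
  have hN0 : N 0 = 0 := by simpa using hsmul 0 0
  have hpos : ∀ j, 0 < N (φ j) := by
    intro j
    induction j with
    | zero => exact h0
    | succ j ih => linarith [h j]
  have hle : ∀ J, N (∑ j ∈ Finset.range J, b j • φ j) ≤ N (φ J) / 3 := by
    intro J
    induction J with
    | zero => simp [hN0]; linarith
    | succ J ih =>
      rw [Finset.sum_range_succ]
      have h1 := hadd (∑ j ∈ Finset.range J, b j • φ j) (b J • φ J)
      have h2 : N (b J • φ J) ≤ N (φ J) := by
        rw [hsmul]
        refine mul_le_of_le_one_left (hpos J).le ?_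
        exact_mod_cast hb J
      linarith [h J]
  induction J with
  | zero => intro j hj; omega
  | succ J ih =>
    rw [Finset.sum_range_succ] at hsum
    have hbJ : b J = 0 := by
      have e : ∑ j ∈ Finset.range J, b j • φ j = (-1 : ℤ) • (b J • φ J) := by
        rw [neg_one_smul]; exact eq_neg_of_add_eq_zero_left hsum
      have h1 := hle J
      rw [e, hsmul, hsmul] at h1
      by_contra hne
      have : (1 : ℝ) ≤ |(b J : ℝ)| := by exact_mod_cast Int.one_le_abs hne
      have h2 := mul_le_mul_of_nonneg_right this (hpos J).le
      have h3 : |((-1 : ℤ) : ℝ)| = 1 := by simp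
      rw [h3] at h1
      linarith [hpos J]
    rw [hbJ, zero_smul, add_zero] at hsum
    intro j hj
    rcases Nat.lt_succ_iff_lt_or_eq.1 hj with h | rfl
    · exact ih hsum j h
    · exact hbJ

theorem two_pow_le_of_expanding (N : (Fin d → ℤ) → ℝ) (hadd : ∀ ξ ξ', N (ξ + ξ') ≤ N ξ + N ξ')
    (hsmul : ∀ (a : ℤ) ξ, N (a • ξ) = |(a : ℝ)| * N ξ) (φ : ℕ → Fin d → ℤ) (h0 : 0 < N (φ 0))
    (h : ∀ j, 4 * N (φ j) ≤ N (φ (j + 1))) (J R : ℕ) (hR : ∀ j < J, ∀ i, |φ j i| ≤ R) :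
    2 ^ J ≤ (2 * (J * R) + 1) ^ d := by
  classical
  by_contra! hlt
  set B : Finset (Fin d → ℤ) := Fintype.piFinset fun _ => Finset.Icc (-(J * R : ℕ) : ℤ) (J * R : ℕ)
  have hB : B.card = (2 * (J * R) + 1) ^ d := by
    simp only [B, Fintype.card_piFinset, Finset.prod_const, Finset.card_univ, Fintype.card_fin,
      Int.card_Icc]
    congr 1
    omega
  obtain ⟨s, hs, s', hs', hne, he⟩ := Finset.exists_ne_map_eq_of_card_lt_of_maps_to
    (s := (Finset.range J).powerset) (t := B) (f := fun s => ∑ j ∈ s, φ j)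
    (by rw [hB, Finset.card_powerset, Finset.card_range]; exact hlt) (by
      intro s hs
      rw [Finset.mem_coe, Finset.mem_powerset] at hs
      simp only [B, Finset.mem_coe, Fintype.mem_piFinset, Finset.mem_Icc, ← abs_le,
        Finset.sum_apply]
      intro i
      refine (Finset.abs_sum_le_sum_abs _ _).trans ?_
      refine (Finset.sum_le_card_nsmul s _ (R : ℤ) fun j hj =>
        hR j (Finset.mem_range.1 (hs hj)) i).trans ?_
      have := Finset.card_le_card hs
      rw [Finset.card_range] at this
      rw [nsmul_eq_mul]; push_cast
      gcongr)
  rw [Finset.mem_powerset] at hs hs'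
  have hconv : ∀ s ⊆ Finset.range J, ∑ j ∈ s, φ j =
      ∑ j ∈ Finset.range J, (if j ∈ s then (1 : ℤ) else 0) • φ j := by
    intro s hs
    rw [← Finset.sum_subset hs (f := fun j => (if j ∈ s then (1 : ℤ) else 0) • φ j)]
    · exact Finset.sum_congr rfl fun j hj => by rw [if_pos hj, one_smul]
    · intro j _ hj; rw [if_neg hj, zero_smul]
  have key := eq_zero_of_expanding N hadd hsmul φ h0 h
    (fun j => (if j ∈ s then (1 : ℤ) else 0) - if j ∈ s' then 1 else 0)
    (fun j => by split_ifs <;> simp) J (by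
      simp only [sub_smul, Finset.sum_sub_distrib]
      rw [← hconv s hs, ← hconv s' hs', sub_eq_zero]; exact he)
  refine hne (Finset.ext fun j => ?_)
  by_cases hj : j < J
  · have := key j hj
    by_cases h1 : j ∈ s <;> by_cases h2 : j ∈ s' <;> simp [h1, h2] at this ⊢
  · have hj' : j ∉ Finset.range J := by simpa using hj
    exact ⟨fun h => absurd (hs h) hj', fun h => absurd (hs' h) hj'⟩

variable {A : Matrix (Fin d) (Fin d) ℤ} {g p : Module.End ℝ (Fin d → ℝ)} {κ C : ℝ} {D : ℝ → ℝ}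

theorem IsSplitting.fg_pow {V : Type*} [NormedAddCommGroup V] [NormedSpace ℝ V]
    {f g p : Module.End ℝ V} (h : IsSplitting f g p κ C D) (n : ℕ) (v : V) :
    (f ^ n) ((g ^ n) v) = v := by
  induction n generalizing v with
  | zero => rfl
  | succ n ih => rw [pow_succ' g, pow_succ f, Module.End.mul_apply, Module.End.mul_apply, h.fg, ih]

theorem IsSplitting.g_pow_mem {V : Type*} [NormedAddCommGroup V] [NormedSpace ℝ V]
    {f g p : Module.End ℝ V} (h : IsSplitting f g p κ C D) (n : ℕ) {v : V} (hv : p v = v) :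
    p ((g ^ n) v) = (g ^ n) v := by
  induction n with
  | zero => exact hv
  | succ n ih => rw [pow_succ' g, Module.End.mul_apply, h.g_mem _ ih]

theorem IsSplitting.f_pow_mem {V : Type*} [NormedAddCommGroup V] [NormedSpace ℝ V]
    {f g p : Module.End ℝ V} (h : IsSplitting f g p κ C D) (n : ℕ) {v : V} (hv : p v = v) :
    p ((f ^ n) v) = (f ^ n) v := by
  induction n with
  | zero => exact hv
  | succ n ih => rw [pow_succ' f, Module.End.mul_apply, h.f_mem _ ih]

theorem IsSplitting.norm_single_le {f : Module.End ℝ (Fin d → ℝ)} (h : IsSplitting f g p κ C D)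
    (i : Fin d) : ‖p (Pi.single i 1)‖ ≤ C :=
  (h.norm_le _).trans (mul_le_of_le_one_right h.C_pos.le (norm_single_one_le i))

theorem formSize_le_of_isSplitting (h : IsSplitting (A.map ((↑) : ℤ → ℝ)).toLin' g p κ C D) (m : ℕ)
    (ξ : Fin d → ℤ) :
    formSize p ξ ≤ d * C ^ 2 * κ ^ m * formSize p (Matrix.vecMul ξ (A ^ m)) := by
  rw [formSize]
  calc _ ≤ ∑ _i : Fin d, C ^ 2 * κ ^ m * formSize p (Matrix.vecMul ξ (A ^ m)) := by
        refine Finset.sum_le_sum fun i _ => ?_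
        have e : zdot ξ (p (Pi.single i 1)) =
            zdot (Matrix.vecMul ξ (A ^ m)) ((g ^ m) (p (Pi.single i 1))) := by
          rw [zdot_vecMul_pow, h.fg_pow]
        rw [e]
        refine (abs_zdot_le_formSize p _ (h.g_pow_mem m (h.idem _))).trans ?_
        rw [mul_comm]
        refine mul_le_mul_of_nonneg_right ((h.le m _ (h.idem _)).trans ?_) (formSize_nonneg _ _)
        have := h.pos
        have := h.C_pos
        calc _ ≤ C * κ ^ m * C := by gcongr; exact h.norm_single_le i
          _ = _ := by ring
    _ = _ := by simp [mul_assoc]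

theorem exists_formSize_le (h : IsSplitting (A.map ((↑) : ℤ → ℝ)).toLin' g p κ C D) (m : ℕ) :
    ∃ r : ℕ, ∀ ξ : Fin d → ℤ, formSize p (Matrix.vecMul ξ (A ^ m)) ≤ 2 ^ r * formSize p ξ := by
  set f := (A.map ((↑) : ℤ → ℝ)).toLin'
  obtain ⟨r, hr⟩ := pow_unbounded_of_one_lt (∑ i, ‖(f ^ m) (p (Pi.single i 1))‖) one_lt_two
  refine ⟨r, fun ξ => ?_⟩
  calc formSize p (Matrix.vecMul ξ (A ^ m)) ≤
        ∑ i, formSize p ξ * ‖(f ^ m) (p (Pi.single i 1))‖ := by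
        refine Finset.sum_le_sum fun i _ => ?_
        rw [zdot_vecMul_pow]
        exact abs_zdot_le_formSize p ξ (h.f_pow_mem m (h.idem _))
    _ = (∑ i, ‖(f ^ m) (p (Pi.single i 1))‖) * formSize p ξ := by rw [← Finset.mul_sum, mul_comm]
    _ ≤ _ := mul_le_mul_of_nonneg_right hr.le (formSize_nonneg _ _)

theorem exists_mul_pow_lt_two_pow (d : ℕ) :
    ∃ b : ℝ, 1 < b ∧ ∀ a : ℝ, ∃ c q : ℕ, 0 < c ∧ ∀ K : ℕ, 1 ≤ K →
      ∃ J : ℕ, 1 ≤ J ∧ 2 ^ J ≤ c * K ^ q ∧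
      ∀ a' : ℝ, 0 ≤ a' → a' ≤ a * K * b ^ J → (J * a') ^ d < (2 : ℝ) ^ J := by
  set b : ℝ := 2 ^ (1 / (4 * (d + 1)) : ℝ)
  have hb1 : 1 < b := Real.one_lt_rpow one_lt_two (by positivity)
  have hb : b ^ (4 * (d + 1)) = 2 := by
    rw [← Real.rpow_natCast, ← Real.rpow_mul zero_le_two]
    push_cast
    rw [one_div_mul_cancel (by positivity), Real.rpow_one]
  have hb' : b ^ (4 * d) ≤ 2 := by
    rw [← hb]; exact pow_le_pow_right₀ hb1.le (by omega)
  refine ⟨b, hb1, fun a => ?_⟩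
  obtain ⟨c₁, hc₁, hJ⟩ := Asymptotics.bound_of_isBigO_nat_atTop
    (isLittleO_pow_const_const_pow_of_one_lt (R := ℝ) (4 * d) one_lt_two).isBigO
  obtain ⟨c₂, hc₂⟩ := exists_nat_gt (c₁ * a ^ (4 * d))
  refine ⟨2 * (c₂ + 1), 4 * d, by omega, fun K hK => ?_⟩
  have hne : (c₂ + 1) * K ^ (4 * d) ≠ 0 := by positivity
  refine ⟨Nat.log 2 ((c₂ + 1) * K ^ (4 * d)) + 1, by omega, ?_, fun a' ha' hle => ?_⟩
  · have := Nat.pow_log_le_self 2 hne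
    rw [pow_succ]; linarith
  · have hlt := Nat.lt_pow_succ_log_self one_lt_two ((c₂ + 1) * K ^ (4 * d))
    rw [Nat.succ_eq_add_one] at hlt
    set J := Nat.log 2 ((c₂ + 1) * K ^ (4 * d)) + 1
    have hlt' : ((c₂ : ℝ) + 1) * K ^ (4 * d) < 2 ^ J := by exact_mod_cast hlt
    have h1 := hJ (x := J) (by positivity)
    simp only [norm_pow, Real.norm_natCast, Real.norm_ofNat] at h1
    have ha4 : 0 ≤ a ^ (4 * d) := by rw [mul_comm, pow_mul']; positivity
    have hK0 : (0 : ℝ) < K := by exact_mod_cast hK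
    refine lt_of_pow_lt_pow_left₀ 4 (by positivity) ?_
    calc ((J * a') ^ d) ^ 4 = J ^ (4 * d) * a' ^ (4 * d) := by rw [← pow_mul, mul_comm d, mul_pow]
      _ ≤ (c₁ * 2 ^ J) * (a * K * b ^ J) ^ (4 * d) := by gcongr
      _ = (c₁ * a ^ (4 * d)) * K ^ (4 * d) * 2 ^ J * (b ^ (4 * d)) ^ J := by
        rw [mul_pow, mul_pow, ← pow_mul, mul_comm J, pow_mul]; ring
      _ ≤ ((c₂ + 1) * K ^ (4 * d)) * 2 ^ J * 2 ^ J := by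
        have : 0 ≤ b ^ (4 * d) := by positivity
        gcongr
        linarith
      _ < 2 ^ J * 2 ^ J * 2 ^ J := by gcongr
      _ ≤ 2 ^ J * 2 ^ J * 2 ^ J * 2 ^ J :=
        le_mul_of_one_le_right (by positivity) (one_le_pow₀ one_le_two)
      _ = _ := by ring

theorem exists_diophantine (h : IsSplitting (A.map ((↑) : ℤ → ℝ)).toLin' g p κ C D) :
    ∃ (c : ℝ) (q : ℕ), 0 < c ∧ ∀ K : ℕ, 1 ≤ K → ∀ ξ : Fin d → ℤ, (∀ i, |ξ i| ≤ K) →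
      formSize p ξ ≠ 0 → 1 ≤ c * K ^ q * formSize p ξ := by
  have hC := h.C_pos
  obtain ⟨m, hm⟩ : ∃ m : ℕ, 4 * (d * C ^ 2 * κ ^ m) ≤ 1 := by
    have : Tendsto (fun m : ℕ => 4 * (d * C ^ 2 * κ ^ m)) atTop (nhds (4 * (d * C ^ 2 * 0))) :=
      ((tendsto_pow_atTop_nhds_zero_of_lt_one h.pos.le h.lt_one).const_mul _).const_mul _
    rw [mul_zero, mul_zero] at this
    exact (this.eventually_le_const one_pos).exists
  have hexp : ∀ ξ : Fin d → ℤ, 4 * formSize p ξ ≤ formSize p (Matrix.vecMul ξ (A ^ m)) :=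
    fun ξ => by
    have h1 := formSize_le_of_isSplitting h m ξ
    have h2 := mul_le_mul_of_nonneg_right hm (formSize_nonneg p (Matrix.vecMul ξ (A ^ m)))
    linarith
  obtain ⟨r, hr⟩ := exists_formSize_le h m
  obtain ⟨b, hb1, hb⟩ := exists_mul_pow_lt_two_pow d
  have hη : 0 < Real.log b / (m + 1) := div_pos (Real.log_pos hb1) (by positivity)
  set η := Real.log b / (m + 1)
  have hηb : Real.exp η ^ m ≤ b := by
    rw [← Real.exp_nat_mul, ← Real.le_log_iff_exp_le (by linarith)]
    have : η * (m + 1) = Real.log b := div_mul_cancel₀ _ (by positivity)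
    linarith
  have hD := h.D_pos η hη
  set G : ℝ := 1 + d * D η
  have hG : 1 ≤ G := le_add_of_nonneg_right (by positivity)
  obtain ⟨c, q, hc, hcq⟩ := hb (3 * G)
  refine ⟨(c : ℝ) ^ r, q * r, by positivity, fun K hK ξ hξ hne => ?_⟩
  by_contra! hlt
  obtain ⟨J, hJ1, hJle, hJ⟩ := hcq K hK
  have hK1 : (1 : ℝ) ≤ K := by exact_mod_cast hK
  have hJ1' : (1 : ℝ) ≤ J := by exact_mod_cast hJ1
  have hbJ : 1 ≤ b ^ J := one_le_pow₀ hb1.le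
  have hpos : 0 < formSize p ξ := lt_of_le_of_ne (formSize_nonneg p ξ) (Ne.symm hne)
  have hsmall : (2 ^ r) ^ J * formSize p ξ ≤ 1 := by
    have h1 : ((2 : ℝ) ^ r) ^ J ≤ (c : ℝ) ^ r * K ^ (q * r) := by
      rw [← pow_mul, mul_comm r, pow_mul, pow_mul, ← mul_pow]
      exact pow_le_pow_left₀ (by positivity) (by exact_mod_cast hJle) r
    exact (mul_le_mul_of_nonneg_right h1 hpos.le).trans hlt.le
  set φ : ℕ → Fin d → ℤ := fun j => Matrix.vecMul ξ (A ^ (m * j)) with hφ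
  have hφs : ∀ j, φ (j + 1) = Matrix.vecMul (φ j) (A ^ m) := fun j => by
    simp only [hφ]; rw [mul_add, mul_one, pow_add, Matrix.vecMul_vecMul]
  have hφN : ∀ j, formSize p (φ j) ≤ (2 ^ r) ^ j * formSize p ξ := by
    intro j
    induction j with
    | zero => simp [hφ]
    | succ j ih =>
      rw [hφs, pow_succ']
      refine (hr _).trans ?_
      rw [mul_assoc]
      gcongr
  have hY : 1 ≤ G * K * b ^ J := one_le_mul_of_one_le_of_one_le
    (one_le_mul_of_one_le_of_one_le hG hK1) hbJ
  have hentry : ∀ j < J, ∀ i, |φ j i| ≤ (⌊G * K * b ^ J⌋₊ : ℤ) := by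
    intro j hj i
    have h1 : |(φ j i : ℝ)| ≤ G * K * b ^ J := by
      set e : Fin d → ℝ := Pi.single i 1 with he
      have e1 : (φ j i : ℝ) = zdot ξ (((A.map ((↑) : ℤ → ℝ)).toLin' ^ (m * j)) (e - p e)) +
          zdot (φ j) (p e) := by
        rw [← zdot_single (φ j) i, ← zdot_vecMul_pow, ← map_add, sub_add_cancel]
      have hK' : ∀ i, |(ξ i : ℝ)| ≤ K := fun i => by exact_mod_cast hξ i
      have h2 : |zdot ξ (((A.map ((↑) : ℤ → ℝ)).toLin' ^ (m * j)) (e - p e))| ≤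
        d * K * (D η * b ^ J) := by
        refine (abs_zdot_le hK' _).trans (mul_le_mul_of_nonneg_left ?_ (by positivity))
        refine (h.le_exp η hη _ e).trans ?_
        calc _ ≤ D η * (Real.exp η ^ m) ^ j * 1 := by
              rw [← pow_mul]; gcongr; exact norm_single_one_le i
          _ ≤ D η * b ^ j * 1 := by gcongr
          _ ≤ D η * b ^ J := by rw [mul_one]; gcongr; exact hb1.le
      have h3 : |zdot (φ j) (p e)| ≤ 1 := by
        calc _ ≤ formSize p (φ j) := Finset.single_le_sum
              (f := fun i => |zdot (φ j) (p (Pi.single i 1))|) (fun _ _ => abs_nonneg _)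
                (Finset.mem_univ i)
          _ ≤ (2 ^ r) ^ j * formSize p ξ := hφN j
          _ ≤ (2 ^ r) ^ J * formSize p ξ := by
            gcongr
            exact one_le_pow₀ one_le_two
          _ ≤ 1 := hsmall
      have h4 : 1 ≤ K * b ^ J := one_le_mul_of_one_le_of_one_le hK1 hbJ
      rw [e1]
      refine (abs_add_le _ _).trans ((add_le_add h2 h3).trans ?_)
      have : G * K * b ^ J = K * b ^ J + d * K * (D η * b ^ J) := by simp only [G]; ring
      linarith
    rw [Int.natCast_floor_eq_floor (by linarith), Int.le_floor]
    exact_mod_cast h1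
  have hcard := two_pow_le_of_expanding (formSize p) (formSize_add_le p) (formSize_smul p) φ
    (by simpa [hφ] using hpos) (fun j => by rw [hφs]; exact hexp _) J _ hentry
  have hlt2 := hJ (3 * G * K * b ^ J) (by positivity) le_rfl
  have hcard' : (2 : ℝ) ^ J ≤ (2 * (J * (⌊G * K * b ^ J⌋₊ : ℝ)) + 1) ^ d := by exact_mod_cast hcard
  have hfl : (⌊G * K * b ^ J⌋₊ : ℝ) ≤ G * K * b ^ J := Nat.floor_le (by linarith)
  refine absurd (hcard'.trans (pow_le_pow_left₀ (by positivity) ?_ d)) hlt2.not_ge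
  have h5 := mul_le_mul_of_nonneg_left hfl (zero_le_one.trans hJ1')
  have h6 : 1 ≤ J * (G * K * b ^ J) := one_le_mul_of_one_le_of_one_le hJ1' hY
  linarith

end dioph

/-! ### Quantitative density of the expanding leaf -/

section density

/-- The character `x ↦ exp (2πix)`. -/
noncomputable def ecirc (x : ℝ) : ℂ := Complex.exp (Complex.I * (2 * Real.pi * x : ℝ))

theorem ecirc_add (x y : ℝ) : ecirc (x + y) = ecirc x * ecirc y := by
  rw [ecirc, ecirc, ecirc, ← Complex.exp_add]; push_cast; ring_nf

theorem ecirc_zero : ecirc 0 = 1 := by simp [ecirc]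

theorem norm_ecirc (x : ℝ) : ‖ecirc x‖ = 1 := by
  rw [ecirc, mul_comm]; exact Complex.norm_exp_ofReal_mul_I _

theorem ecirc_natCast_mul (n : ℕ) (x : ℝ) : ecirc (n * x) = ecirc x ^ n := by
  rw [ecirc, ecirc, ← Complex.exp_nat_mul]; push_cast; ring_nf

theorem ecirc_sum {ι : Type*} (s : Finset ι) (f : ι → ℝ) :
    ecirc (∑ i ∈ s, f i) = ∏ i ∈ s, ecirc (f i) := by
  classical
  induction s using Finset.induction_on with
  | empty => simp [ecirc_zero]
  | insert a s ha ih => rw [Finset.sum_insert ha, Finset.prod_insert ha, ecirc_add, ih]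

theorem conj_ecirc (x : ℝ) : (starRingEnd ℂ) (ecirc x) = ecirc (-x) := by
  rw [ecirc, ecirc, ← Complex.exp_conj, map_mul, Complex.conj_I, Complex.conj_ofReal]
  push_cast; ring_nf

theorem ecirc_intCast (k : ℤ) : ecirc k = 1 := by
  rw [ecirc, Complex.exp_eq_one_iff]
  exact ⟨k, by push_cast; ring⟩

theorem four_mul_abs_le_norm_ecirc_sub_one {x : ℝ} (hx : |x| ≤ 1 / 2) :
    4 * |x| ≤ ‖ecirc x - 1‖ := by
  rw [ecirc, Complex.norm_exp_I_mul_ofReal_sub_one, norm_mul, Real.norm_ofNat, Real.norm_eq_abs,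
    show 2 * Real.pi * x / 2 = Real.pi * x by ring]
  have h := Real.mul_abs_le_abs_sin (x := Real.pi * x) (by
    rw [abs_mul, abs_of_pos Real.pi_pos]; nlinarith [Real.pi_pos])
  rw [abs_mul, abs_of_pos Real.pi_pos] at h
  have : 2 / Real.pi * (Real.pi * |x|) = 2 * |x| := by field_simp
  linarith

theorem norm_sum_ecirc_le {x : ℝ} (hx0 : x ≠ 0) (hx : |x| ≤ 1 / 2) (S : ℕ) :
    ‖∑ k ∈ Finset.range S, ecirc (k * x)‖ ≤ 1 / (2 * |x|) := by
  have h1 := four_mul_abs_le_norm_ecirc_sub_one hx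
  have hpos : 0 < |x| := abs_pos.2 hx0
  have h2 : (∑ k ∈ Finset.range S, ecirc (k * x)) * (ecirc x - 1) = ecirc x ^ S - 1 := by
    simp only [ecirc_natCast_mul]; exact geom_sum_mul _ _
  have h3 : ‖∑ k ∈ Finset.range S, ecirc (k * x)‖ * ‖ecirc x - 1‖ ≤ 2 := by
    rw [← norm_mul, h2]
    refine (norm_sub_le _ _).trans ?_
    rw [norm_pow, norm_ecirc]; norm_num
  rw [le_div_iff₀ (by positivity)]
  nlinarith [norm_nonneg (∑ k ∈ Finset.range S, ecirc (k * x))]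

theorem exists_norm_sq_sum_ge {ι τ : Type*} (I : Finset ι) (T : Finset τ) (hT : T.Nonempty)
    (w : ι → ℝ) (hw : ∀ a ∈ I, 0 ≤ w a) (hw1 : ∑ a ∈ I, w a = 1) (u : ι → τ → ℂ) {ρ : ℝ}
    (hu : ∀ a ∈ I, ∀ t ∈ T, ‖u a t‖ = 1)
    (h : ∀ a ∈ I, ∀ b ∈ I, -(ρ * T.card) ≤ (∑ t ∈ T, u a t * (starRingEnd ℂ) (u b t)).re)
    (hρ : 0 ≤ ρ) :
    ∃ t ∈ T, (∑ a ∈ I, w a ^ 2) - ρ ≤ ‖∑ a ∈ I, w a * u a t‖ ^ 2 := by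
  classical
  by_contra! hlt
  have hcard : (0 : ℝ) < T.card := by exact_mod_cast hT.card_pos
  have h1 : ∑ t ∈ T, ‖∑ a ∈ I, w a * u a t‖ ^ 2 < T.card * ((∑ a ∈ I, w a ^ 2) - ρ) := by
    rw [← nsmul_eq_mul, ← Finset.sum_const]
    exact Finset.sum_lt_sum_of_nonempty hT hlt
  have h2 : ∑ t ∈ T, ‖∑ a ∈ I, w a * u a t‖ ^ 2 =
      ∑ a ∈ I, ∑ b ∈ I, w a * w b * (∑ t ∈ T, u a t * (starRingEnd ℂ) (u b t)).re := by
    have e : ∀ t, ‖∑ a ∈ I, w a * u a t‖ ^ 2 =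
        ∑ a ∈ I, ∑ b ∈ I, w a * w b * (u a t * (starRingEnd ℂ) (u b t)).re := by
      intro t
      have : ((‖∑ a ∈ I, w a * u a t‖ ^ 2 : ℝ) : ℂ) =
          ∑ a ∈ I, ∑ b ∈ I, ((w a * w b : ℝ) : ℂ) * (u a t * (starRingEnd ℂ) (u b t)) := by
        rw [Complex.ofReal_pow, ← Complex.mul_conj', map_sum, Finset.sum_mul_sum]
        refine Finset.sum_congr rfl fun a _ => Finset.sum_congr rfl fun b _ => ?_
        rw [map_mul, Complex.conj_ofReal]; push_cast; ring
      have := congrArg Complex.re this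
      rw [Complex.ofReal_re] at this
      rw [this]
      simp only [Complex.re_sum, Complex.re_ofReal_mul]
    simp only [e]
    rw [Finset.sum_comm]
    refine Finset.sum_congr rfl fun a _ => ?_
    rw [Finset.sum_comm]
    refine Finset.sum_congr rfl fun b _ => ?_
    rw [Complex.re_sum, Finset.mul_sum]
  have h3 : ∀ a ∈ I, T.card * w a ^ 2 - ρ * T.card * w a ≤
      ∑ b ∈ I, w a * w b * (∑ t ∈ T, u a t * (starRingEnd ℂ) (u b t)).re := by
    intro a ha
    have h4 : ∀ b ∈ I, w a * w b * (if b = a then (T.card : ℝ) else 0) - ρ * T.card * w a * w b ≤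
        w a * w b * (∑ t ∈ T, u a t * (starRingEnd ℂ) (u b t)).re := by
      intro b hb
      have hab := mul_nonneg (hw a ha) (hw b hb)
      split_ifs with hba
      · subst hba
        have : ∑ t ∈ T, u b t * (starRingEnd ℂ) (u b t) = T.card := by
          rw [Finset.sum_congr rfl fun t ht => (by rw [Complex.mul_conj', hu b hb t ht]; simp :
            u b t * (starRingEnd ℂ) (u b t) = 1)]
          simp
        rw [this, Complex.natCast_re]
        have : 0 ≤ ρ * T.card * (w b * w b) := by positivity
        linarith
      · have := mul_le_mul_of_nonneg_left (h a ha b hb) hab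
        linarith
    refine le_trans (le_of_eq ?_) (Finset.sum_le_sum h4)
    rw [Finset.sum_sub_distrib, ← Finset.mul_sum, hw1]
    simp only [mul_ite, mul_zero, Finset.sum_ite_eq', ha, if_true]
    ring
  have h5 := Finset.sum_le_sum h3
  rw [← h2, Finset.sum_sub_distrib, ← Finset.mul_sum, ← Finset.mul_sum, hw1] at h5
  linarith

theorem norm_one_add_ecirc_sq (x : ℝ) : ‖(1 + ecirc x) / 2‖ ^ 2 = Real.cos (Real.pi * x) ^ 2 := by
  have h : ecirc x = Real.cos (2 * (Real.pi * x)) + Real.sin (2 * (Real.pi * x)) * Complex.I := by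
    rw [ecirc, mul_comm, Complex.exp_mul_I]; push_cast; ring_nf
  rw [norm_div, div_pow, ← Complex.normSq_eq_norm_sq, h, Complex.normSq_apply]
  simp only [Complex.add_re, Complex.add_im, Complex.one_re, Complex.one_im, Complex.ofReal_re,
    Complex.ofReal_im, Complex.mul_re, Complex.mul_im, Complex.I_re, Complex.I_im]
  have := Real.sin_sq_add_cos_sq (2 * (Real.pi * x))
  have h2 := Real.cos_two_mul (Real.pi * x)
  norm_num
  nlinarith

theorem norm_one_add_ecirc_le (x : ℝ) :
    ‖(1 + ecirc x) / 2‖ ^ 2 ≤ Real.exp (-(4 * (x - round x) ^ 2)) := by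
  have hper : ecirc x = ecirc (x - round x) := by
    rw [sub_eq_add_neg, ecirc_add, ← Int.cast_neg, ecirc_intCast, mul_one]
  rw [hper, norm_one_add_ecirc_sq]
  set y := x - round x
  have hy : |y| ≤ 1 / 2 := abs_sub_round x
  have h := Real.mul_abs_le_abs_sin (x := Real.pi * y) (by
    rw [abs_mul, abs_of_pos Real.pi_pos]; nlinarith [Real.pi_pos])
  rw [abs_mul, abs_of_pos Real.pi_pos] at h
  have e : 2 / Real.pi * (Real.pi * |y|) = 2 * |y| := by field_simp
  rw [e] at h
  have h2 : (2 * |y|) ^ 2 ≤ |Real.sin (Real.pi * y)| ^ 2 := pow_le_pow_left₀ (by positivity) h 2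
  rw [mul_pow, sq_abs, sq_abs] at h2
  have h3 := Real.sin_sq_add_cos_sq (Real.pi * y)
  have h4 := Real.add_one_le_exp (-(4 * y ^ 2))
  linarith

variable {d : ℕ}

/-- Products of binomial weights. -/
noncomputable def binomWeight (K : ℕ) (a : Fin d → ℕ) : ℝ := ∏ i, (K.choose (a i) : ℝ) / 2 ^ K

theorem binomWeight_nonneg (K : ℕ) (a : Fin d → ℕ) : 0 ≤ binomWeight K a :=
  Finset.prod_nonneg fun _ _ => by positivity

theorem sum_binomWeight_mul_prod (K : ℕ) (z : Fin d → ℂ) :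
    ∑ a ∈ Fintype.piFinset fun _ : Fin d => Finset.range (K + 1),
      (binomWeight K a : ℂ) * ∏ i, z i ^ a i = ∏ i, ((1 + z i) / 2) ^ K := by
  have : ∀ i, ((1 + z i) / 2) ^ K =
      ∑ k ∈ Finset.range (K + 1), (K.choose k : ℂ) / 2 ^ K * z i ^ k := by
    intro i
    rw [add_comm, div_pow, add_pow, Finset.sum_div]
    exact Finset.sum_congr rfl fun k _ => by simp; ring
  simp only [this]
  rw [Finset.prod_univ_sum]
  refine Finset.sum_congr rfl fun a _ => ?_
  rw [Finset.prod_mul_distrib, binomWeight]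
  push_cast; rfl

theorem sum_binomWeight (K : ℕ) :
    ∑ a ∈ Fintype.piFinset fun _ : Fin d => Finset.range (K + 1), binomWeight K a = 1 := by
  have := sum_binomWeight_mul_prod (d := d) K 1
  norm_num at this
  exact_mod_cast this

theorem le_sum_binomWeight_sq (K : ℕ) : 1 / ((K : ℝ) + 1) ^ d ≤
    ∑ a ∈ Fintype.piFinset fun _ : Fin d => Finset.range (K + 1), binomWeight K a ^ 2 := by
  have := sq_sum_le_card_mul_sum_sq (s := Fintype.piFinset fun _ : Fin d => Finset.range (K + 1))
    (f := binomWeight K)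
  rw [sum_binomWeight, Fintype.card_piFinset] at this
  simp only [Finset.card_range, Finset.prod_const, Finset.card_univ, Fintype.card_fin] at this
  push_cast at this
  rw [div_le_iff₀ (by positivity)]
  linarith

theorem ecirc_zdot (a : Fin d → ℕ) (v : Fin d → ℝ) :
    ecirc (zdot (fun i => (a i : ℤ)) v) = ∏ i, ecirc (v i) ^ a i := by
  rw [zdot_apply, ecirc_sum]
  exact Finset.prod_congr rfl fun i _ => by rw [← ecirc_natCast_mul]; simp

theorem norm_kernel_sq_le (K : ℕ) (v : Fin d → ℝ) (i : Fin d) :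
    ‖∑ a ∈ Fintype.piFinset fun _ : Fin d => Finset.range (K + 1),
      (binomWeight K a : ℂ) * ecirc (zdot (fun i => (a i : ℤ)) v)‖ ^ 2 ≤
      Real.exp (-(4 * (v i - round (v i)) ^ 2)) ^ K := by
  simp only [ecirc_zdot]
  rw [sum_binomWeight_mul_prod K fun i => ecirc (v i), norm_prod, ← Finset.prod_pow]
  have h1 : ∀ j, ‖((1 + ecirc (v j)) / 2) ^ K‖ ^ 2 ≤
      Real.exp (-(4 * (v j - round (v j)) ^ 2)) ^ K := by
    intro j
    rw [norm_pow, ← pow_mul, mul_comm, pow_mul]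
    exact pow_le_pow_left₀ (by positivity) (norm_one_add_ecirc_le _) K
  rw [← Finset.mul_prod_erase _ _ (Finset.mem_univ i)]
  refine (mul_le_of_le_one_right (by positivity) (Finset.prod_le_one (fun _ _ => by positivity)
    fun j _ => (h1 j).trans ?_)).trans (h1 i)
  exact pow_le_one₀ (Real.exp_pos _).le
    (Real.exp_le_one_iff.2 (by nlinarith [sq_nonneg (v j - round (v j))]))

theorem norm_sum_ecirc_grid_le (p : Module.End ℝ (Fin d → ℝ)) (ξ : Fin d → ℤ) (s : ℝ) (S : ℕ)
    (j : Fin d)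
    (h0 : zdot ξ (p (Pi.single j 1)) * s ≠ 0) (h1 : |zdot ξ (p (Pi.single j 1)) * s| ≤ 1 / 2) :
    ‖∑ k ∈ Fintype.piFinset fun _ : Fin d => Finset.range S,
      ecirc (zdot ξ (p fun i => (k i : ℝ) * s))‖ * S ≤
      S ^ d / (2 * |zdot ξ (p (Pi.single j 1)) * s|) := by
  have e : ∀ k : Fin d → ℕ, ecirc (zdot ξ (p fun i => (k i : ℝ) * s)) =
      ∏ i, ecirc (k i * (zdot ξ (p (Pi.single i 1)) * s)) := by
    intro k
    have hv' : (fun i => (k i : ℝ) * s) = ∑ i, ((k i : ℝ) * s) • (Pi.single i 1 : Fin d → ℝ) := by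
      ext j; simp [Finset.sum_apply, Pi.single_apply]
    rw [hv', ← ecirc_sum]
    simp only [map_sum, map_smul, smul_eq_mul]
    congr 1
    exact Finset.sum_congr rfl fun i _ => by ring
  simp only [e]
  rw [← Finset.prod_univ_sum (t := fun _ : Fin d => Finset.range S)
    (f := fun i k => ecirc ((k : ℝ) * (zdot ξ (p (Pi.single i 1)) * s))), norm_prod,
    ← Finset.mul_prod_erase _ _ (Finset.mem_univ j)]
  have h2 : ∏ i ∈ Finset.univ.erase j, ‖∑ k ∈ Finset.range S,
      ecirc ((k : ℝ) * (zdot ξ (p (Pi.single i 1)) * s))‖ ≤ (S : ℝ) ^ (d - 1) := by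
    have : (Finset.univ.erase j).card = d - 1 := by simp
    rw [← this, ← Finset.prod_const]
    refine Finset.prod_le_prod (fun _ _ => norm_nonneg _) fun i _ => ?_
    refine (norm_sum_le _ _).trans ?_
    simp [norm_ecirc]
  have h3 := norm_sum_ecirc_le h0 h1 S
  have h4 : (S : ℝ) ^ d = S ^ (d - 1) * S := by
    rw [← pow_succ]; congr 1; have := j.pos; omega
  calc _ ≤ 1 / (2 * |zdot ξ (p (Pi.single j 1)) * s|) * (S : ℝ) ^ (d - 1) * S := by gcongr
    _ = _ := by rw [h4]; ring

theorem exists_near_of_exp_le (n K : ℕ) (hn : 1 ≤ n) (hK : K = (d + 1) ^ 2 * n ^ 4) {y : ℝ}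
    (h : 1 / (2 * ((K : ℝ) + 1) ^ d) ≤ Real.exp (-(4 * y ^ 2)) ^ K) : |y| ≤ 1 / n := by
  by_contra! hy
  have hn' : (1 : ℝ) ≤ n := by exact_mod_cast hn
  have hn0 : (0 : ℝ) < n := by linarith
  have hK' : (K : ℝ) = (d + 1) ^ 2 * n ^ 4 := by rw [hK]; push_cast; ring
  have hK1 : (1 : ℝ) ≤ K := by
    rw [hK']; exact one_le_mul_of_one_le_of_one_le (one_le_pow₀
      (by linarith [Nat.cast_nonneg (α := ℝ) d]))
      (one_le_pow₀ hn')
  have h1 : (1 / n : ℝ) ^ 2 < y ^ 2 := by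
    rw [← sq_abs y]; exact pow_lt_pow_left₀ hy (by positivity) two_ne_zero
  have h2 : Real.exp (-(4 * y ^ 2)) ^ K < Real.exp (-(4 * (d + 1) ^ 2 * n ^ 2)) := by
    rw [← Real.exp_nat_mul, Real.exp_lt_exp]
    have : (K : ℝ) * (4 * (1 / n : ℝ) ^ 2) = 4 * (d + 1) ^ 2 * n ^ 2 := by rw [hK']; field_simp
    have := mul_lt_mul_of_pos_left h1 (by linarith : (0 : ℝ) < K)
    linarith
  have h3 : (K : ℝ) + 1 ≤ Real.exp (2 * (d + 1) * n ^ 2) := by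
    have h4 := Real.add_one_le_exp (((d : ℝ) + 1) * n ^ 2)
    have h5 : Real.exp (2 * (d + 1) * n ^ 2) = Real.exp ((d + 1) * n ^ 2) ^ 2 := by
      rw [← Real.exp_nat_mul]; congr 1; push_cast; ring
    rw [h5]
    refine le_trans ?_ (pow_le_pow_left₀ (by positivity) h4 2)
    rw [hK']
    nlinarith [mul_nonneg (by positivity : (0 : ℝ) ≤ d + 1) (sq_nonneg (n : ℝ))]
  have h6 : 2 * ((K : ℝ) + 1) ^ d ≤ Real.exp (4 * (d + 1) ^ 2 * n ^ 2) := by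
    calc 2 * ((K : ℝ) + 1) ^ d ≤ (K + 1) * (K + 1) ^ d := by gcongr; linarith
      _ = (K + 1) ^ (d + 1) := by rw [pow_succ]; ring
      _ ≤ Real.exp (2 * (d + 1) * n ^ 2) ^ (d + 1) := by gcongr
      _ = Real.exp ((d + 1 : ℕ) * (2 * (d + 1) * n ^ 2)) := by rw [← Real.exp_nat_mul]
      _ ≤ _ := by
        apply Real.exp_le_exp.2
        push_cast
        nlinarith [sq_nonneg (((d : ℝ) + 1) * n)]
  have h7 : Real.exp (-(4 * (d + 1) ^ 2 * n ^ 2)) ≤ 1 / (2 * ((K : ℝ) + 1) ^ d) := by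
    rw [Real.exp_neg, ← one_div]
    exact one_div_le_one_div_of_le (by positivity) h6
  linarith

variable {A : Matrix (Fin d) (Fin d) ℤ} {g p : Module.End ℝ (Fin d → ℝ)} {κ C : ℝ} {D : ℝ → ℝ}

theorem exists_near_integer (h : IsSplitting (A.map ((↑) : ℤ → ℝ)).toLin' g p κ C D) {K S : ℕ}
    {c : ℝ}
    (hK : 1 ≤ K) (hS : 1 ≤ S) (hc : 0 < c)
    (hdio : ∀ ξ : Fin d → ℤ, (∀ i, |ξ i| ≤ K) → formSize p ξ ≠ 0 → 1 ≤ c * formSize p ξ)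
    (hSK : 2 * ((K : ℝ) + 1) ^ d * (d * c * (d + 1) * (C + 1) * K) ≤ S) {v : Fin d → ℝ}
    (hv : p v = v) :
    ∃ t, p t = t ∧ ‖t‖ ≤ C * S ∧
      ∀ i, 1 / (2 * ((K : ℝ) + 1) ^ d) ≤
        Real.exp (-(4 * ((v - t) i - round ((v - t) i)) ^ 2)) ^ K := by
  have hC := h.C_pos
  have hK1 : (1 : ℝ) ≤ K := by exact_mod_cast hK
  have hS1 : (1 : ℝ) ≤ S := by exact_mod_cast hS
  have hd0 : (0 : ℝ) ≤ d := Nat.cast_nonneg d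
  set s : ℝ := 1 / (2 * ((d + 1) * (C + 1) * K)) with hs_def
  have hs0 : 0 < s := by positivity
  have hs1 : s ≤ 1 := by
    rw [hs_def, div_le_one (by positivity)]
    have : 1 ≤ ((d : ℝ) + 1) * (C + 1) * K := one_le_mul_of_one_le_of_one_le
      (one_le_mul_of_one_le_of_one_le (by linarith) (by linarith)) hK1
    linarith
  set ρ : ℝ := 1 / (2 * ((K : ℝ) + 1) ^ d) with hρ
  have hρ0 : 0 < ρ := by positivity
  set T := Fintype.piFinset fun _ : Fin d => Finset.range S
  have hTcard : (T.card : ℝ) = S ^ d := by simp [T]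
  have hTne : T.Nonempty :=
    ⟨fun _ => 0, Fintype.mem_piFinset.2 fun _ => Finset.mem_range.2 (by omega)⟩
  have hcorr : ∀ a ∈ Fintype.piFinset fun _ : Fin d => Finset.range (K + 1),
      ∀ b ∈ Fintype.piFinset fun _ : Fin d => Finset.range (K + 1), -(ρ * T.card) ≤
      (∑ k ∈ T, ecirc (zdot (fun i => (a i : ℤ)) (v - p fun i => (k i : ℝ) * s)) *
        (starRingEnd ℂ) (ecirc (zdot (fun i => (b i : ℤ)) (v - p fun i => (k i : ℝ) * s)))).re := by
    intro a ha b hb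
    set ξ : Fin d → ℤ := fun i => (b i : ℤ) - a i
    have e : ∀ k : Fin d → ℕ, ecirc (zdot (fun i => (a i : ℤ)) (v - p fun i => (k i : ℝ) * s)) *
        (starRingEnd ℂ) (ecirc (zdot (fun i => (b i : ℤ)) (v - p fun i => (k i : ℝ) * s))) =
        ecirc (-zdot ξ v) * ecirc (zdot ξ (p fun i => (k i : ℝ) * s)) := by
      intro k
      have : ξ = (fun i => (b i : ℤ)) - fun i => (a i : ℤ) := rfl
      rw [conj_ecirc, ← ecirc_add, ← ecirc_add, this, zdot_sub, zdot_sub, map_sub, map_sub]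
      congr 1; ring
    simp only [e]
    rw [← Finset.mul_sum]
    by_cases hξ : formSize p ξ = 0
    · have h0 : ∀ w, p w = w → zdot ξ w = 0 := by
        intro w hw
        have := abs_zdot_le_formSize p ξ hw
        rw [hξ, zero_mul] at this
        exact abs_nonpos_iff.1 this
      have h1 : ∀ k : Fin d → ℕ, zdot ξ (p fun i => (k i : ℝ) * s) = 0 := fun k => h0 _ (h.idem _)
      simp only [h1, h0 v hv, neg_zero, ecirc_zero, one_mul, Finset.sum_const, nsmul_eq_mul,
        mul_one,
        Complex.natCast_re]
      have : 0 ≤ ρ * T.card := by positivity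
      linarith [Nat.cast_nonneg (α := ℝ) T.card]
    · have hξK : ∀ i, |ξ i| ≤ K := by
        intro i
        have h1 := Finset.mem_range.1 (Fintype.mem_piFinset.1 ha i)
        have h2 := Finset.mem_range.1 (Fintype.mem_piFinset.1 hb i)
        simp only [ξ]
        rw [abs_le]; constructor <;> omega
      have hξK' : ∀ i, |(ξ i : ℝ)| ≤ K := fun i => by exact_mod_cast hξK i
      have h1 := hdio ξ hξK hξ
      obtain ⟨j, hj⟩ : ∃ j, formSize p ξ ≤ d * |zdot ξ (p (Pi.single j 1))| := by
        by_contra! hlt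
        have hpos : 0 < formSize p ξ := lt_of_le_of_ne (formSize_nonneg p ξ) (Ne.symm hξ)
        have hne : (Finset.univ : Finset (Fin d)).Nonempty := by
          rw [Finset.univ_nonempty_iff]
          by_contra hemp
          rw [not_nonempty_iff] at hemp
          exact hξ (by simp [formSize])
        have := Finset.sum_lt_sum_of_nonempty hne fun i _ => hlt i
        rw [← Finset.mul_sum] at this
        simp only [Finset.sum_const, Finset.card_univ, Fintype.card_fin, nsmul_eq_mul] at this
        exact lt_irrefl _ this
      set β := |zdot ξ (p (Pi.single j 1))| with hβ
      have hβ1 : 1 ≤ d * c * β := by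
        have := mul_le_mul_of_nonneg_left hj hc.le
        linarith
      have hβ0 : 0 < β := by
        by_contra! hle
        have : β = 0 := le_antisymm hle (abs_nonneg _)
        rw [this, mul_zero] at hβ1
        linarith
      have habs : |zdot ξ (p (Pi.single j 1)) * s| = β * s := by rw [abs_mul, abs_of_pos hs0]
      have hβle : β ≤ d * K * C := (abs_zdot_le hξK' _).trans
        (mul_le_mul_of_nonneg_left (h.norm_single_le j) (by positivity))
      have hgrid := norm_sum_ecirc_grid_le p ξ s S j
        (by rw [← abs_pos, habs]; positivity) (by
          rw [habs, hs_def, mul_one_div, div_le_div_iff₀ (by positivity) two_pos]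
          have : d * K * C ≤ ((d : ℝ) + 1) * (C + 1) * K := by nlinarith [mul_nonneg hd0 hC.le]
          linarith)
      rw [habs] at hgrid
      have h3 : 1 / (2 * (β * s)) ≤ ρ * S := by
        have h4 : 1 / (2 * (β * s)) = (d + 1) * (C + 1) * K / β := by rw [hs_def]; field_simp
        have h5 : d * c * (d + 1) * (C + 1) * K ≤ ρ * S := by
          have : ρ * (2 * ((K : ℝ) + 1) ^ d) = 1 := by rw [hρ]; field_simp
          calc d * c * (d + 1) * (C + 1) * K =
              ρ * (2 * ((K : ℝ) + 1) ^ d * (d * c * (d + 1) * (C + 1) * K)) := by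
                rw [← mul_assoc ρ, this, one_mul]
            _ ≤ ρ * S := by gcongr
        rw [h4]
        refine le_trans ?_ h5
        rw [div_le_iff₀ hβ0]
        have := mul_le_mul_of_nonneg_left hβ1 (by positivity : 0 ≤ ((d : ℝ) + 1) * (C + 1) * K)
        linarith
      refine neg_le_of_abs_le ((Complex.abs_re_le_norm _).trans ?_)
      rw [norm_mul, norm_ecirc, one_mul, hTcard]
      refine le_of_mul_le_mul_right (hgrid.trans ?_) (by linarith : (0 : ℝ) < S)
      rw [div_eq_mul_one_div]
      have := mul_le_mul_of_nonneg_left h3 (by positivity : (0 : ℝ) ≤ S ^ d)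
      linarith
  obtain ⟨k, hkT, hk⟩ :=
    exists_norm_sq_sum_ge (Fintype.piFinset fun _ : Fin d => Finset.range (K + 1)) T hTne
    (binomWeight K) (fun a _ => binomWeight_nonneg K a) (sum_binomWeight K)
    (fun a k => ecirc (zdot (fun i => (a i : ℤ)) (v - p fun i => (k i : ℝ) * s))) (ρ := ρ)
    (fun a _ t _ => norm_ecirc _) hcorr hρ0.le
  refine ⟨p fun i => (k i : ℝ) * s, h.idem _, ?_, fun i => ?_⟩
  · refine (h.norm_le _).trans (mul_le_mul_of_nonneg_left ?_ hC.le)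
    rw [pi_norm_le_iff_of_nonneg (by positivity)]
    intro i
    have hki : (k i : ℝ) ≤ S := by
      have := Finset.mem_range.1 (Fintype.mem_piFinset.1 hkT i)
      exact_mod_cast this.le
    rw [Real.norm_eq_abs, abs_of_nonneg (by positivity)]
    calc (k i : ℝ) * s ≤ S * 1 := by gcongr
      _ = S := mul_one _
  · refine le_trans ?_ (norm_kernel_sq_le K (v - p fun i => (k i : ℝ) * s) i)
    refine le_trans ?_ hk
    have := le_sum_binomWeight_sq (d := d) K
    have e : 1 / ((K : ℝ) + 1) ^ d = 2 * ρ := by rw [hρ]; field_simp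
    linarith

theorem exists_density (h : IsSplitting (A.map ((↑) : ℤ → ℝ)).toLin' g p κ C D) :
    ∃ (c : ℝ) (q : ℕ), 0 < c ∧ ∀ n : ℕ, 1 ≤ n → ∀ v, p v = v → ∃ t, p t = t ∧ ‖t‖ ≤ c * n ^ q ∧
      ∀ i, |(v - t) i - round ((v - t) i)| ≤ 1 / n := by
  obtain ⟨c, q, hc, hdio⟩ := exists_diophantine h
  have hC := h.C_pos
  set B : ℝ := 2 * 2 ^ d * (d * c * (d + 1) * (C + 1))
  have hB : 0 ≤ B := by positivity
  refine ⟨C * (B + 2) * ((d + 1) ^ 2) ^ (d + q + 1), 4 * (d + q + 1), by positivity,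
    fun n hn v hv => ?_⟩
  obtain ⟨K, hK⟩ : ∃ K, K = (d + 1) ^ 2 * n ^ 4 := ⟨_, rfl⟩
  have hK1 : 1 ≤ K := hK ▸ Nat.succ_le_of_lt (by positivity)
  have hK1' : (1 : ℝ) ≤ K := by exact_mod_cast hK1
  set Z : ℝ := 2 * ((K : ℝ) + 1) ^ d * (d * (c * K ^ q) * (d + 1) * (C + 1) * K)
  have hZ : Z ≤ B * K ^ (d + q + 1) := by
    calc Z ≤ 2 * (2 * K : ℝ) ^ d * (d * (c * K ^ q) * (d + 1) * (C + 1) * K) := by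
          simp only [Z]; gcongr; linarith
      _ = B * K ^ (d + q + 1) := by simp only [B]; rw [mul_pow]; ring
  obtain ⟨t, ht, htn, htr⟩ :=
    exists_near_integer h (S := ⌈Z⌉₊ + 1) hK1 (by omega) (c := c * K ^ q) (by positivity)
    (hdio K hK1) (by push_cast; linarith [Nat.le_ceil Z]) hv
  refine ⟨t, ht, htn.trans ?_, fun i => exists_near_of_exp_le n K hn hK (htr i)⟩
  have h1 := Nat.ceil_lt_add_one (a := Z) (by positivity)
  have h2 : (1 : ℝ) ≤ K ^ (d + q + 1) := one_le_pow₀ hK1'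
  calc C * ((⌈Z⌉₊ + 1 : ℕ) : ℝ) ≤ C * ((B + 2) * K ^ (d + q + 1)) := by
        push_cast; gcongr; linarith
    _ = _ := by rw [hK]; push_cast; rw [mul_pow, ← pow_mul]; ring

end density

section torus

/-! ### The torus and its expanding leaf -/

variable {d : ℕ} {A : Matrix (Fin d) (Fin d) ℤ} {g p : Module.End ℝ (Fin d → ℝ)} {κ C : ℝ}
  {D : ℝ → ℝ}

/-- The covering map `ℝ^d → ℝ^d/ℤ^d`. -/
def torusMk : (Fin d → ℝ) →+ Torus d where
  toFun v i := (v i : AddCircle (1 : ℝ))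
  map_zero' := rfl
  map_add' _ _ := rfl

theorem torusMk_apply (v : Fin d → ℝ) (i : Fin d) : torusMk v i = (v i : AddCircle (1 : ℝ)) := rfl

theorem norm_torusMk_le (v : Fin d → ℝ) : ‖torusMk v‖ ≤ ‖v‖ := by
  rw [pi_norm_le_iff_of_nonneg (norm_nonneg _)]
  intro i
  rw [torusMk_apply, UnitAddCircle.norm_eq]
  have := round_le (v i) 0
  simp only [Int.cast_zero, sub_zero] at this
  exact this.trans (norm_le_pi_norm v i)

theorem norm_torusMk_eq {v : Fin d → ℝ} (hv : ‖v‖ ≤ 1 / 2) : ‖torusMk v‖ = ‖v‖ := by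
  refine le_antisymm (norm_torusMk_le v) ?_
  rw [pi_norm_le_iff_of_nonneg (norm_nonneg _)]
  intro i
  have h1 : ‖(v i : AddCircle (1 : ℝ))‖ = |v i| :=
    (AddCircle.norm_coe_eq_abs_iff 1 one_ne_zero).2 (by
      rw [abs_one]; exact (norm_le_pi_norm v i).trans hv)
  rw [Real.norm_eq_abs, ← h1]
  exact norm_le_pi_norm (torusMk v) i

theorem torusMk_round (v : Fin d → ℝ) : torusMk (fun i => v i - round (v i)) = torusMk v := by
  ext i
  simp only [torusMk_apply, AddCircle.coe_sub]
  have : ((round (v i) : ℝ) : AddCircle (1 : ℝ)) = 0 :=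
    (AddCircle.coe_eq_zero_iff 1).2 ⟨round (v i), by simp⟩
  rw [this, sub_zero]

theorem exists_torusMk_eq (y : Torus d) : ∃ v : Fin d → ℝ, torusMk v = y ∧ ‖v‖ ≤ 1 := by
  have h : ∀ i, ∃ r : ℝ, (r : AddCircle (1 : ℝ)) = y i :=
    fun i => QuotientAddGroup.mk_surjective (y i)
  choose r hr using h
  refine ⟨fun i => r i - round (r i), (torusMk_round r).trans (funext hr), ?_⟩
  rw [pi_norm_le_iff_of_nonneg zero_le_one]
  intro i
  exact (abs_sub_round (r i)).trans (by norm_num)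

theorem toralAut_torusMk (v : Fin d → ℝ) :
    toralAut A (torusMk v) = torusMk ((A.map ((↑) : ℤ → ℝ)).toLin' v) := by
  ext i
  simp only [toralAut, torusMk_apply, Matrix.toLin'_apply, Matrix.mulVec, dotProduct,
    Matrix.map_apply]
  rw [← QuotientAddGroup.mk'_apply, map_sum]
  refine Finset.sum_congr rfl fun j _ => ?_
  rw [← zsmul_eq_mul, map_zsmul, QuotientAddGroup.mk'_apply]

theorem toralAut_iterate_torusMk (n : ℕ) (v : Fin d → ℝ) :
    (toralAut A)^[n] (torusMk v) = torusMk (((A.map ((↑) : ℤ → ℝ)).toLin' ^ n) v) := by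
  induction n with
  | zero => rfl
  | succ n ih => rw [Function.iterate_succ_apply', ih, toralAut_torusMk, pow_succ',
    Module.End.mul_apply]

theorem continuous_toralAut (A : Matrix (Fin d) (Fin d) ℤ) : Continuous (toralAut A) := by
  unfold toralAut
  fun_prop

theorem toralAut_toralAut (A B : Matrix (Fin d) (Fin d) ℤ) (y : Torus d) :
    toralAut A (toralAut B y) = toralAut (A * B) y := by
  ext i
  simp only [toralAut, Matrix.mul_apply, Finset.smul_sum, Finset.sum_smul, smul_smul]
  exact Finset.sum_comm

theorem toralAut_one (y : Torus d) : toralAut (1 : Matrix (Fin d) (Fin d) ℤ) y = y := by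
  ext i
  simp only [toralAut, Matrix.one_apply, ite_smul, one_smul, zero_smul]
  rw [Finset.sum_ite_eq]
  simp

theorem injective_toralAut (hA : IsUnit A.det) : Function.Injective (toralAut A) :=
  Function.LeftInverse.injective (g := toralAut A⁻¹) fun y => by
    rw [toralAut_toralAut, Matrix.nonsing_inv_mul A hA, toralAut_one]

/-- The image in the torus of the range of the projection `p`. -/
def leaf (p : Module.End ℝ (Fin d → ℝ)) : Set (Torus d) := torusMk '' {v | p v = v}

theorem toralAut_mem_leaf (h : IsSplitting (A.map ((↑) : ℤ → ℝ)).toLin' g p κ C D) {z : Torus d}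
    (hz : z ∈ leaf p) : toralAut A z ∈ leaf p := by
  obtain ⟨v, hv, rfl⟩ := hz
  exact ⟨_, h.f_mem v hv, (toralAut_torusMk v).symm⟩

theorem exists_translate (h : IsSplitting (A.map ((↑) : ℤ → ℝ)).toLin' g p κ C D) :
    ∃ q : ℕ, ∀ η : ℝ, 0 < η → ∀ δ : ℝ, 0 < δ → ∃ K : ℝ, 0 < K ∧ ∀ (m : ℕ) (v : Fin d → ℝ), p v = v →
      ∃ t s : Fin d → ℝ, p t = t ∧ ‖t‖ ≤ K * Real.exp (η * q * m) ∧ torusMk (v - t) = torusMk s ∧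
        ∀ i < m, ‖((A.map ((↑) : ℤ → ℝ)).toLin' ^ i) s‖ ≤ δ := by
  obtain ⟨c, q, hc, H⟩ := exists_density h
  have hC := h.C_pos
  refine ⟨q, fun η hη δ hδ => ?_⟩
  have hD := h.D_pos η hη
  refine ⟨c * (D η / δ + 2) ^ q + C, by positivity, fun m v hv => ?_⟩
  set X := Real.exp (η * m) with hX
  have hX1 : 1 ≤ X := Real.one_le_exp (by positivity)
  set n := ⌈D η * X / δ⌉₊ + 1 with hn
  have hn1 : (1 : ℝ) ≤ n := by exact_mod_cast Nat.le_add_left 1 _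
  have hnle : (n : ℝ) ≤ (D η / δ + 2) * X := by
    have := (Nat.ceil_lt_add_one (show 0 ≤ D η * X / δ by positivity)).le
    rw [hn]; push_cast
    calc _ ≤ D η * X / δ + 1 + 1 := by linarith
      _ ≤ D η * X / δ + X + X := by linarith
      _ = _ := by ring
  have hnge : D η * X / δ ≤ n := by
    have := Nat.le_ceil (D η * X / δ)
    rw [hn]; push_cast; linarith
  obtain ⟨t, ht, htn, hround⟩ := H n (Nat.le_add_left 1 _) v hv
  set s : Fin d → ℝ := fun i => (v - t) i - round ((v - t) i) with hs
  have hsn : ‖s‖ ≤ 1 / n := by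
    rw [pi_norm_le_iff_of_nonneg (by positivity)]
    exact hround
  have hsmk : torusMk s = torusMk (v - t) := torusMk_round _
  have hs1 : ‖s‖ ≤ 1 := hsn.trans ((div_le_one (by linarith)).2 hn1)
  refine ⟨t + p s, s - p s, by rw [map_add, ht, h.idem], ?_, ?_, fun i hi => ?_⟩
  · have hXq : Real.exp (η * q * m) = X ^ q := by
      rw [hX, ← Real.exp_nat_mul]; congr 1; ring
    have hXq1 : 1 ≤ X ^ q := one_le_pow₀ hX1
    rw [hXq]
    calc ‖t + p s‖ ≤ ‖t‖ + ‖p s‖ := norm_add_le _ _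
      _ ≤ c * n ^ q + C := by
        gcongr
        exact (h.norm_le s).trans (mul_le_of_le_one_right hC.le hs1)
      _ ≤ c * ((D η / δ + 2) * X) ^ q + C * X ^ q := by
        gcongr
        exact le_mul_of_one_le_right hC.le hXq1
      _ = _ := by rw [mul_pow]; ring
  · rw [← sub_sub, map_sub, map_sub torusMk s, hsmk]
  · have h1 := h.le_exp η hη i s
    refine h1.trans ?_
    have h2 : Real.exp η ^ i ≤ X := by
      rw [← Real.exp_nat_mul, hX, mul_comm]
      apply Real.exp_le_exp.2
      gcongr
    calc D η * Real.exp η ^ i * ‖s‖ ≤ D η * X * (1 / n) := by gcongr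
      _ ≤ δ := by
        rw [mul_one_div, div_le_iff₀ (by linarith)]
        rw [div_le_iff₀ hδ] at hnge
        linarith

theorem add_mul_le_of_gap {a m : ℕ → ℕ} {τ : ℝ} {N : ℕ} (hτ : 0 < τ)
    (hgap : ∀ j, (a j + m j + τ * m (j + 1) + N : ℝ) ≤ a (j + 1)) {j J : ℕ} (hj : j ≤ J) :
    (a j + m j + τ * m (J + 1) + N * ((J + 1 - j : ℕ) : ℝ) : ℝ) ≤ a (J + 1) := by
  induction J, hj using Nat.le_induction with
  | base => simpa using hgap j
  | succ J hj ih =>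
    have h1 := hgap (J + 1)
    have e : ((J + 1 + 1 - j : ℕ) : ℝ) = ((J + 1 - j : ℕ) : ℝ) + 1 := by
      rw [← Nat.cast_add_one]; congr 1; omega
    rw [e]
    have h2 : (0 : ℝ) ≤ τ * m (J + 1) := by positivity
    have h3 : (0 : ℝ) ≤ m (J + 1) := Nat.cast_nonneg _
    linarith

theorem exists_glueAt (h : IsSplitting (A.map ((↑) : ℤ → ℝ)).toLin' g p κ C D) {δ τ : ℝ}
    (hδ : 0 < δ)
    (hτ : 0 < τ) : ∃ N, GlueAt (toralAut A) (leaf p) δ τ N := by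
  obtain ⟨q, Hq⟩ := exists_translate h
  have hC := h.C_pos
  have hκ0 := h.pos
  set l : ℝ := -Real.log κ with hl_def
  have hl : 0 < l := by have := Real.log_neg hκ0 h.lt_one; rw [hl_def]; linarith
  have hκ : κ = Real.exp (-l) := by rw [hl_def, neg_neg, Real.exp_log hκ0]
  set η : ℝ := τ * l / (q + 1) with hη
  have hη0 : 0 < η := by positivity
  have hηq : η * q ≤ τ * l := by
    rw [hη, div_mul_eq_mul_div, div_le_iff₀ (by positivity)]
    have : 0 ≤ τ * l := by positivity
    nlinarith
  obtain ⟨K, hK, HK⟩ := Hq η hη0 (δ / 2) (by positivity)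
  obtain ⟨N₁, hN₁⟩ := exists_pow_lt_of_lt_one (show 0 < δ / (4 * (C * K)) by positivity) h.lt_one
  obtain ⟨N₂, hN₂⟩ := exists_pow_lt_of_lt_one (show (0 : ℝ) < 1 / 2 by norm_num) h.lt_one
  set N := N₁ + N₂ with hN
  have hNa : C * K * κ ^ N ≤ δ / 4 := by
    have h1 : κ ^ N ≤ κ ^ N₁ := pow_le_pow_of_le_one hκ0.le h.lt_one.le (Nat.le_add_right _ _)
    calc C * K * κ ^ N ≤ C * K * (δ / (4 * (C * K))) := by gcongr; linarith
      _ = δ / 4 := by field_simp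
  have hNb : κ ^ N ≤ 1 / 2 :=
    (pow_le_pow_of_le_one hκ0.le h.lt_one.le (Nat.le_add_left _ _)).trans hN₂.le
  have hsmall : ∀ r, C * K * (κ ^ N) ^ (r + 1) ≤ δ / 2 * (1 / 2) ^ (r + 1) := by
    intro r
    calc C * K * (κ ^ N) ^ (r + 1) = C * K * κ ^ N * (κ ^ N) ^ r := by ring
      _ ≤ δ / 4 * (1 / 2) ^ r := by gcongr
      _ = _ := by ring
  refine ⟨N, fun a m y hy hgap J => ?_⟩
  choose w hw hwy using hy
  have step : ∀ J u, p u = u → ∃ t, p t = t ∧ ‖t‖ ≤ K * Real.exp (η * q * m J) ∧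
      ∀ i < m J, dist ((toralAut A)^[a J + i] (torusMk (u + (g ^ a J) t)))
        ((toralAut A)^[i] (y J)) ≤ δ / 2 := by
    intro J u hu
    set M := (A.map ((↑) : ℤ → ℝ)).toLin' with hM
    obtain ⟨t, s, ht, htn, hts, hs⟩ := HK (m J) (w J - (M ^ a J) u)
      (by rw [map_sub, hw J, h.f_pow_mem _ hu])
    refine ⟨t, ht, htn, fun i hi => ?_⟩
    have e1 : (toralAut A)^[a J] (torusMk (u + (g ^ a J) t)) = torusMk (w J - s) := by
      rw [toralAut_iterate_torusMk, map_add, ← hM, h.fg_pow, map_sub torusMk, ← hts, ← map_sub]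
      congr 1; abel
    rw [add_comm, Function.iterate_add_apply, e1, ← hwy J, toralAut_iterate_torusMk,
      toralAut_iterate_torusMk, dist_eq_norm, ← map_sub, ← map_sub, sub_sub_cancel_left, map_neg,
        map_neg,
      norm_neg]
    exact (norm_torusMk_le _).trans (hs i hi)
  have key : ∀ J : ℕ, ∃ u, p u = u ∧ ∀ j ≤ J, ∀ i < m j,
      dist ((toralAut A)^[a j + i] (torusMk u)) ((toralAut A)^[i] (y j)) ≤
        δ / 2 + δ / 2 * (1 - (1 / 2) ^ (J - j)) := by
    intro J
    induction J with
    | zero =>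
      obtain ⟨t, ht, -, H⟩ := step 0 0 (map_zero _)
      refine ⟨0 + (g ^ a 0) t, by rw [zero_add, h.g_pow_mem _ ht], fun j hj i hi => ?_⟩
      obtain rfl : j = 0 := by omega
      simpa using H i hi
    | succ J ih =>
      obtain ⟨u, hu, hJ⟩ := ih
      obtain ⟨t, ht, htn, H⟩ := step (J + 1) u hu
      refine ⟨u + (g ^ a (J + 1)) t, by rw [map_add, hu, h.g_pow_mem _ ht], fun j hj i hi => ?_⟩
      rcases Nat.lt_or_eq_of_le hj with hj' | rfl
      · have hj'' : j ≤ J := by omega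
        have hgap' := add_mul_le_of_gap hτ hgap hj''
        have hle : a j + i ≤ a (J + 1) := by
          have h1 : (0 : ℝ) ≤ τ * m (J + 1) := by positivity
          have h2 : (0 : ℝ) ≤ N * ((J + 1 - j : ℕ) : ℝ) := by positivity
          have h3 : (a j + m j : ℝ) ≤ a (J + 1) := by linarith
          have : a j + m j ≤ a (J + 1) := by exact_mod_cast h3
          omega
        obtain ⟨e, he⟩ := Nat.exists_eq_add_of_le hle
        have hee : (τ * m (J + 1) + N * ((J + 1 - j : ℕ) : ℝ) : ℝ) ≤ e := by
          have h1 : (i : ℝ) ≤ m j := by exact_mod_cast hi.le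
          have h2 : (a (J + 1) : ℝ) = a j + i + e := by exact_mod_cast he
          linarith
        have hκe : κ ^ e * Real.exp (η * q * m (J + 1)) ≤ (κ ^ N) ^ (J + 1 - j) := by
          rw [hκ, ← Real.exp_nat_mul, ← Real.exp_nat_mul, ← Real.exp_nat_mul, ← Real.exp_add]
          apply Real.exp_le_exp.2
          have h1 := mul_le_mul_of_nonneg_right hee hl.le
          have h2 : η * q * m (J + 1) ≤ τ * l * m (J + 1) := by gcongr
          linarith
        have hshift : ‖((A.map ((↑) : ℤ → ℝ)).toLin' ^ (a j + i)) ((g ^ a (J + 1)) t)‖ ≤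
            δ / 2 * (1 / 2) ^ (J + 1 - j) := by
          rw [he, pow_add g, Module.End.mul_apply, h.fg_pow]
          refine (h.le e t ht).trans ?_
          calc C * κ ^ e * ‖t‖ ≤ C * κ ^ e * (K * Real.exp (η * q * m (J + 1))) := by gcongr
            _ = C * K * (κ ^ e * Real.exp (η * q * m (J + 1))) := by ring
            _ ≤ C * K * (κ ^ N) ^ (J + 1 - j) := by gcongr
            _ ≤ _ := by
              obtain ⟨r, hr⟩ : ∃ r, J + 1 - j = r + 1 := ⟨J - j, by omega⟩
              rw [hr]; exact hsmall r
        have htri := dist_triangle ((toralAut A)^[a j + i] (torusMk (u + (g ^ a (J + 1)) t)))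
          ((toralAut A)^[a j + i] (torusMk u)) ((toralAut A)^[i] (y j))
        have hd : dist ((toralAut A)^[a j + i] (torusMk (u + (g ^ a (J + 1)) t)))
            ((toralAut A)^[a j + i] (torusMk u)) ≤ δ / 2 * (1 / 2) ^ (J + 1 - j) := by
          rw [toralAut_iterate_torusMk, toralAut_iterate_torusMk, dist_eq_norm, ← map_sub,
            ← map_sub,
            add_sub_cancel_left]
          exact (norm_torusMk_le _).trans hshift
        have hJj := hJ j hj'' i hi
        have e2 : ((1 : ℝ) / 2) ^ (J - j) = 2 * (1 / 2) ^ (J + 1 - j) := by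
          rw [Nat.sub_add_comm hj'', pow_succ]; ring
        rw [e2] at hJj
        linarith only [htri, hd, hJj]
      · simpa using H i hi
  obtain ⟨u, hu, H⟩ := key J
  refine ⟨torusMk u, ⟨u, hu, rfl⟩, fun j hj i hi => (H j hj i hi).trans ?_⟩
  have : (0 : ℝ) ≤ (1 / 2) ^ (J - j) := by positivity
  nlinarith

end torus

section marker

/-! ### Marker words -/

variable {d : ℕ} {A : Matrix (Fin d) (Fin d) ℤ} {g p : Module.End ℝ (Fin d → ℝ)} {κ C : ℝ}
  {D : ℝ → ℝ}

theorem IsSplitting.exists_sep {V : Type*} [NormedAddCommGroup V] [NormedSpace ℝ V]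
    {f g p : Module.End ℝ V} (h : IsSplitting f g p κ C D) {v : V} (hv : p v = v) (hv0 : v ≠ 0) :
    ∃ ρ : ℝ, 0 < ρ ∧ ∀ n : ℕ, 1 ≤ n → ρ ≤ ‖(g ^ n) v - v‖ := by
  have hC := h.C_pos
  have hnv : 0 < ‖v‖ := norm_pos_iff.2 hv0
  obtain ⟨I, hI⟩ := exists_pow_lt_of_lt_one (show 0 < 1 / (2 * C) by positivity) h.lt_one
  have hfar : ∀ n, I ≤ n → ‖v‖ / 2 ≤ ‖(g ^ n) v - v‖ := by
    intro n hn
    have h1 : ‖(g ^ n) v‖ ≤ ‖v‖ / 2 := by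
      refine (h.le n v hv).trans ?_
      calc C * κ ^ n * ‖v‖ ≤ C * (1 / (2 * C)) * ‖v‖ := by
            have := pow_le_pow_of_le_one h.pos.le h.lt_one.le hn
            gcongr; linarith
        _ = ‖v‖ / 2 := by field_simp
    have h2 := norm_sub_norm_le v ((g ^ n) v)
    rw [norm_sub_rev] at h2
    linarith
  have hne : ∀ n : ℕ, 1 ≤ n → 0 < ‖(g ^ n) v - v‖ := by
    intro n hn
    rw [norm_pos_iff, sub_ne_zero]
    intro he
    have hk : ∀ k : ℕ, (g ^ (n * k)) v = v := by
      intro k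
      induction k with
      | zero => rfl
      | succ k ih => rw [mul_add, mul_one, pow_add, Module.End.mul_apply, he, ih]
    have := hfar (n * I) (Nat.le_mul_of_pos_left I hn)
    rw [hk I, sub_self, norm_zero] at this
    linarith
  have hmin : ∀ I : ℕ, ∃ ρ : ℝ, 0 < ρ ∧ ∀ n : ℕ, 1 ≤ n → n < I → ρ ≤ ‖(g ^ n) v - v‖ := by
    intro I
    induction I with
    | zero => exact ⟨1, one_pos, fun n _ hn => absurd hn (Nat.not_lt_zero n)⟩
    | succ I ih =>
      obtain ⟨ρ, hρ, H⟩ := ih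
      rcases Nat.eq_zero_or_pos I with h0 | h0
      · exact ⟨ρ, hρ, fun n hn hn' => by omega⟩
      · refine ⟨min ρ ‖(g ^ I) v - v‖, lt_min hρ (hne I h0), fun n hn hn' => ?_⟩
        rcases Nat.lt_succ_iff_lt_or_eq.1 hn' with h1 | rfl
        · exact (min_le_left _ _).trans (H n hn h1)
        · exact min_le_right _ _
  obtain ⟨ρ, hρ, H⟩ := hmin I
  refine ⟨min ρ (‖v‖ / 2), lt_min hρ (by positivity), fun n hn => ?_⟩
  rcases lt_or_ge n I with h1 | h1
  · exact (min_le_left _ _).trans (H n hn h1)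
  · exact (min_le_right _ _).trans (hfar n h1)

theorem exists_marker (h : IsSplitting (A.map ((↑) : ℤ → ℝ)).toLin' g p κ C D) {w : Fin d → ℝ}
    (hw : p w = w) (hw0 : w ≠ 0) : ∃ ρ : ℝ, 0 < ρ ∧ ∀ ε : ℝ, 0 < ε → ∃ s : ℕ, ∀ m, ∃ z ∈ leaf p,
      (∀ i, i + s ≤ m → dist ((toralAut A)^[i] z) 0 < ε) ∧
        ∀ i < m, ρ ≤ dist ((toralAut A)^[i] z) ((toralAut A)^[m] z) := by
  have hC := h.C_pos
  have hnw : 0 < ‖w‖ := norm_pos_iff.2 hw0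
  set v : Fin d → ℝ := (1 / (4 * (C + 1) * ‖w‖)) • w with hv_def
  have hv : p v = v := by rw [hv_def, map_smul, hw]
  have hvn : ‖v‖ = 1 / (4 * (C + 1)) := by
    rw [hv_def, norm_smul, Real.norm_eq_abs, abs_of_pos (by positivity)]
    field_simp
  have hv0 : v ≠ 0 := by
    rw [← norm_pos_iff, hvn]; positivity
  have hgv : ∀ n : ℕ, ‖(g ^ n) v‖ ≤ 1 / 4 := by
    intro n
    refine (h.le n v hv).trans ?_
    rw [hvn]
    calc C * κ ^ n * (1 / (4 * (C + 1))) ≤ C * 1 * (1 / (4 * (C + 1))) := by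
          gcongr; exact pow_le_one₀ h.pos.le h.lt_one.le
      _ ≤ 1 / 4 := by
        rw [mul_one, mul_one_div, div_le_div_iff₀ (by positivity) (by norm_num)]
        linarith
  obtain ⟨ρ, hρ, H⟩ := h.exists_sep hv hv0
  refine ⟨ρ, hρ, fun ε hε => ?_⟩
  obtain ⟨s, hs⟩ :=
    exists_pow_lt_of_lt_one (show 0 < ε / (C * ‖v‖) by rw [hvn]; positivity) h.lt_one
  have hit : ∀ m i, i ≤ m → (toralAut A)^[i] (torusMk ((g ^ m) v)) = torusMk ((g ^ (m - i)) v) := by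
    intro m i hi
    obtain ⟨e, rfl⟩ := Nat.exists_eq_add_of_le hi
    rw [toralAut_iterate_torusMk, pow_add, Module.End.mul_apply, h.fg_pow, Nat.add_sub_cancel_left]
  refine ⟨s, fun m => ⟨torusMk ((g ^ m) v), ⟨_, h.g_pow_mem m hv, rfl⟩, fun i hi => ?_,
    fun i hi => ?_⟩⟩
  · rw [hit m i (by omega), dist_zero_right]
    refine (norm_torusMk_le _).trans_lt ((h.le _ v hv).trans_lt ?_)
    have h1 : κ ^ (m - i) ≤ κ ^ s := pow_le_pow_of_le_one h.pos.le h.lt_one.le (by omega)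
    have h2 : 0 < C * ‖v‖ := by rw [hvn]; positivity
    rw [lt_div_iff₀ h2] at hs
    have := mul_le_mul_of_nonneg_right h1 h2.le
    linarith
  · rw [hit m i hi.le, hit m m le_rfl, Nat.sub_self, dist_eq_norm, ← map_sub, pow_zero,
      Module.End.one_apply]
    have h0 : ‖v‖ ≤ 1 / 4 := hgv 0
    have h1 := hgv (m - i)
    have h2 := norm_sub_le ((g ^ (m - i)) v) v
    rw [norm_torusMk_eq (by linarith)]
    exact H _ (by omega)

end marker

section words

/-! ### Words in the expanding leaf -/

/-- `s` consists of points whose orbit segments of length `n` are pairwise `ε`-separated. -/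
def Separated {Y : Type*} [PseudoMetricSpace Y] (f : Y → Y) (n : ℕ) (ε : ℝ) (s : Finset Y) : Prop :=
  ∀ z ∈ s, ∀ z' ∈ s, z ≠ z' → ∃ i < n, ε ≤ dist (f^[i] z) (f^[i] z')

theorem separated_of_isDynNetIn {Y : Type*} [PseudoMetricSpace Y] {f : Y → Y} {F : Set Y} {n : ℕ}
    {ε : ℝ}
    {s : Finset Y} (hε : 0 < ε) (hs : Dynamics.IsDynNetIn f F {q | dist q.1 q.2 < ε} n s) :
    Separated f n ε s := by
  intro z hz z' hz' hne
  by_contra! hlt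
  have hdisj := Set.disjoint_left.1 (hs.2 hz hz' hne)
  refine @hdisj z' ?_ ?_
  · rw [Dynamics.mem_ball_dynEntourage]
    exact fun k hk => hlt k hk
  · rw [Dynamics.mem_ball_dynEntourage]
    intro k _
    change dist _ _ < ε
    rwa [dist_self]

theorem exists_separated {Y : Type*} [PseudoMetricSpace Y] (f : Y → Y) {c : ℝ}
    (hc : (c : EReal) < topEntropy f) :
    ∃ ε : ℝ, 0 < ε ∧ ∃ᶠ n : ℕ in atTop, ∃ s : Finset Y, Real.exp (c * n) ≤ s.card ∧
      Separated f n ε s := by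
  rw [topEntropy, Dynamics.coverEntropy_eq_iSup_basis_netEntropyEntourage
    Metric.uniformity_basis_dist,
    lt_iSup_iff] at hc
  obtain ⟨ε, hc⟩ := hc
  rw [lt_iSup_iff] at hc
  obtain ⟨hε, hc⟩ := hc
  refine ⟨ε, hε, (ExpGrowth.frequently_exp_le hc).mono fun n hn => ?_⟩
  by_cases htop : Dynamics.netMaxcard f univ {q | dist q.1 q.2 < ε} n = ⊤
  · obtain ⟨s, hs, hcard⟩ :=
      (Dynamics.netMaxcard_infinite_iff f univ _ n).1 htop ⌈Real.exp (c * n)⌉₊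
    exact ⟨s, (Nat.le_ceil _).trans (by exact_mod_cast hcard), separated_of_isDynNetIn hε hs⟩
  · obtain ⟨s, hs, hcard⟩ :=
      (Dynamics.netMaxcard_finite_iff f univ _ n).1 (lt_top_iff_ne_top.2 htop)
    refine ⟨s, ?_, separated_of_isDynNetIn hε hs⟩
    rw [← hcard] at hn
    have e : ((c : EReal) * (n : EReal)) = ((c * n : ℝ) : EReal) := by push_cast; rfl
    rw [e, EReal.exp_coe, ENat.toENNReal_coe] at hn
    have := (ENNReal.ofReal_le_iff_le_toReal (ENNReal.natCast_ne_top _)).1 hn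
    simpa using this

theorem tendsto_exp_mul_natCast {a : ℝ} (ha : 0 < a) :
    Tendsto (fun n : ℕ => Real.exp (a * n)) atTop atTop :=
  Real.tendsto_exp_atTop.comp (tendsto_natCast_atTop_atTop.const_mul_atTop ha)

theorem exists_fiber_card {α : Type*} (s : Finset α) {d : ℕ} (b : α → Fin d → ℝ) {R γ W : ℝ}
    (hγ : 0 < γ)
    (hR : 0 ≤ R) (hb : ∀ y ∈ s, ‖b y‖ ≤ R) (hW : (2 * (R / γ) + 5) ^ d * W ≤ s.card) :
    ∃ t ⊆ s, W ≤ t.card ∧ ∀ y ∈ t, ∀ y' ∈ t, ‖b y - b y'‖ ≤ γ := by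
  classical
  set B : ℤ := ⌈R / γ⌉ + 1 with hB
  have hB1 : (B : ℝ) ≤ R / γ + 2 := by
    rw [hB]; push_cast
    linarith [Int.ceil_lt_add_one (R / γ)]
  have hB0 : 0 ≤ B := by
    have : 0 ≤ ⌈R / γ⌉ := Int.ceil_nonneg (by positivity)
    omega
  have hcell : ∀ y ∈ s, (fun i => ⌊b y i / γ⌋) ∈
      Fintype.piFinset fun _ : Fin d => Finset.Icc (-B) B := by
    intro y hy
    rw [Fintype.mem_piFinset]
    intro i
    have h1 : |b y i / γ| ≤ R / γ := by
      rw [abs_div, abs_of_pos hγ]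
      gcongr
      exact (norm_le_pi_norm (b y) i).trans (hb y hy)
    rw [abs_le] at h1
    have h2 : R / γ ≤ ⌈R / γ⌉ := Int.le_ceil _
    have h3 : ⌊b y i / γ⌋ ≤ ⌈R / γ⌉ := by
      have := (Int.floor_le (b y i / γ)).trans (h1.2.trans h2)
      exact_mod_cast this
    have h4 : -⌈R / γ⌉ ≤ ⌊b y i / γ⌋ := by
      rw [Int.le_floor]; push_cast; linarith
    rw [Finset.mem_Icc]; constructor <;> omega
  have hne : (Fintype.piFinset fun _ : Fin d => Finset.Icc (-B) B).Nonempty :=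
    ⟨fun _ => 0, Fintype.mem_piFinset.2 fun _ => Finset.mem_Icc.2 ⟨by omega, hB0⟩⟩
  have hcard : ((Fintype.piFinset fun _ : Fin d => Finset.Icc (-B) B).card : ℝ) ≤
    (2 * (R / γ) + 5) ^ d := by
    rw [Fintype.card_piFinset_const, Int.card_Icc]
    push_cast
    have e : (((B + 1 - -B).toNat : ℕ) : ℝ) = 2 * B + 1 := by
      have h1 : (((B + 1 - -B).toNat : ℕ) : ℤ) = 2 * B + 1 := by omega
      exact_mod_cast h1
    rw [e]
    have : (0 : ℝ) ≤ B := by exact_mod_cast hB0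
    exact pow_le_pow_left₀ (by positivity) (by linarith) d
  rcases le_or_gt W 0 with hW0 | hW0
  · exact ⟨∅, Finset.empty_subset _, by simpa using hW0, by simp⟩
  obtain ⟨k, -, hk⟩ :=
    Finset.exists_le_card_fiber_of_nsmul_le_card_of_maps_to hcell hne (b := W) (by
    rw [nsmul_eq_mul]
    exact (mul_le_mul_of_nonneg_right hcard hW0.le).trans hW)
  refine ⟨s.filter fun y => (fun i => ⌊b y i / γ⌋) = k, Finset.filter_subset _ _, hk,
    fun y hy y' hy' => ?_⟩
  rw [pi_norm_le_iff_of_nonneg hγ.le]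
  intro i
  have h1 := congrFun ((Finset.mem_filter.1 hy).2.trans (Finset.mem_filter.1 hy').2.symm) i
  have h2 := Int.abs_sub_lt_one_of_floor_eq_floor h1
  rw [← sub_div, abs_div, abs_of_pos hγ, div_lt_one hγ] at h2
  exact h2.le

variable {d : ℕ} {A : Matrix (Fin d) (Fin d) ℤ} {g p : Module.End ℝ (Fin d → ℝ)} {κ C : ℝ}
  {D : ℝ → ℝ}

theorem exists_leaf_words (h : IsSplitting (A.map ((↑) : ℤ → ℝ)).toLin' g p κ C D) {c : ℝ}
    (hc : (c : EReal) < topEntropy (toralAut A)) :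
    ∃ ε : ℝ, 0 < ε ∧ ∃ᶠ n : ℕ in atTop, ∃ s : Finset (Torus d), (∀ z ∈ s, z ∈ leaf p) ∧
      Real.exp (c * n) ≤ s.card ∧ Separated (toralAut A) n ε s := by
  classical
  obtain ⟨c', hcc, hc'⟩ := EReal.lt_iff_exists_real_btwn.1 hc
  have hcc' : 0 < c' - c := sub_pos.2 (EReal.coe_lt_coe_iff.1 hcc)
  obtain ⟨ε, hε, hfreq⟩ := exists_separated (toralAut A) hc'
  have hC := h.C_pos
  set η : ℝ := (c' - c) / (2 * (d + 1)) with hη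
  have hη0 : 0 < η := by positivity
  have hηd : η * d ≤ (c' - c) / 2 := by
    rw [hη, div_mul_eq_mul_div, div_le_div_iff₀ (by positivity) two_pos]
    nlinarith
  have hD := h.D_pos η hη0
  set K : ℝ := 2 * ((1 + C) * (2 * D η) / ε) + 5 with hK
  have hK0 : 0 < K := by positivity
  have hev :=
    (tendsto_exp_mul_natCast (show 0 < (c' - c) / 2 by linarith)).eventually_ge_atTop (K ^ d)
  refine ⟨ε / 2, by positivity, (hfreq.and_eventually hev).mono ?_⟩
  rintro n ⟨⟨s, hcard, hsep⟩, hn⟩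
  choose x hx hx1 using exists_torusMk_eq (d := d)
  set X := Real.exp (η * n) with hX
  have hX1 : 1 ≤ X := Real.one_le_exp (by positivity)
  have hX0 : 0 < X := by linarith
  obtain ⟨t, hts, htcard, ht⟩ := exists_fiber_card s (fun y => x y - p (x y)) (R := 1 + C)
    (γ := ε / (2 * (D η * X))) (W := Real.exp (c * n)) (by positivity) (by positivity)
    (fun y _ => by
      refine (norm_sub_le _ _).trans (add_le_add (hx1 y) ((h.norm_le _).trans ?_))
      exact mul_le_of_le_one_right hC.le (hx1 y)) (by
      refine le_trans ?_ hcard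
      have h1 : 2 * ((1 + C) / (ε / (2 * (D η * X)))) + 5 ≤ K * X := by
        calc 2 * ((1 + C) / (ε / (2 * (D η * X)))) + 5 = 2 * ((1 + C) * (2 * D η) / ε) * X + 5 := by
              field_simp
          _ ≤ 2 * ((1 + C) * (2 * D η) / ε) * X + 5 * X := by linarith
          _ = K * X := by rw [hK]; ring
      have hXd : X ^ d ≤ Real.exp ((c' - c) / 2 * n) := by
        rw [hX, ← Real.exp_nat_mul]
        apply Real.exp_le_exp.2
        have := mul_le_mul_of_nonneg_right hηd (Nat.cast_nonneg (α := ℝ) n)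
        linarith
      calc _ ≤ (K * X) ^ d * Real.exp (c * n) := by gcongr
        _ = K ^ d * X ^ d * Real.exp (c * n) := by rw [mul_pow]
        _ ≤ Real.exp ((c' - c) / 2 * n) * Real.exp ((c' - c) / 2 * n) * Real.exp (c * n) := by
          gcongr
        _ = Real.exp (c' * n) := by rw [← Real.exp_add, ← Real.exp_add]; congr 1; ring)
  have hsep' : ∀ y ∈ t, ∀ y' ∈ t, y ≠ y' → ∃ i < n, ε / 2 ≤
      dist ((toralAut A)^[i] (torusMk (p (x y)))) ((toralAut A)^[i] (torusMk (p (x y')))) := by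
    intro y hy y' hy' hne
    obtain ⟨i, hi, hd⟩ := hsep y (hts hy) y' (hts hy') hne
    refine ⟨i, hi, ?_⟩
    rw [← hx y, ← hx y'] at hd
    simp only [toralAut_iterate_torusMk, dist_eq_norm, ← map_sub] at hd ⊢
    set M := (A.map ((↑) : ℤ → ℝ)).toLin' with hM
    set w := (x y - x y') - p (x y - x y') with hw
    have hpw : p w = 0 := by rw [hw, map_sub, h.idem, sub_self]
    have h1 := h.le_exp η hη0 i w
    rw [hpw, sub_zero] at h1
    have hwn : ‖w‖ ≤ ε / (2 * (D η * X)) := by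
      have := ht y hy y' hy'
      rwa [show x y - p (x y) - (x y' - p (x y')) = w by rw [hw, map_sub]; abel] at this
    have h2 : Real.exp η ^ i ≤ X := by
      rw [← Real.exp_nat_mul, hX, mul_comm]
      apply Real.exp_le_exp.2
      gcongr
    have h3 : ‖(M ^ i) w‖ ≤ ε / 2 := by
      refine h1.trans ?_
      calc D η * Real.exp η ^ i * ‖w‖ ≤ D η * X * (ε / (2 * (D η * X))) := by gcongr
        _ = ε / 2 := by field_simp
    have h4 : torusMk ((M ^ i) (x y - x y')) =
        torusMk ((M ^ i) (p (x y - x y'))) + torusMk ((M ^ i) w) := by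
      rw [← map_add, ← map_add, hw]; congr 2; abel
    rw [h4] at hd
    have h5 := norm_add_le (torusMk ((M ^ i) (p (x y - x y')))) (torusMk ((M ^ i) w))
    have h6 := norm_torusMk_le ((M ^ i) w)
    linarith
  have hinj : Set.InjOn (fun y => torusMk (p (x y))) (t : Set (Torus d)) := by
    intro y hy y' hy' he
    by_contra hne
    obtain ⟨i, -, hi⟩ := hsep' y hy y' hy' hne
    simp only at he
    rw [he, dist_self] at hi
    linarith
  refine ⟨t.image fun y => torusMk (p (x y)), fun z hz => ?_, ?_, ?_⟩
  · obtain ⟨y, -, rfl⟩ := Finset.mem_image.1 hz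
    exact ⟨_, h.idem _, rfl⟩
  · rw [Finset.card_image_of_injOn hinj]; exact htcard
  · intro z hz z' hz' hne
    obtain ⟨y, hy, rfl⟩ := Finset.mem_image.1 hz
    obtain ⟨y', hy', rfl⟩ := Finset.mem_image.1 hz'
    exact hsep' y hy y' hy' fun he => hne (by rw [he])

theorem exists_leaf_words_away (h : IsSplitting (A.map ((↑) : ℤ → ℝ)).toLin' g p κ C D) {c : ℝ}
    (hc0 : 0 < c)
    (hc : (c : EReal) < topEntropy (toralAut A)) :
    ∃ ε : ℝ, 0 < ε ∧ ∃ᶠ n : ℕ in atTop, ∃ s : Finset (Torus d), (∀ z ∈ s, z ∈ leaf p) ∧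
      Real.exp (c * n) ≤ s.card ∧ Separated (toralAut A) n ε s ∧
      ∀ z ∈ s, ∃ i < n, ε ≤ dist ((toralAut A)^[i] z) 0 := by
  classical
  obtain ⟨c', hcc, hc'⟩ := EReal.lt_iff_exists_real_btwn.1 hc
  have hcc' : 0 < c' - c := sub_pos.2 (EReal.coe_lt_coe_iff.1 hcc)
  obtain ⟨ε, hε, hfreq⟩ := exists_leaf_words h hc'
  have hev := (tendsto_exp_mul_natCast hcc').eventually_ge_atTop 2
  refine ⟨ε / 2, by positivity, (hfreq.and_eventually hev).mono ?_⟩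
  rintro n ⟨⟨s, hleaf, hcard, hsep⟩, hn⟩
  set P : Torus d → Prop := fun z => ∃ i < n, ε / 2 ≤ dist ((toralAut A)^[i] z) 0 with hP
  refine ⟨s.filter P, fun z hz => hleaf z (Finset.mem_filter.1 hz).1, ?_, fun z hz z' hz' hne => ?_,
    fun z hz => (Finset.mem_filter.1 hz).2⟩
  · have h1 : (s.filter fun z => ¬ P z).card ≤ 1 := by
      rw [Finset.card_le_one]
      intro z hz z' hz'
      by_contra hne
      obtain ⟨hz, hzP⟩ := Finset.mem_filter.1 hz
      obtain ⟨hz', hzP'⟩ := Finset.mem_filter.1 hz'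
      simp only [hP, not_exists, not_and, not_le] at hzP hzP'
      obtain ⟨i, hi, hd⟩ := hsep z hz z' hz' hne
      have := dist_triangle_right ((toralAut A)^[i] z) ((toralAut A)^[i] z') 0
      linarith [hzP i hi, hzP' i hi]
    have h2 : ((s.filter P).card : ℝ) + (s.filter fun z => ¬ P z).card = s.card := by
      exact_mod_cast Finset.card_filter_add_card_filter_not P
    have h3 : ((s.filter fun z => ¬ P z).card : ℝ) ≤ 1 := by exact_mod_cast h1
    have h4 : Real.exp (c' * n) = Real.exp (c * n) * Real.exp ((c' - c) * n) := by
      rw [← Real.exp_add]; congr 1; ring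
    have h5 : 1 ≤ Real.exp (c * n) := Real.one_le_exp (by positivity)
    nlinarith
  · obtain ⟨i, hi, hd⟩ := hsep z (Finset.mem_filter.1 hz).1 z' (Finset.mem_filter.1 hz').1 hne
    exact ⟨i, hi, by linarith⟩

end words

section universal

/-! ### Toral automorphisms as targets -/

/-- Concatenating words from a fixed separated family gives many separated codes of every large
length. -/
theorem exists_codes {Y : Type*} [MetricSpace Y] {f : Y → Y} {H : Set Y} {o : Y} {δ τ ε : ℝ}
    {N n P : ℕ}
    {s : Finset Y} (hglue : GlueAt f H δ τ N) (hP : n + τ * n + N ≤ (P : ℝ)) (hP0 : 0 < P)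
    (hnP : n ≤ P)
    (hleaf : ∀ z ∈ s, z ∈ H) (hne : s.Nonempty) (hsep : Separated f n (ε + 2 * δ) s) (hε : 0 < ε)
    (hδ : 0 ≤ δ)
    (haway : ∀ z ∈ s, ∃ i < n, ε + 2 * δ ≤ dist (f^[i] z) o) (J L : ℕ) (hJ : J * P ≤ L)
    (hL : L < (J + 1) * P) :
    ∃ E : Finset Y, (∀ z ∈ E, z ∈ H) ∧ E.card = s.card ^ J ∧ Separated f L ε E ∧
      ∀ z ∈ E, ∀ a, a + 2 * P ≤ L → ∃ i, a ≤ i ∧ i < a + 2 * P ∧ ε ≤ dist (f^[i] z) o := by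
  classical
  obtain ⟨z₀, hz₀⟩ := hne
  set W : (Fin J → s) → ℕ → Y := fun φ j => if hj : j < J then φ ⟨j, hj⟩ else z₀ with hW
  have hWs : ∀ φ j, W φ j ∈ s := by
    intro φ j
    simp only [hW]
    split_ifs
    · exact Subtype.coe_prop _
    · exact hz₀
  have hW' : ∀ φ (j : Fin J), W φ j = φ j := fun φ j => by simp [hW]
  have hglue' : ∀ φ : Fin J → s, ∃ z ∈ H, ∀ j ≤ J, ∀ i < n,
      dist (f^[j * P + i] z) (f^[i] (W φ j)) ≤ δ := by
    intro φ
    refine hglue (fun j => j * P) (fun _ => n) (W φ) (fun j => hleaf _ (hWs φ j)) (fun j => ?_) J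
    push_cast
    linarith
  choose Z hZH hZ using hglue'
  have hsepZ : ∀ φ ψ, φ ≠ ψ → ∃ i < L, ε ≤ dist (f^[i] (Z φ)) (f^[i] (Z ψ)) := by
    intro φ ψ hne
    obtain ⟨j, hj⟩ := Function.ne_iff.1 hne
    obtain ⟨i, hi, hd⟩ := hsep (φ j) (φ j).2 (ψ j) (ψ j).2 fun he => hj (Subtype.ext he)
    have h1 := hZ φ j j.2.le i hi
    have h2 := hZ ψ j j.2.le i hi
    rw [hW'] at h1 h2
    refine ⟨j * P + i, ?_, ?_⟩
    · calc (j : ℕ) * P + i < j * P + P := by omega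
        _ = (j + 1) * P := by ring
        _ ≤ J * P := Nat.mul_le_mul_right _ j.2
        _ ≤ L := hJ
    · have h3 := dist_triangle4 (f^[i] (φ j : Y)) (f^[j * P + i] (Z φ)) (f^[j * P + i] (Z ψ))
        (f^[i] (ψ j : Y))
      rw [dist_comm (f^[i] (φ j : Y)) (f^[j * P + i] (Z φ))] at h3
      linarith
  have hinj : Function.Injective Z := by
    intro φ ψ he
    by_contra hne
    obtain ⟨i, -, hi⟩ := hsepZ φ ψ hne
    rw [he, dist_self] at hi
    linarith
  refine ⟨Finset.univ.image Z, fun z hz => ?_, ?_, fun z hz z' hz' hne => ?_, fun z hz a ha => ?_⟩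
  · obtain ⟨φ, -, rfl⟩ := Finset.mem_image.1 hz
    exact hZH φ
  · rw [Finset.card_image_of_injective _ hinj]
    simp
  · obtain ⟨φ, -, rfl⟩ := Finset.mem_image.1 hz
    obtain ⟨ψ, -, rfl⟩ := Finset.mem_image.1 hz'
    exact hsepZ φ ψ fun he => hne (by rw [he])
  · obtain ⟨φ, -, rfl⟩ := Finset.mem_image.1 hz
    have hdiv := Nat.div_add_mod a P
    have hmod := Nat.mod_lt a hP0
    set b := a / P with hb
    have e : (b + 1) * P = P * b + P := by ring
    have hbJ : b + 1 < J := by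
      by_contra! hle
      have h1 : (J + 1) * P ≤ (b + 1 + 1) * P := Nat.mul_le_mul_right _ (by omega)
      have h2 : (b + 1 + 1) * P = P * b + 2 * P := by ring
      omega
    obtain ⟨i, hi, hd⟩ := haway (W φ (b + 1)) (hWs φ _)
    have h1 := hZ φ (b + 1) hbJ.le i hi
    refine ⟨(b + 1) * P + i, by omega, by omega, ?_⟩
    have h2 := dist_triangle_left (f^[i] (W φ (b + 1))) o (f^[(b + 1) * P + i] (Z φ))
    linarith

variable {d : ℕ} {A : Matrix (Fin d) (Fin d) ℤ} {g p : Module.End ℝ (Fin d → ℝ)} {κ C : ℝ}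
  {D : ℝ → ℝ}

theorem exists_leaf_codes (h : IsSplitting (A.map ((↑) : ℤ → ℝ)).toLin' g p κ C D) {c : ℝ}
    (hc0 : 0 < c)
    (hc : (c : EReal) < topEntropy (toralAut A)) :
    ∃ ε : ℝ, 0 < ε ∧ ∃ s₀ L₀ : ℕ, ∀ L ≥ L₀, ∃ E : Finset (Torus d), (∀ z ∈ E, z ∈ leaf p) ∧
      Real.exp (c * L) ≤ E.card ∧ Separated (toralAut A) L ε E ∧
      ∀ z ∈ E, ∀ a, a + s₀ ≤ L → ∃ i, a ≤ i ∧ i < a + s₀ ∧ ε ≤ dist ((toralAut A)^[i] z) 0 := by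
  obtain ⟨c', hcc, hc'⟩ := EReal.lt_iff_exists_real_btwn.1 hc
  have hcc' : c < c' := EReal.coe_lt_coe_iff.1 hcc
  have hc'0 : 0 < c' := hc0.trans hcc'
  obtain ⟨ε, hε, hfreq⟩ := exists_leaf_words_away h hc'0 hc'
  set c₁ := (c + c') / 2 with hc₁
  have hc₁0 : 0 < c₁ := by rw [hc₁]; linarith
  set τ := (c' - c₁) / (3 * c₁) with hτ_def
  have hτ : 0 < τ := div_pos (by rw [hc₁]; linarith) (by positivity)
  have hτc : c₁ * (1 + 3 * τ) = c' := by rw [hτ_def]; field_simp; ring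
  obtain ⟨N, hN⟩ := exists_glueAt h (δ := ε / 4) (τ := τ) (by positivity) hτ
  have hev : ∀ᶠ n : ℕ in atTop, (N + 1 : ℝ) ≤ τ * n ∧ 1 ≤ n :=
    ((tendsto_natCast_atTop_atTop.const_mul_atTop hτ).eventually_ge_atTop _).and
    (eventually_ge_atTop 1)
  obtain ⟨n, ⟨s, hleaf, hcard, hsep, haway⟩, hn, hn1⟩ := (hfreq.and_eventually hev).exists
  set P := n + ⌈τ * n⌉₊ + N with hP
  have hceil : ⌈τ * n⌉₊ < τ * n + 1 := Nat.ceil_lt_add_one (by positivity)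
  have hPge : n + τ * n + N ≤ (P : ℝ) := by
    rw [hP]; push_cast
    linarith [Nat.le_ceil (τ * n)]
  have hPle : (P : ℝ) ≤ n * (1 + 3 * τ) := by
    rw [hP]; push_cast
    have : 0 ≤ τ * n := by positivity
    linarith
  have hP0 : 0 < P := by omega
  have hne : s.Nonempty := by
    rw [← Finset.card_pos]
    have : (0 : ℝ) < s.card := (Real.exp_pos _).trans_le hcard
    exact_mod_cast this
  have hcard' : Real.exp (c₁ * P) ≤ s.card := by
    refine le_trans (Real.exp_le_exp.2 ?_) hcard
    calc c₁ * P ≤ c₁ * (n * (1 + 3 * τ)) := by gcongr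
      _ = c₁ * (1 + 3 * τ) * n := by ring
      _ = c' * n := by rw [hτc]
  have he : ε / 2 + 2 * (ε / 4) = ε := by ring
  obtain ⟨L₀, hL₀⟩ := exists_nat_ge (c₁ * P / (c₁ - c))
  refine ⟨ε / 2, by positivity, 2 * P, L₀, fun L hL => ?_⟩
  have hdm := Nat.div_add_mod L P
  have hmod := Nat.mod_lt L hP0
  obtain ⟨E, hEH, hEcard, hEsep, hEaway⟩ := exists_codes hN hPge hP0 (by omega) hleaf hne
    (ε := ε / 2) (by rwa [he]) (by positivity) (by positivity) (by rwa [he]) (L / P) L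
    (by rw [mul_comm]; omega) (by rw [add_mul, one_mul, mul_comm]; omega)
  refine ⟨E, hEH, ?_, hEsep, hEaway⟩
  rw [hEcard]
  push_cast
  calc Real.exp (c * L) ≤ Real.exp ((L / P : ℕ) * (c₁ * P)) := by
        apply Real.exp_le_exp.2
        have h1 : (c₁ * P / (c₁ - c)) ≤ L := hL₀.trans (by exact_mod_cast hL)
        rw [div_le_iff₀ (by rw [hc₁]; linarith)] at h1
        have h2 : (L : ℝ) ≤ P * (L / P : ℕ) + P := by
          have : L ≤ P * (L / P) + P := by omega
          exact_mod_cast this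
        have h3 := mul_le_mul_of_nonneg_left h2 hc₁0.le
        linarith
    _ = Real.exp (c₁ * P) ^ (L / P) := by rw [Real.exp_nat_mul]
    _ ≤ _ := by gcongr

theorem exists_ne_zero_of_codes (h : IsSplitting (A.map ((↑) : ℤ → ℝ)).toLin' g p κ C D) {c : ℝ}
    (hc0 : 0 < c)
    (hc : (c : EReal) < topEntropy (toralAut A)) : ∃ w, p w = w ∧ w ≠ 0 := by
  obtain ⟨ε, hε, hfreq⟩ := exists_leaf_words_away h hc0 hc
  obtain ⟨n, s, hleaf, hcard, -, haway⟩ := hfreq.exists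
  obtain ⟨z, hz⟩ : s.Nonempty := by
    rw [← Finset.card_pos]
    have : (0 : ℝ) < s.card := (Real.exp_pos _).trans_le hcard
    exact_mod_cast this
  obtain ⟨w, hw, rfl⟩ := hleaf z hz
  refine ⟨w, hw, ?_⟩
  rintro rfl
  obtain ⟨i, -, hi⟩ := haway _ hz
  rw [toralAut_iterate_torusMk, map_zero, map_zero, dist_self] at hi
  linarith

theorem exists_isTarget (hA : IsUnit A.det) {c : ℝ} (hc0 : 0 < c)
    (hc : (c : EReal) < topEntropy (toralAut A)) :
    ∃ (H : Set (Torus d)) (ε : ℝ), IsTarget (toralAut A) H 0 ε c := by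
  obtain ⟨p, κ, C, D, h⟩ := exists_isSplitting (A.map ((↑) : ℤ → ℝ)) (A⁻¹.map ((↑) : ℤ → ℝ)) (by
    have := congrArg (Int.castRingHom ℝ).mapMatrix (Matrix.mul_nonsing_inv A hA)
    rwa [map_mul, map_one] at this)
  obtain ⟨ε₁, hε₁, s₀, L₀, hcodes⟩ := exists_leaf_codes h hc0 hc
  obtain ⟨w, hw, hw0⟩ := exists_ne_zero_of_codes h hc0 hc
  obtain ⟨ρ, hρ, hmark⟩ := exists_marker h hw hw0
  set ε := min ε₁ ρ / 10 with hε_def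
  have hε : 0 < ε := by positivity
  have h1 : 10 * ε ≤ ε₁ := by rw [hε_def]; linarith [min_le_left ε₁ ρ]
  have h2 : 10 * ε ≤ ρ := by rw [hε_def]; linarith [min_le_right ε₁ ρ]
  obtain ⟨s₁, hs₁⟩ := hmark ε hε
  refine ⟨leaf p, ε, continuous_toralAut A, injective_toralAut hA,
    fun z hz => toralAut_mem_leaf h hz, hε,
    fun δ hδ τ hτ => exists_glueAt h hδ hτ, ⟨s₀, L₀, fun L hL => ?_⟩, ⟨s₁, fun m => ?_⟩⟩
  · obtain ⟨E, hEH, hEcard, hEsep, hEaway⟩ := hcodes L hL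
    refine ⟨E, hEH, hEcard, fun z hz z' hz' hne => ?_, fun z hz a ha => ?_⟩
    · obtain ⟨i, hi, hd⟩ := hEsep z hz z' hz' hne
      exact ⟨i, hi, h1.trans hd⟩
    · obtain ⟨i, hi, hi', hd⟩ := hEaway z hz a ha
      exact ⟨i, hi, hi', h1.trans hd⟩
  · obtain ⟨z, hz, hnear, hfar⟩ := hs₁ m
    exact ⟨z, hz, hnear, fun i hi => h2.trans (hfar i hi)⟩

end universal

/-- **Toral automorphisms are universal.**  Every automorphism of the `d`-dimensional torus,
induced by a matrix `A ∈ GL_d(ℤ)`, is universal: every invertible ergodic measure-preserving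
transformation of a non-atomic Lebesgue probability space whose entropy is strictly less than
the topological entropy of the toral automorphism embeds into it. -/
theorem toral_automorphisms_universal {d : ℕ} (A : Matrix (Fin d) (Fin d) ℤ)
    (hA : IsUnit A.det) : Universal (toralAut A) := by
  intro X _ μ T _ _ hμ hT hlt
  have : NullSingletonClass μ := hμ
  obtain ⟨c, hc, hc'⟩ := EReal.lt_iff_exists_real_btwn.1 hlt
  have hfin : ksEntropy μ T ≠ ∞ := by
    intro he
    rw [he] at hlt
    simp at hlt
  rw [← ENNReal.ofReal_toReal hfin, EReal.coe_ennreal_ofReal, max_eq_left ENNReal.toReal_nonneg,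
    EReal.coe_lt_coe_iff] at hc
  obtain ⟨H, ε, htar⟩ := exists_isTarget hA (ENNReal.toReal_nonneg.trans_lt hc) hc'
  exact exists_embedding hT hfin htar hc
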